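/- arXiv:2302.12754 — 5 statements merged into one kernel-verified Lean document; each statement's English description precedes it below -/
import Mathlib

section
/- Let X be a complete separable metric space and Y a complete metric space. Let T be a metric space, suppose the mapping t ↦ ν_t from T to P_r(Y) is continuous in the weak topology, the mapping t ↦ μ_t from T to P_r(X) is continuous in the total variation norm, and the measures μ_t are non-atomic for all t ∈ T. Let h : X × Y × T → [0,∞) be a continuous function such that h(x,y,t) ≤ a_t(x) + b_t(y), where a_t ∈ L¹(μ_t), b_t ∈ L¹(ν_t) are nonnegative Borel functions with lim_{R→+∞} sup_{t∈T} ( ∫_{{a_t ≥ R}} a_t dμ_t + ∫_{{b_t ≥ R}} b_t dν_t ) = 0. Then for every ε > 0 one can select ε-optimal Monge mappings T_t^ε : X → Y for the cost functions h_t = h(·,·,t) and marginals (μ_t, ν_t), i.e. μ_t∘(T_t^ε)⁻¹ = ν_t for every t ∈ T and ∫ h_t(x, T_t^ε(x)) μ_t(dx) ≤ K_{h_t}(μ_t, ν_t) + ε, such that the family (T_t^ε) is continuous in t in the sense of convergence μ_t-a.e.: if t_n → t as n → ∞, then T_{t_n}^ε(x) → T_t^ε(x) for μ_t-a.e. x ∈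 X. -/
open MeasureTheory Filter Topology

noncomputable section

/-- `σ` is a coupling of `μ` and `ν`, i.e. an element of `Π(μ, ν)`: a measure on the
product whose projections onto the factors are `μ` and `ν`. -/
def IsCoupling {X Y : Type*} [MeasurableSpace X] [MeasurableSpace Y]
    (σ : Measure (X × Y)) (μ : Measure X) (ν : Measure Y) : Prop :=
  σ.map Prod.fst = μ ∧ σ.map Prod.snd = ν

/-- The Kantorovich optimal transportation cost
`K_h(μ, ν) = inf {∫ h dσ : σ ∈ Π(μ, ν)}` (for a nonnegative cost `h`). -/
def kantorovichCost {X Y : Type*} [MeasurableSpace X] [MeasurableSpace Y]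
    (h : X → Y → ℝ) (μ : Measure X) (ν : Measure Y) : ENNReal :=
  ⨅ (σ : Measure (X × Y)) (_ : IsCoupling σ μ ν), ∫⁻ p, ENNReal.ofReal (h p.1 p.2) ∂σ

/-- A family of measures `t ↦ μ t` is continuous in the weak topology generated by
integration against bounded continuous functions. -/
def WeaklyContinuousFamily {T X : Type*} [TopologicalSpace T] [TopologicalSpace X]
    [MeasurableSpace X] (μ : T → Measure X) : Prop :=
  ∀ f : BoundedContinuousFunction X ℝ, Continuous fun t => ∫ x, f x ∂(μ t)


/-- The total variation distance between two measures:
`sup_B |μ(B) − ν(B)|` over measurable sets `B` (computed in `ℝ≥0∞` via truncated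
subtraction in both directions). -/
def tvDist {X : Type*} [MeasurableSpace X] (μ ν : Measure X) : ENNReal :=
  ⨆ (s : Set X) (_ : MeasurableSet s), ((μ s - ν s) + (ν s - μ s))

/-- A family of measures `t ↦ μ t` is continuous in the total variation norm. -/
def TVContinuousFamily {T X : Type*} [TopologicalSpace T] [MeasurableSpace X]
    (μ : T → Measure X) : Prop :=
  ∀ t₀ : T, Filter.Tendsto (fun t => tvDist (μ t) (μ t₀)) (nhds t₀) (nhds 0)

set_option linter.unusedSectionVars false

def TVNear {X : Type*} [MeasurableSpace X] (μ ν : Measure X) (δ : ℝ) : Prop :=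
  ∀ f : X → ℝ, Measurable f → (∀ x, 0 ≤ f x) → (∀ x, f x ≤ 1) →
    |∫ x, f x ∂μ - ∫ x, f x ∂ν| ≤ δ

lemma integrable_bdd {X : Type*} [MeasurableSpace X] {μ : Measure X} [IsFiniteMeasure μ]
    {f : X → ℝ} (hf : Measurable f) {R : ℝ} (hR : ∀ x, |f x| ≤ R) : Integrable f μ :=
  Integrable.of_bound hf.aestronglyMeasurable R (Eventually.of_forall hR)

lemma tv_one_side {X : Type*} [MeasurableSpace X] {μ ν : Measure X} [IsProbabilityMeasure μ]
    [IsProbabilityMeasure ν] {d : ENNReal} (h : ∀ s, MeasurableSet s → μ s ≤ ν s + d)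
    (f : X → ℝ) (hf : Measurable f) (h0 : ∀ x, 0 ≤ f x) (h1 : ∀ x, f x ≤ 1) :
    ∫⁻ x, ENNReal.ofReal (f x) ∂μ ≤ ∫⁻ x, ENNReal.ofReal (f x) ∂ν + d := by
  rw [lintegral_eq_lintegral_meas_le μ (Eventually.of_forall h0) hf.aemeasurable,
    lintegral_eq_lintegral_meas_le ν (Eventually.of_forall h0) hf.aemeasurable]
  calc ∫⁻ t in Set.Ioi 0, μ {a | t ≤ f a}
      ≤ ∫⁻ t in Set.Ioi 0, (ν {a | t ≤ f a} + (Set.Iic (1:ℝ)).indicator (fun _ => d) t) := by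
        refine lintegral_mono fun t => ?_
        by_cases ht : t ≤ 1
        · simpa [ht] using h _ (measurableSet_le measurable_const hf)
        · have : {a | t ≤ f a} = ∅ := by
            ext a; simp; linarith [h1 a]
          simp [this]
    _ = (∫⁻ t in Set.Ioi 0, ν {a | t ≤ f a}) + d := by
        rw [lintegral_add_right _ (measurable_const.indicator measurableSet_Iic)]
        congr 1
        rw [lintegral_indicator measurableSet_Iic, Measure.restrict_restrict measurableSet_Iic]
        rw [Set.inter_comm, Set.Ioi_inter_Iic]; simp

lemma tvNear_of_lt {X : Type*} [MeasurableSpace X] {μ ν : Measure X} [IsProbabilityMeasure μ]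
    [IsProbabilityMeasure ν] {δ : ℝ} (hδ : 0 < δ) (h : tvDist μ ν ≤ ENNReal.ofReal δ) :
    TVNear μ ν δ := by
  have hs : ∀ s, MeasurableSet s → μ s ≤ ν s + ENNReal.ofReal δ ∧ ν s ≤ μ s + ENNReal.ofReal δ := by
    intro s hs
    have : (μ s - ν s) + (ν s - μ s) ≤ ENNReal.ofReal δ :=
      (le_iSup₂ (f := fun (s : Set X) (_ : MeasurableSet s) => ((μ s - ν s) + (ν s - μ s)))
        s hs).trans h
    exact ⟨tsub_le_iff_left.mp (le_self_add.trans this),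
      tsub_le_iff_left.mp (le_add_self.trans this)⟩
  intro f hf h0 h1
  have a1 := tv_one_side (fun s h => (hs s h).1) f hf h0 h1
  have a2 := tv_one_side (fun s h => (hs s h).2) f hf h0 h1
  have hb : ∀ x, |f x| ≤ 1 := fun x => by rw [abs_of_nonneg (h0 x)]; exact h1 x
  rw [← ofReal_integral_eq_lintegral_ofReal (integrable_bdd hf hb) (Eventually.of_forall h0),
    ← ofReal_integral_eq_lintegral_ofReal (integrable_bdd hf hb) (Eventually.of_forall h0),
    ← ENNReal.ofReal_add (integral_nonneg h0) hδ.le,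
    ENNReal.ofReal_le_ofReal_iff (add_nonneg (integral_nonneg h0) hδ.le)] at a1 a2
  rw [abs_le]; constructor <;> linarith

lemma tv_eventually {X T : Type*} [MeasurableSpace X] [TopologicalSpace T] {μ : T → Measure X}
    [∀ t, IsProbabilityMeasure (μ t)] (hμc : TVContinuousFamily μ) (t₀ : T) {δ : ℝ} (hδ : 0 < δ) :
    ∀ᶠ t in 𝓝 t₀, TVNear (μ t) (μ t₀) δ := by
  have := (hμc t₀).eventually (Iio_mem_nhds (ENNReal.ofReal_pos.2 hδ))
  filter_upwards [this] with t ht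
  exact tvNear_of_lt hδ ht.le

lemma TVNear.bdd {X : Type*} [MeasurableSpace X] {μ ν : Measure X} [IsProbabilityMeasure μ]
    [IsProbabilityMeasure ν] {δ : ℝ} (h : TVNear μ ν δ) {R : ℝ} (hR : 0 < R) {f : X → ℝ}
    (hf : Measurable f) (hb : ∀ x, |f x| ≤ R) : |∫ x, f x ∂μ - ∫ x, f x ∂ν| ≤ 2 * R * δ := by
  have h1 := h (fun x => (f x + R) / (2 * R)) (by fun_prop)
    (fun x => div_nonneg (by linarith [(abs_le.1 (hb x)).1]) (by linarith))
    (fun x => by rw [div_le_one (by linarith)]; linarith [(abs_le.1 (hb x)).2])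
  have e : ∀ (m : Measure X) [IsProbabilityMeasure m],
      ∫ x, (f x + R) / (2 * R) ∂m = (∫ x, f x ∂m + R) / (2 * R) := by
    intro m _
    rw [integral_div, integral_add (integrable_bdd hf hb) (integrable_const _)]
    simp
  rw [e μ, e ν, ← sub_div, abs_div, abs_of_pos (by linarith : (0:ℝ) < 2 * R),
    div_le_iff₀ (by linarith)] at h1
  rw [add_sub_add_right_eq_sub] at h1
  linarith

lemma tv_dct {X T ι : Type*} [MeasurableSpace X] [TopologicalSpace T] {μ : T → Measure X}
    [∀ t, IsProbabilityMeasure (μ t)] (hμc : TVContinuousFamily μ) {t₀ : T}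
    {l : Filter ι} [l.IsCountablyGenerated] {τ : ι → T} (hτ : Tendsto τ l (𝓝 t₀))
    {f : ι → X → ℝ} {f₀ : X → ℝ} (hf : ∀ᶠ i in l, Measurable (f i)) {R : ℝ} (hR : 0 < R)
    (hb : ∀ᶠ i in l, ∀ x, |f i x| ≤ R)
    (hlim : ∀ᵐ x ∂(μ t₀), Tendsto (fun i => f i x) l (𝓝 (f₀ x))) :
    Tendsto (fun i => ∫ x, f i x ∂(μ (τ i))) l (𝓝 (∫ x, f₀ x ∂(μ t₀))) := by
  have h1 : Tendsto (fun i => ∫ x, f i x ∂(μ t₀)) l (𝓝 (∫ x, f₀ x ∂(μ t₀))) :=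
    tendsto_integral_filter_of_dominated_convergence (fun _ => R)
      (hf.mono fun i h => h.aestronglyMeasurable)
      (hb.mono fun i h => Eventually.of_forall h) (integrable_const _) hlim
  have h2 : Tendsto (fun i => ∫ x, f i x ∂(μ (τ i)) - ∫ x, f i x ∂(μ t₀)) l (𝓝 0) := by
    rw [Metric.tendsto_nhds]
    intro e he
    have := hτ.eventually (tv_eventually hμc t₀ (δ := e / (4 * R)) (by positivity))
    filter_upwards [this, hf, hb] with i h3 h4 h5
    have := h3.bdd hR h4 h5
    rw [Real.dist_eq, sub_zero]
    have e2 : 2 * R * (e / (4 * R)) = e / 2 := by field_simp; norm_num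
    rw [e2] at this
    linarith
  simpa using h2.add h1

/-- Lebesgue measure on the unit interval, as a measure on the line. -/
def lam : Measure ℝ := volume.restrict (Set.Icc 0 1)

instance : IsProbabilityMeasure lam := ⟨by simp [lam]⟩

instance : NullSingletonClass lam := by unfold lam; infer_instance

lemma lam_Iic {r : ℝ} (_h0 : 0 ≤ r) (h1 : r ≤ 1) : lam (Set.Iic r) = ENNReal.ofReal r := by
  rw [lam, Measure.restrict_apply measurableSet_Iic]
  have : Set.Iic r ∩ Set.Icc 0 1 = Set.Icc 0 r := by
    ext x; simp; constructor
    · rintro ⟨a, b, c⟩; exact ⟨b, a⟩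
    · rintro ⟨a, b⟩; exact ⟨b, a, by linarith⟩
  rw [this]; simp

lemma lam_real_Iic {r : ℝ} (h0 : 0 ≤ r) (h1 : r ≤ 1) : lam.real (Set.Iic r) = r := by
  rw [measureReal_def, lam_Iic h0 h1, ENNReal.toReal_ofReal h0]

lemma eq_lam_of {m : Measure ℝ} [IsProbabilityMeasure m]
    (h : ∀ r, 0 < r → r < 1 → m.real (Set.Iic r) = r) : m = lam := by
  refine Measure.ext_of_Iic _ _ fun r => ?_
  have h' : ∀ r, 0 < r → r < 1 → m (Set.Iic r) = ENNReal.ofReal r := fun r a b => by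
    have := h r a b
    rw [← ofReal_measureReal (measure_ne_top _ _), this]
  have e1 : m (Set.Iic 0) = 0 := by
    refine le_antisymm (le_of_forall_gt_imp_ge_of_dense fun a ha => ?_) (zero_le)
    rcases eq_or_ne a ⊤ with rfl | ha'
    · exact le_top
    have hp : 0 < min a.toReal (1/2) := lt_min (ENNReal.toReal_pos ha.ne' ha') (by norm_num)
    have hq : min a.toReal (1/2) < 1 := (min_le_right _ _).trans_lt (by norm_num)
    calc m (Set.Iic 0) ≤ m (Set.Iic (min a.toReal (1/2))) :=
          measure_mono (Set.Iic_subset_Iic.2 hp.le)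
      _ = ENNReal.ofReal (min a.toReal (1/2)) := by
          rw [h' _ hp hq]
      _ ≤ ENNReal.ofReal a.toReal := ENNReal.ofReal_le_ofReal (min_le_left _ _)
      _ = a := ENNReal.ofReal_toReal ha'
  have e2 : m (Set.Iic 1) = 1 := by
    refine le_antisymm prob_le_one (le_of_forall_lt_imp_le_of_dense fun a ha => ?_)
    have hat : a ≠ ⊤ := (ha.trans ENNReal.one_lt_top).ne
    have ha1 : a.toReal < 1 := by
      rw [← ENNReal.toReal_one]; exact (ENNReal.toReal_lt_toReal hat ENNReal.one_ne_top).2 ha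
    have hp : 0 < max a.toReal (1/2) := lt_max_of_lt_right (by norm_num)
    have hq : max a.toReal (1/2) < 1 := max_lt ha1 (by norm_num)
    calc a = ENNReal.ofReal a.toReal := (ENNReal.ofReal_toReal hat).symm
      _ ≤ ENNReal.ofReal (max a.toReal (1/2)) := ENNReal.ofReal_le_ofReal (le_max_left _ _)
      _ = m (Set.Iic (max a.toReal (1/2))) := by
          rw [h' _ hp hq]
      _ ≤ m (Set.Iic 1) := measure_mono (Set.Iic_subset_Iic.2 hq.le)
  rcases le_or_gt r 0 with h0 | h0
  · have a : m (Set.Iic r) = 0 := measure_mono_null (Set.Iic_subset_Iic.2 h0) e1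
    have b : lam (Set.Iic r) = 0 := by
      refine measure_mono_null (Set.Iic_subset_Iic.2 h0) ?_
      rw [lam_Iic le_rfl zero_le_one]; simp
    rw [a, b]
  rcases lt_or_ge r 1 with h1 | h1
  · rw [lam_Iic h0.le h1.le, h' r h0 h1]
  · have a : m (Set.Iic r) = 1 :=
      le_antisymm prob_le_one (e2 ▸ measure_mono (Set.Iic_subset_Iic.2 h1))
    have b : lam (Set.Iic r) = 1 := by
      refine le_antisymm prob_le_one ?_
      calc (1 : ENNReal) = lam (Set.Iic 1) := by rw [lam_Iic zero_le_one le_rfl]; simp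
        _ ≤ _ := measure_mono (Set.Iic_subset_Iic.2 h1)
    rw [a, b]

lemma pit_meas {Ω : Type*} [MeasurableSpace Ω] (P : Measure Ω) [IsProbabilityMeasure P]
    {Z : Ω → ℝ} : Measurable (fun r => P.real {ω | Z ω ≤ r}) := by
  have : Monotone (fun r => P.real {ω | Z ω ≤ r}) := fun a b hab =>
    measureReal_mono (fun ω (h : Z ω ≤ a) => h.trans hab)
  exact this.measurable

/-- Probability integral transform. -/
lemma pit {Ω : Type*} [MeasurableSpace Ω] (P : Measure Ω) [IsProbabilityMeasure P]
    {Z : Ω → ℝ} (hZ : Measurable Z) (hat : ∀ r, P {ω | Z ω = r} = 0) :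
    P.map (fun ω => P.real {ω' | Z ω' ≤ Z ω}) = lam := by
  set F : ℝ → ℝ := fun r => P.real {ω | Z ω ≤ r} with hF
  have hFm : Measurable F := pit_meas P
  have hmono : Monotone F := fun a b hab =>
    measureReal_mono (fun ω (h : Z ω ≤ a) => h.trans hab)
  have : IsProbabilityMeasure (P.map Z) := Measure.isProbabilityMeasure_map hZ.aemeasurable
  have hFc : F = ProbabilityTheory.cdf (P.map Z) := by
    ext r
    rw [ProbabilityTheory.cdf_eq_real, measureReal_def, Measure.map_apply hZ measurableSet_Iic]
    rfl
  have hcont : Continuous F := by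
    rw [hFc, continuous_iff_continuousAt]
    intro r
    have h1 := (ProbabilityTheory.cdf (P.map Z)).measure_singleton r
    rw [ProbabilityTheory.measure_cdf, Measure.map_apply hZ (measurableSet_singleton r)] at h1
    have h2 : P (Z ⁻¹' {r}) = 0 := hat r
    rw [h2, eq_comm, ENNReal.ofReal_eq_zero] at h1
    have h3 := (ProbabilityTheory.monotone_cdf (P.map Z)).leftLim_le (le_refl r)
    rw [(ProbabilityTheory.monotone_cdf (P.map Z)).continuousAt_iff_leftLim_eq_rightLim,
      (ProbabilityTheory.cdf (P.map Z)).rightLim_eq]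
    linarith
  have hsurj : ∀ r, 0 < r → r < 1 → ∃ s, F s = r := by
    intro r h0 h1
    refine mem_range_of_exists_le_of_exists_ge hcont ?_ ?_
    · rw [hFc]
      exact ((ProbabilityTheory.tendsto_cdf_atBot (P.map Z)).eventually (Iic_mem_nhds h0)).exists
    · rw [hFc]
      exact ((ProbabilityTheory.tendsto_cdf_atTop (P.map Z)).eventually (Ici_mem_nhds h1)).exists
  have hm : Measurable (fun ω => F (Z ω)) := hFm.comp hZ
  have : IsProbabilityMeasure (P.map (fun ω => F (Z ω))) :=
    Measure.isProbabilityMeasure_map hm.aemeasurable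
  refine eq_lam_of fun r h0 h1 => ?_
  rw [measureReal_def, Measure.map_apply hm measurableSet_Iic, ← measureReal_def]
  apply le_antisymm
  · refine le_of_forall_gt_imp_ge_of_dense fun r' hr' => ?_
    have hr'' : r < min r' ((r + 1)/2) := lt_min hr' (by linarith)
    obtain ⟨s, hs⟩ := hsurj (min r' ((r + 1)/2)) (h0.trans hr'')
      ((min_le_right _ _).trans_lt (by linarith))
    calc P.real ((fun ω => F (Z ω)) ⁻¹' Set.Iic r) ≤ P.real {ω | Z ω ≤ s} := by
          refine measureReal_mono fun ω hω => ?_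
          simp only [Set.mem_preimage, Set.mem_Iic, Set.mem_ofPred_eq] at hω ⊢
          by_contra hc
          have := hmono (not_le.1 hc).le
          linarith
      _ = F s := rfl
      _ ≤ r' := by rw [hs]; exact min_le_left _ _
  · obtain ⟨s, hs⟩ := hsurj r h0 h1
    calc r = F s := hs.symm
      _ = P.real {ω | Z ω ≤ s} := rfl
      _ ≤ _ := measureReal_mono fun ω (hω : Z ω ≤ s) => (hmono hω).trans hs.le

section cum
variable {ι Z : Type*} [LinearOrder ι]

/-- Cumulative sums of a family of functions. -/
def cum (φ : ι → Z → ℝ) (k : ι) (z : Z) : ℝ := ∑ᶠ j, if j < k then φ j z else 0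

lemma cum_eq_sum {φ : ι → Z → ℝ} {z : Z} (S : Finset ι) (hS : ∀ j, φ j z ≠ 0 → j ∈ S) (k : ι) :
    cum φ k z = ∑ j ∈ S, if j < k then φ j z else 0 := by
  refine finsum_eq_sum_of_support_subset _ fun j hj => ?_
  refine hS j fun h0 => hj ?_
  simp [h0]

lemma cum_continuous [TopologicalSpace Z] {φ : ι → Z → ℝ} (hc : ∀ j, Continuous (φ j))
    (hlf : LocallyFinite fun j => Function.support (φ j)) (k : ι) : Continuous (cum φ k) := by
  refine continuous_finsum (fun j => ?_) (hlf.subset fun j z hz => ?_)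
  · split_ifs
    · exact hc j
    · exact continuous_const
  · intro h0
    apply hz
    simp [h0]

lemma cum_nonneg {φ : ι → Z → ℝ} (h0 : ∀ j z, 0 ≤ φ j z) (k : ι) (z : Z) : 0 ≤ cum φ k z :=
  finsum_nonneg fun j => by split_ifs <;> simp [h0]

lemma cum_add_le {φ : ι → Z → ℝ} (h0 : ∀ j z, 0 ≤ φ j z) {z : Z}
    (hfin : (Function.support fun j => φ j z).Finite) {i j : ι} (hij : i < j) :
    cum φ i z + φ i z ≤ cum φ j z := by
  classical
  have hS : ∀ k, φ k z ≠ 0 → k ∈ insert i hfin.toFinset := fun k hk => by simp [hk]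
  rw [cum_eq_sum _ hS, cum_eq_sum _ hS]
  have : φ i z = ∑ k ∈ insert i hfin.toFinset, if k = i then φ k z else 0 := by
    rw [Finset.sum_ite_eq' _ i]; simp
  rw [this, ← Finset.sum_add_distrib]
  refine Finset.sum_le_sum fun k _ => ?_
  rcases lt_trichotomy k i with h | h | h
  · simp [h, h.ne, h.trans hij]
  · subst h; simp [hij]
  · simp only [not_lt.2 h.le, h.ne', if_false, add_zero]
    split_ifs <;> simp [h0]

lemma cum_add_le_one {φ : ι → Z → ℝ} (h0 : ∀ j z, 0 ≤ φ j z) {z : Z}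
    (hfin : (Function.support fun j => φ j z).Finite) (hsum : ∑ᶠ j, φ j z ≤ 1) (i : ι) :
    cum φ i z + φ i z ≤ 1 := by
  classical
  refine le_trans ?_ hsum
  have hS : ∀ k, φ k z ≠ 0 → k ∈ insert i hfin.toFinset := fun k hk => by simp [hk]
  rw [cum_eq_sum _ hS, finsum_eq_sum_of_support_subset (s := insert i hfin.toFinset) _
    (fun k hk => hS k hk)]
  have : φ i z = ∑ k ∈ insert i hfin.toFinset, if k = i then φ k z else 0 := by
    rw [Finset.sum_ite_eq' _ i]; simp
  rw [this, ← Finset.sum_add_distrib]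
  refine Finset.sum_le_sum fun k _ => ?_
  rcases lt_trichotomy k i with h | h | h
  · simp [h, h.ne]
  · subst h; simp
  · simp [not_lt.2 h.le, h.ne', h0]

lemma cum_cover_aux (p : ι → ℝ) (S : Finset ι) : ∀ s, 0 ≤ s → s < ∑ j ∈ S, p j →
    ∃ k ∈ S, (∑ j ∈ S, if j < k then p j else 0) ≤ s ∧
      s < (∑ j ∈ S, if j < k then p j else 0) + p k := by
  classical
  induction S using Finset.induction_on_max with
  | empty => intro s h0 h1; simp at h1; linarith
  | insert a S ha ih =>
    intro s h0 h1
    have hna : a ∉ S := fun h => lt_irrefl _ (ha a h)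
    rw [Finset.sum_insert hna] at h1
    by_cases h : s < ∑ j ∈ S, p j
    · obtain ⟨k, hk, h2, h3⟩ := ih s h0 h
      refine ⟨k, Finset.mem_insert_of_mem hk, ?_⟩
      rw [Finset.sum_insert hna]
      simp only [not_lt.2 (ha k hk).le, if_false, zero_add]
      exact ⟨h2, h3⟩
    · refine ⟨a, Finset.mem_insert_self _ _, ?_⟩
      have : (∑ j ∈ insert a S, if j < a then p j else 0) = ∑ j ∈ S, p j := by
        rw [Finset.sum_insert hna]
        simp only [lt_irrefl, if_false, zero_add]
        exact Finset.sum_congr rfl fun j hj => by simp [ha j hj]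
      rw [this]
      constructor <;> linarith

lemma cum_cover {φ : ι → Z → ℝ} {z : Z} (S : Finset ι) (hS : ∀ j, φ j z ≠ 0 → j ∈ S)
    (hsum : ∑ᶠ j, φ j z = 1) {s : ℝ} (h0 : 0 ≤ s) (h1 : s < 1) :
    ∃ k ∈ S, cum φ k z ≤ s ∧ s < cum φ k z + φ k z := by
  rw [finsum_eq_sum_of_support_subset (s := S) _ (fun k hk => hS k hk)] at hsum
  obtain ⟨k, hk, h⟩ := cum_cover_aux (fun j => φ j z) S s h0 (hsum ▸ h1)
  exact ⟨k, hk, by rw [cum_eq_sum _ hS]; exact h⟩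

end cum

section xi
variable {Y T : Type*} [LinearOrder Y] (ψ : ℕ → Y → Y → ℝ)

def Fl : List Y → Y → ℝ
  | [], _ => 1
  | k :: l, y => Fl l y * ψ l.length k y

def Ph : List Y → Y → ℝ
  | [], _ => 0
  | k :: l, y => Ph l y + Fl ψ l y * cum (ψ l.length) k y

structure GoodPU [MetricSpace Y] : Prop where
  cont : ∀ n k, Continuous (ψ n k)
  nn : ∀ n k y, 0 ≤ ψ n k y
  lf : ∀ n, LocallyFinite fun k => Function.support (ψ n k)
  sum : ∀ n y, ∑ᶠ k, ψ n k y = 1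
  supp : ∀ n k y, ψ n k y ≠ 0 → dist y k < (1/2)^n

variable [MetricSpace Y] {ψ}

lemma GoodPU.fin (h : GoodPU ψ) (n : ℕ) (y : Y) : (Function.support fun j => ψ n j y).Finite :=
  (h.lf n).point_finite y

lemma Fl_nonneg (h : GoodPU ψ) (l : List Y) (y : Y) : 0 ≤ Fl ψ l y := by
  induction l with
  | nil => simp [Fl]
  | cons k l ih => exact mul_nonneg ih (h.nn _ _ _)

lemma Fl_cont (h : GoodPU ψ) (l : List Y) : Continuous (Fl ψ l) := by
  induction l with
  | nil => exact continuous_const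
  | cons k l ih => exact ih.mul (h.cont _ _)

lemma Ph_nonneg (h : GoodPU ψ) (l : List Y) (y : Y) : 0 ≤ Ph ψ l y := by
  induction l with
  | nil => simp [Ph]
  | cons k l ih => exact add_nonneg ih (mul_nonneg (Fl_nonneg h _ _) (cum_nonneg (h.nn _) _ _))

lemma Ph_cont (h : GoodPU ψ) (l : List Y) : Continuous (Ph ψ l) := by
  induction l with
  | nil => exact continuous_const
  | cons k l ih => exact ih.add ((Fl_cont h l).mul (cum_continuous (h.cont _) (h.lf _) k))

lemma Ph_cons (h : GoodPU ψ) (k : Y) (l : List Y) (y : Y) : Ph ψ l y ≤ Ph ψ (k :: l) y :=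
  le_add_of_nonneg_right (mul_nonneg (Fl_nonneg h _ _) (cum_nonneg (h.nn _) _ _))

lemma PhFl_cons (h : GoodPU ψ) (k : Y) (l : List Y) (y : Y) :
    Ph ψ (k :: l) y + Fl ψ (k :: l) y ≤ Ph ψ l y + Fl ψ l y := by
  have := cum_add_le_one (h.nn l.length) (h.fin _ y) (h.sum _ y).le k
  simp only [Ph, Fl]
  nlinarith [Fl_nonneg h l y]

lemma PhFl_le (h : GoodPU ψ) (l : List Y) (y : Y) : Ph ψ l y + Fl ψ l y ≤ 1 := by
  induction l with
  | nil => simp [Ph, Fl]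
  | cons k l ih => exact (PhFl_cons h k l y).trans ih

lemma PhFl_lt (h : GoodPU ψ) {k k' : Y} (hk : k < k') (l : List Y) (y : Y) :
    Ph ψ (k :: l) y + Fl ψ (k :: l) y ≤ Ph ψ (k' :: l) y := by
  have := cum_add_le (h.nn l.length) (h.fin _ y) hk
  simp only [Ph, Fl]
  nlinarith [Fl_nonneg h l y]

variable [MeasurableSpace Y] [BorelSpace Y] (ν : T → Measure Y)

variable (ψ) in
def Oset (l : List Y) : Set (T × ℝ) :=
  {p | ∫ y, Ph ψ l y ∂(ν p.1) < p.2 ∧ p.2 < ∫ y, (Ph ψ l y + Fl ψ l y) ∂(ν p.1)}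

variable [∀ t, IsProbabilityMeasure (ν t)]

lemma Ph_int (h : GoodPU ψ) (l : List Y) (m : Measure Y) [IsProbabilityMeasure m] :
    Integrable (Ph ψ l) m :=
  integrable_bdd (Ph_cont h l).measurable (R := 1) fun y => by
    rw [abs_of_nonneg (Ph_nonneg h l y)]
    linarith [PhFl_le h l y, Fl_nonneg h l y]

lemma Fl_int (h : GoodPU ψ) (l : List Y) (m : Measure Y) [IsProbabilityMeasure m] :
    Integrable (Fl ψ l) m :=
  integrable_bdd (Fl_cont h l).measurable (R := 1) fun y => by
    rw [abs_of_nonneg (Fl_nonneg h l y)]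
    linarith [PhFl_le h l y, Ph_nonneg h l y]

variable {ν}

lemma Oset_cons (h : GoodPU ψ) {k : Y} {l : List Y} {p : T × ℝ} (hp : p ∈ Oset ψ ν (k :: l)) :
    p ∈ Oset ψ ν l :=
  ⟨(integral_mono (Ph_int h _ _) (Ph_int h _ _) (Ph_cons h k l)).trans_lt hp.1,
    hp.2.trans_le (integral_mono ((Ph_int h _ _).add (Fl_int h _ _))
      ((Ph_int h _ _).add (Fl_int h _ _)) (PhFl_cons h k l))⟩

lemma Oset_inj (h : GoodPU ψ) {p : T × ℝ} : ∀ {l l' : List Y}, l.length = l'.length →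
    p ∈ Oset ψ ν l → p ∈ Oset ψ ν l' → l = l' := by
  intro l
  induction l with
  | nil => intro l' hl _ _; exact (List.length_eq_zero_iff.1 hl.symm).symm
  | cons k l ih =>
    intro l' hl h1 h2
    cases l' with
    | nil => simp at hl
    | cons k' l' =>
      have e : l = l' := ih (by simpa using hl) (Oset_cons h h1) (Oset_cons h h2)
      subst e
      have aux : ∀ {a b : Y}, a < b → p ∈ Oset ψ ν (a :: l) → p ∈ Oset ψ ν (b :: l) → False := by
        intro a b hab ha hb
        have := integral_mono ((Ph_int h (a :: l) (ν p.1)).add (Fl_int h (a :: l) (ν p.1)))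
          (Ph_int h (b :: l) (ν p.1)) (PhFl_lt h hab l)
        have h3 := ha.2
        have h4 := hb.1
        simp only [Pi.add_apply] at this
        linarith
      rcases lt_trichotomy k k' with hk | hk | hk
      · exact (aux hk h1 h2).elim
      · rw [hk]
      · exact (aux hk h2 h1).elim

lemma Oset_open [TopologicalSpace T] (h : GoodPU ψ) (hνc : WeaklyContinuousFamily ν) (l : List Y) :
    IsOpen (Oset ψ ν l) := by
  have key : ∀ f : Y → ℝ, Continuous f → (∀ y, 0 ≤ f y) → (∀ y, f y ≤ 1) →
      Continuous fun t => ∫ y, f y ∂(ν t) := by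
    intro f hf h0 h1
    exact hνc (BoundedContinuousFunction.ofNormedAddCommGroup f hf 1 fun y => by
      rw [Real.norm_eq_abs, abs_of_nonneg (h0 y)]; exact h1 y)
  have c1 := key (Ph ψ l) (Ph_cont h l) (Ph_nonneg h l)
    (fun y => by linarith [PhFl_le h l y, Fl_nonneg h l y])
  have c2 := key (fun y => Ph ψ l y + Fl ψ l y) ((Ph_cont h l).add (Fl_cont h l))
    (fun y => by linarith [Ph_nonneg h l y, Fl_nonneg h l y]) (PhFl_le h l)
  exact (isOpen_lt (c1.comp continuous_fst) continuous_snd).inter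
    (isOpen_lt continuous_snd (c2.comp continuous_fst))

lemma Oset_pos (h : GoodPU ψ) {l : List Y} {p : T × ℝ} (hp : p ∈ Oset ψ ν l) :
    ∃ y, Fl ψ l y ≠ 0 := by
  by_contra hc
  push Not at hc
  have h1 := hp.1
  have h2 := hp.2
  simp only [hc, add_zero] at h2
  linarith

variable (ψ ν) in
open Classical in
def xin (y₀ : Y) : ℕ → T × ℝ → Y
  | 0, _ => y₀
  | n + 1, p => if h : ∃ kl : Y × List Y, kl.2.length = n ∧ p ∈ Oset ψ ν (kl.1 :: kl.2)
      then h.choose.1 else xin y₀ n p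

lemma xin_eq (h : GoodPU ψ) (y₀ : Y) {k : Y} {l : List Y} {p : T × ℝ}
    (hp : p ∈ Oset ψ ν (k :: l)) : xin ψ ν y₀ (l.length + 1) p = k := by
  have hex : ∃ kl : Y × List Y, kl.2.length = l.length ∧ p ∈ Oset ψ ν (kl.1 :: kl.2) :=
    ⟨(k, l), rfl, hp⟩
  rw [xin, dif_pos hex]
  have := Oset_inj h (by simp [hex.choose_spec.1]) hex.choose_spec.2 hp
  exact (List.cons.inj this).1

lemma xin_dist (h : GoodPU ψ) (y₀ : Y) (n : ℕ) (p : T × ℝ) :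
    dist (xin ψ ν y₀ (n + 1) p) (xin ψ ν y₀ (n + 2) p) ≤ 2 * (1/2)^n := by
  by_cases hex : ∃ kl : Y × List Y, kl.2.length = n + 1 ∧ p ∈ Oset ψ ν (kl.1 :: kl.2)
  · obtain ⟨⟨k', l'⟩, hl, hp⟩ := hex
    cases l' with
    | nil => simp at hl
    | cons k l =>
      simp only [List.length_cons, Nat.add_right_cancel_iff] at hl hp
      subst hl
      have e1 := xin_eq h y₀ hp
      have e2 := xin_eq h y₀ (Oset_cons h hp)
      simp only [List.length_cons] at e1
      rw [e1, e2]
      obtain ⟨y, hy⟩ := Oset_pos h hp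
      simp only [Fl, List.length_cons] at hy
      have a1 := h.supp _ _ _ (right_ne_zero_of_mul hy)
      have a2 := h.supp _ _ _ (right_ne_zero_of_mul (left_ne_zero_of_mul hy))
      have := dist_triangle_left k k' y
      have hp : (0:ℝ) < (1/2)^l.length := by positivity
      rw [pow_succ] at a1
      linarith
  · have : xin ψ ν y₀ (n + 2) p = xin ψ ν y₀ (n + 1) p := by
      conv_lhs => rw [xin]
      rw [dif_neg hex]
    rw [this, dist_self]; positivity

lemma xin_meas [TopologicalSpace T] (h : GoodPU ψ) (hνc : WeaklyContinuousFamily ν) (y₀ : Y) (n : ℕ)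
    (t : T) : Measurable fun u => xin ψ ν y₀ n (t, u) := by
  induction n with
  | zero => exact measurable_const
  | succ n ih =>
    have hO : ∀ l : List Y, IsOpen {u : ℝ | (t, u) ∈ Oset ψ ν l} := fun l =>
      (Oset_open h hνc l).preimage (by fun_prop : Continuous fun u : ℝ => (t, u))
    intro B hB
    have : (fun u => xin ψ ν y₀ (n + 1) (t, u)) ⁻¹' B =
        (⋃ kl : Y × List Y, ⋃ (_ : kl.2.length = n ∧ kl.1 ∈ B),
          {u : ℝ | (t, u) ∈ Oset ψ ν (kl.1 :: kl.2)}) ∪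
        ((⋃ kl : Y × List Y, ⋃ (_ : kl.2.length = n),
          {u : ℝ | (t, u) ∈ Oset ψ ν (kl.1 :: kl.2)})ᶜ ∩ (fun u => xin ψ ν y₀ n (t, u)) ⁻¹' B) := by
      ext u
      by_cases hex : ∃ kl : Y × List Y, kl.2.length = n ∧ (t, u) ∈ Oset ψ ν (kl.1 :: kl.2)
      · obtain ⟨⟨k, l⟩, hl, hp⟩ := hex
        subst hl
        simp only at hp
        constructor
        · intro hu
          left
          simp only [Set.mem_preimage, xin_eq h y₀ hp] at hu
          simp only [Set.mem_iUnion]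
          exact ⟨(k, l), ⟨rfl, hu⟩, hp⟩
        · rintro (hu | hu)
          · simp only [Set.mem_iUnion] at hu
            obtain ⟨⟨k', l'⟩, ⟨h1, h2⟩, h3⟩ := hu
            have := xin_eq h y₀ h3
            simp only at h1 h2 this
            rw [h1] at this
            rwa [Set.mem_preimage, this]
          · exfalso
            apply hu.1
            simp only [Set.mem_iUnion]
            exact ⟨(k, l), rfl, hp⟩
      · have e : xin ψ ν y₀ (n + 1) (t, u) = xin ψ ν y₀ n (t, u) := by
          conv_lhs => rw [xin]
          rw [dif_neg hex]
        rw [Set.mem_preimage, e]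
        constructor
        · intro hu
          refine Or.inr ⟨?_, hu⟩
          intro hc
          simp only [Set.mem_iUnion] at hc
          obtain ⟨kl, h1, h2⟩ := hc
          exact hex ⟨kl, h1, h2⟩
        · rintro (hu | hu)
          · simp only [Set.mem_iUnion] at hu
            obtain ⟨kl, h1, h2⟩ := hu
            exact (hex ⟨kl, h1.1, h2⟩).elim
          · exact hu.2
    rw [this]
    refine ((isOpen_iUnion fun kl => isOpen_iUnion fun _ => hO _).measurableSet).union
      (MeasurableSet.inter ?_ (ih hB))
    exact ((isOpen_iUnion fun kl => isOpen_iUnion fun _ => hO _).measurableSet).compl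

lemma lists_exist (h : GoodPU ψ) {K : Set Y} (hK : IsCompact K) (n : ℕ) :
    ∃ S : Finset (List Y), (∀ l ∈ S, l.length = n) ∧ (∀ y, ∑ l ∈ S, Fl ψ l y ≤ 1) ∧
      ∀ y ∈ K, ∑ l ∈ S, Fl ψ l y = 1 := by
  classical
  induction n with
  | zero => exact ⟨{[]}, by simp, by simp [Fl], by simp [Fl]⟩
  | succ n ih =>
    obtain ⟨S, h1, h2, h3⟩ := ih
    have hfin := (h.lf n).finite_nonempty_inter_compact hK
    set A := hfin.toFinset with hA
    have hs : ∀ y, ∑ l ∈ (A ×ˢ S).image (fun kl : Y × List Y => kl.1 :: kl.2), Fl ψ l y =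
        (∑ k ∈ A, ψ n k y) * ∑ l ∈ S, Fl ψ l y := by
      intro y
      rw [Finset.sum_image, Finset.sum_product, Finset.sum_mul]
      · refine Finset.sum_congr rfl fun k _ => ?_
        rw [Finset.mul_sum]
        refine Finset.sum_congr rfl fun l hl => ?_
        simp only [Fl, h1 l hl, mul_comm]
      · rintro ⟨a, b⟩ _ ⟨c, d⟩ _ hh
        simpa using hh
    refine ⟨(A ×ˢ S).image (fun kl : Y × List Y => kl.1 :: kl.2), ?_, ?_, ?_⟩
    · intro l hl
      simp only [Finset.mem_image, Finset.mem_product] at hl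
      obtain ⟨kl, ⟨_, hl⟩, rfl⟩ := hl
      simp [h1 _ hl]
    · intro y
      rw [hs]
      have : ∑ k ∈ A, ψ n k y ≤ 1 := by
        rw [← h.sum n y, finsum_eq_sum_of_support_subset (s := A ∪ (h.fin n y).toFinset) _
          (fun k hk => by
            have : ψ n k y ≠ 0 := hk
            simp [this])]
        exact Finset.sum_le_sum_of_subset_of_nonneg Finset.subset_union_left
          fun _ _ _ => h.nn _ _ _
      exact mul_le_one₀ this (Finset.sum_nonneg fun l _ => Fl_nonneg h l y) (h2 y)
    · intro y hy
      rw [hs, h3 y hy, mul_one, ← h.sum n y, finsum_eq_sum_of_support_subset (s := A)]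
      intro k hk
      simp only [hA, Set.Finite.coe_toFinset]
      exact ⟨y, hk, hy⟩
end xi

section xi2
variable {Y T : Type*} [LinearOrder Y] {ψ : ℕ → Y → Y → ℝ} [MetricSpace Y]
  [MeasurableSpace Y] [BorelSpace Y] {ν : T → Measure Y} [∀ t, IsProbabilityMeasure (ν t)]

lemma Oset_slice (t : T) (l : List Y) : {u : ℝ | (t, u) ∈ Oset ψ ν l} =
    Set.Ioo (∫ y, Ph ψ l y ∂(ν t)) (∫ y, (Ph ψ l y + Fl ψ l y) ∂(ν t)) := rfl

lemma Oset_lam (h : GoodPU ψ) (t : T) (l : List Y) :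
    lam.real {u : ℝ | (t, u) ∈ Oset ψ ν l} = ∫ y, Fl ψ l y ∂(ν t) := by
  have i1 := Ph_int h l (ν t)
  have i2 := Fl_int h l (ν t)
  have e : ∫ y, (Ph ψ l y + Fl ψ l y) ∂(ν t) = ∫ y, Ph ψ l y ∂(ν t) + ∫ y, Fl ψ l y ∂(ν t) :=
    integral_add i1 i2
  have h0 : 0 ≤ ∫ y, Ph ψ l y ∂(ν t) := integral_nonneg (Ph_nonneg h l)
  have h1 : 0 ≤ ∫ y, Fl ψ l y ∂(ν t) := integral_nonneg (Fl_nonneg h l)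
  have h2 : ∫ y, (Ph ψ l y + Fl ψ l y) ∂(ν t) ≤ 1 := by
    have := integral_mono (i1.add i2) (integrable_const (1:ℝ)) (PhFl_le h l)
    simpa using this
  rw [Oset_slice, measureReal_def, lam, Measure.restrict_apply measurableSet_Ioo,
    Set.inter_eq_left.2, Real.volume_Ioo, ENNReal.toReal_ofReal, e]
  · ring
  · rw [e]; linarith
  · intro u hu
    exact ⟨by linarith [hu.1], by linarith [hu.2]⟩

lemma Oset_cover [TopologicalSpace T] (h : GoodPU ψ) (hνc : WeaklyContinuousFamily ν) (t : T)
    [(ν t).InnerRegular] (n : ℕ) {δ : ℝ} (hδ : 0 < δ) :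
    ∃ S : Finset (List Y), (∀ l ∈ S, l.length = n) ∧ (∀ y, ∑ l ∈ S, Fl ψ l y ≤ 1) ∧
      lam.real (⋃ l ∈ S, {u : ℝ | (t, u) ∈ Oset ψ ν l})ᶜ ≤ δ := by
  obtain ⟨K, -, hK, hKδ⟩ : ∃ K ⊆ (Set.univ : Set Y), IsCompact K ∧ ENNReal.ofReal (1 - δ) < (ν t) K := by
    refine MeasurableSet.univ.exists_lt_isCompact ?_
    rw [measure_univ, ← ENNReal.ofReal_one]
    exact (ENNReal.ofReal_lt_ofReal_iff (by norm_num)).2 (by linarith)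
  obtain ⟨S, h1, h2, h3⟩ := lists_exist h hK n
  refine ⟨S, h1, h2, ?_⟩
  have hO : ∀ l : List Y, IsOpen {u : ℝ | (t, u) ∈ Oset ψ ν l} := fun l =>
      (Oset_open h hνc l).preimage (by fun_prop : Continuous fun u : ℝ => (t, u))
  have hm : MeasurableSet (⋃ l ∈ S, {u : ℝ | (t, u) ∈ Oset ψ ν l}) :=
    (isOpen_iUnion fun l => isOpen_iUnion fun _ => hO l).measurableSet
  rw [probReal_compl_eq_one_sub hm, measureReal_biUnion_finset]
  · have e : ∑ l ∈ S, lam.real {u : ℝ | (t, u) ∈ Oset ψ ν l} = ∫ y, ∑ l ∈ S, Fl ψ l y ∂(ν t) := by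
      rw [integral_finsetSum _ fun l _ => Fl_int h l _]
      exact Finset.sum_congr rfl fun l _ => Oset_lam h t l
    rw [e]
    have : (ν t).real K ≤ ∫ y, ∑ l ∈ S, Fl ψ l y ∂(ν t) := by
      rw [← integral_indicator_one hK.isClosed.measurableSet]
      refine integral_mono ((integrable_const (1:ℝ)).indicator hK.isClosed.measurableSet)
        (integrable_finsetSum _ fun l _ => Fl_int h l _) fun y => ?_
      by_cases hy : y ∈ K
      · simp [hy, h3 y hy]
      · simp only [hy, not_false_eq_true, Set.indicator_of_notMem]
        exact Finset.sum_nonneg fun l _ => Fl_nonneg h l y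
    have h4 : 1 - δ ≤ (ν t).real K := by
      rw [measureReal_def]
      exact (ENNReal.ofReal_le_iff_le_toReal (measure_ne_top _ _)).1 hKδ.le
    linarith
  · intro l hl l' hl' hne
    refine Set.disjoint_left.2 fun u hu hu' => hne ?_
    exact Oset_inj h (by rw [h1 l hl, h1 l' hl']) hu hu'
  · intro l _; exact (hO l).measurableSet

variable [CompleteSpace Y] [TopologicalSpace T]

theorem xi_exists_aux (h : GoodPU ψ) (hνc : WeaklyContinuousFamily ν) [∀ t, (ν t).InnerRegular]
    (y₀ : Y) :
    ∃ (ξ : T × ℝ → Y) (Gd : T → Set ℝ), (∀ t, Measurable fun u => ξ (t, u)) ∧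
      (∀ t, lam.map (fun u => ξ (t, u)) = ν t) ∧ (∀ t, MeasurableSet (Gd t)) ∧
      (∀ t, ∀ᵐ u ∂lam, u ∈ Gd t) ∧ ∀ t, ∀ u ∈ Gd t, ContinuousAt ξ (t, u) := by
  have hcau : ∀ p : T × ℝ, ∃ y, Tendsto (fun n => xin ψ ν y₀ (n + 1) p) atTop (𝓝 y) := fun p =>
    cauchySeq_tendsto_of_complete
      (cauchySeq_of_le_geometric (1/2) 2 (by norm_num) fun n => xin_dist h y₀ n p)
  choose ξ hξ using hcau
  have hd : ∀ p n, dist (xin ψ ν y₀ (n + 1) p) (ξ p) ≤ 4 * (1/2)^n := by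
    intro p n
    have := dist_le_of_le_geometric_of_tendsto (1/2) 2 (by norm_num)
      (fun n => xin_dist h y₀ n p) (hξ p) n
    refine this.trans (le_of_eq ?_)
    norm_num; ring
  have hO : ∀ t, ∀ l : List Y, IsOpen {u : ℝ | (t, u) ∈ Oset ψ ν l} := fun t l =>
      (Oset_open h hνc l).preimage (by fun_prop : Continuous fun u : ℝ => (t, u))
  have hξm : ∀ t, Measurable fun u => ξ (t, u) := fun t =>
    measurable_of_tendsto_metrizable (fun n => xin_meas h hνc y₀ (n + 1) t)
      (tendsto_pi_nhds.2 fun u => hξ (t, u))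
  refine ⟨ξ, fun t => ⋂ n : ℕ, ⋃ l : List Y, ⋃ (_ : l.length = n), {u : ℝ | (t, u) ∈ Oset ψ ν l},
    hξm, ?_, ?_, ?_, ?_⟩
  · intro t
    have hpm : IsProbabilityMeasure (lam.map fun u => ξ (t, u)) :=
      Measure.isProbabilityMeasure_map (hξm t).aemeasurable
    have key : ∀ F : Set Y, IsClosed F → (lam.map fun u => ξ (t, u)) F ≤ ν t F := by
      intro F hF
      have h1 : ∀ n : ℕ, (lam.map fun u => ξ (t, u)).real F ≤
          (ν t).real (Metric.thickening (6 * (1/2)^n) F) + (1/2)^n := by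
        intro n
        obtain ⟨S, s1, s2, s3⟩ := Oset_cover h hνc t (n + 1) (δ := (1/2)^n) (by positivity)
        classical
        set S' := S.filter fun l => ∃ k l', l = k :: l' ∧ ∃ z ∈ F, dist k z ≤ 4 * (1/2)^n with hS'
        have hsub : (fun u => ξ (t, u)) ⁻¹' F ⊆
            (⋃ l ∈ S, {u : ℝ | (t, u) ∈ Oset ψ ν l})ᶜ ∪
              ⋃ l ∈ S', {u : ℝ | (t, u) ∈ Oset ψ ν l} := by
          intro u hu
          by_cases hc : u ∈ (⋃ l ∈ S, {u : ℝ | (t, u) ∈ Oset ψ ν l})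
          · right
            simp only [Set.mem_iUnion] at hc ⊢
            obtain ⟨l, hl, hul⟩ := hc
            refine ⟨l, ?_, hul⟩
            rw [hS', Finset.mem_filter]
            refine ⟨hl, ?_⟩
            have hlen := s1 l hl
            cases l with
            | nil => simp at hlen
            | cons k l =>
              simp only [List.length_cons, Nat.add_right_cancel_iff] at hlen
              subst hlen
              refine ⟨k, l, rfl, ξ (t, u), hu, ?_⟩
              have := hd (t, u) l.length
              rwa [xin_eq h y₀ hul] at this
          · exact Or.inl hc
        rw [map_measureReal_apply (hξm t) hF.measurableSet]
        refine (measureReal_mono hsub).trans ((measureReal_union_le _ _).trans ?_)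
        rw [add_comm]
        refine add_le_add ((measureReal_biUnion_finset_le _ _).trans ?_) s3
        have e : ∑ l ∈ S', lam.real {u : ℝ | (t, u) ∈ Oset ψ ν l} =
            ∫ y, ∑ l ∈ S', Fl ψ l y ∂(ν t) := by
          rw [integral_finsetSum _ fun l _ => Fl_int h l _]
          exact Finset.sum_congr rfl fun l _ => Oset_lam h t l
        have hmt : MeasurableSet (Metric.thickening (6 * (1/2)^n) F) :=
          Metric.isOpen_thickening.measurableSet
        rw [e, ← integral_indicator_one hmt]
        refine integral_mono (integrable_finsetSum _ fun l _ => Fl_int h l _)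
          ((integrable_const (1:ℝ)).indicator hmt) fun y => ?_
        by_cases hy : y ∈ Metric.thickening (6 * (1/2)^n) F
        · simp only [hy, Set.indicator_of_mem, Pi.one_apply]
          exact (Finset.sum_le_sum_of_subset_of_nonneg (Finset.filter_subset _ _)
            fun l _ _ => Fl_nonneg h l y).trans (s2 y)
        · simp only [hy, not_false_eq_true, Set.indicator_of_notMem]
          refine le_of_eq (Finset.sum_eq_zero fun l hl => ?_)
          rw [hS', Finset.mem_filter] at hl
          obtain ⟨hl, k, l', rfl, z, hz, hkz⟩ := hl
          have hlen := s1 _ hl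
          simp only [List.length_cons, Nat.add_right_cancel_iff] at hlen
          subst hlen
          by_contra hne
          apply hy
          have := h.supp _ _ _ (right_ne_zero_of_mul hne)
          refine Metric.mem_thickening_iff.2 ⟨z, hz, ?_⟩
          have h5 : (0:ℝ) < (1/2)^l'.length := by positivity
          linarith [dist_triangle y k z]
      have t0 : Tendsto (fun n : ℕ => ((1/2:ℝ))^n) atTop (𝓝 0) :=
        tendsto_pow_atTop_nhds_zero_of_lt_one (by norm_num) (by norm_num)
      have t1 : Tendsto (fun r => (ν t) (Metric.thickening r F)) (𝓝[>] 0) (𝓝 (ν t F)) :=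
        tendsto_measure_thickening_of_isClosed ⟨1, one_pos, measure_ne_top _ _⟩ hF
      have t2 : Tendsto (fun n : ℕ => 6 * ((1/2:ℝ))^n) atTop (𝓝[>] 0) := by
        refine tendsto_nhdsWithin_iff.2 ⟨?_, Eventually.of_forall fun n => ?_⟩
        · simpa using t0.const_mul 6
        · have : (0:ℝ) < 6 * (1/2)^n := by positivity
          exact this
      have t3 := (ENNReal.tendsto_toReal (measure_ne_top (ν t) F)).comp (t1.comp t2)
      have t4 := ge_of_tendsto' (t3.add t0) h1
      rw [add_zero] at t4
      exact (ENNReal.toReal_le_toReal (measure_ne_top _ _) (measure_ne_top _ _)).1 t4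
    have key2 : ∀ G : Set Y, IsOpen G → ν t G ≤ (lam.map fun u => ξ (t, u)) G := by
      intro G hG
      have := key Gᶜ hG.isClosed_compl
      rw [prob_compl_eq_one_sub hG.measurableSet, prob_compl_eq_one_sub hG.measurableSet] at this
      exact (ENNReal.sub_le_sub_iff_left prob_le_one ENNReal.one_ne_top).1 this
    refine ext_of_generate_finite _ (BorelSpace.measurable_eq.trans borel_eq_generateFrom_isClosed)
      isPiSystem_isClosed (fun F hF => le_antisymm (key F hF) ?_) (by simp)
    have t1 : Tendsto (fun r => (lam.map fun u => ξ (t, u)) (Metric.thickening r F)) (𝓝[>] 0)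
        (𝓝 ((lam.map fun u => ξ (t, u)) F)) :=
        tendsto_measure_thickening_of_isClosed ⟨1, one_pos, measure_ne_top _ _⟩ hF
    refine ge_of_tendsto t1 (eventually_nhdsWithin_of_forall fun r (hr : 0 < r) => ?_)
    exact (measure_mono (Metric.self_subset_thickening hr F)).trans
      (key2 _ Metric.isOpen_thickening)
  · intro t
    exact MeasurableSet.iInter fun n =>
      (isOpen_iUnion fun l => isOpen_iUnion fun _ => hO t l).measurableSet
  · intro t
    simp only [Set.mem_iInter]
    rw [ae_all_iff]
    intro n
    have : lam.real (⋃ l : List Y, ⋃ (_ : l.length = n), {u : ℝ | (t, u) ∈ Oset ψ ν l})ᶜ ≤ 0 := by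
      refine le_of_forall_pos_le_add fun δ hδ => ?_
      obtain ⟨S, s1, s2, s3⟩ := Oset_cover h hνc t n hδ
      rw [zero_add]
      refine (measureReal_mono (Set.compl_subset_compl.2 ?_)).trans s3
      exact Set.iUnion_mono fun l => Set.iUnion_mono' fun hl => ⟨s1 l hl, le_rfl⟩
    have h0 := le_antisymm this measureReal_nonneg
    rw [measureReal_eq_zero_iff] at h0
    exact h0
  · intro t u hu
    rw [Metric.continuousAt_iff']
    intro e he
    obtain ⟨n, hn⟩ := exists_pow_lt_of_lt_one (show 0 < e / 8 by linarith)
      (show (1/2:ℝ) < 1 by norm_num)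
    have := Set.mem_iInter.1 hu (n + 1)
    simp only [Set.mem_iUnion] at this
    obtain ⟨l, hl, hul⟩ := this
    cases l with
    | nil => simp at hl
    | cons k l =>
      simp only [List.length_cons, Nat.add_right_cancel_iff] at hl
      subst hl
      filter_upwards [(Oset_open h hνc (k :: l)).mem_nhds hul] with p hp
      have a1 := hd p l.length
      have a2 := hd (t, u) l.length
      rw [xin_eq h y₀ hp] at a1
      rw [xin_eq h y₀ hul] at a2
      have := dist_triangle_left (ξ p) (ξ (t, u)) k
      linarith
end xi2

theorem goodPU_exists (Y : Type*) [LinearOrder Y] [MetricSpace Y] :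
    ∃ ψ : ℕ → Y → Y → ℝ, GoodPU ψ := by
  have : ∀ n : ℕ, ∃ f : PartitionOfUnity Y Y Set.univ,
      f.IsSubordinate fun k => Metric.ball k ((1/2)^n) := fun n =>
    PartitionOfUnity.exists_isSubordinate isClosed_univ _ (fun k => Metric.isOpen_ball)
      fun y _ => Set.mem_iUnion.2 ⟨y, Metric.mem_ball_self (by positivity)⟩
  choose f hf using this
  refine ⟨fun n k => f n k, ⟨fun n k => (f n k).continuous, fun n k y => (f n).nonneg k y,
    fun n => (f n).locallyFinite, fun n y => (f n).sum_eq_one (Set.mem_univ y), ?_⟩⟩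
  intro n k y hy
  exact hf n k (subset_tsupport _ hy)

theorem xi_exists {Y T : Type*} [MetricSpace Y] [CompleteSpace Y] [Nonempty Y]
    [MeasurableSpace Y] [BorelSpace Y] [TopologicalSpace T] {ν : T → Measure Y}
    [∀ t, IsProbabilityMeasure (ν t)] [∀ t, (ν t).InnerRegular]
    (hνc : WeaklyContinuousFamily ν) :
    ∃ (ξ : T × ℝ → Y) (Gd : T → Set ℝ), (∀ t, Measurable fun u => ξ (t, u)) ∧
      (∀ t, lam.map (fun u => ξ (t, u)) = ν t) ∧ (∀ t, MeasurableSet (Gd t)) ∧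
      (∀ t, ∀ᵐ u ∂lam, u ∈ Gd t) ∧ ∀ t, ∀ u ∈ Gd t, ContinuousAt ξ (t, u) := by
  classical
  let _ : LinearOrder Y := linearOrderOfSTO (WellOrderingRel : Y → Y → Prop)
  obtain ⟨ψ, hψ⟩ := goodPU_exists Y
  obtain ⟨y₀⟩ := ‹Nonempty Y›
  exact xi_exists_aux hψ hνc y₀

section lift
open ProbabilityTheory

lemma compProd_comap_snd {X Y U : Type*} [MeasurableSpace X] [MeasurableSpace Y]
    [MeasurableSpace U] (σ : Measure (X × Y)) [IsProbabilityMeasure σ] (κ : Kernel Y U)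
    [IsMarkovKernel κ] :
    (σ ⊗ₘ κ.comap Prod.snd measurable_snd).map (fun q => (q.1.2, q.2)) =
      (σ.map Prod.snd) ⊗ₘ κ := by
  have : IsProbabilityMeasure (σ.map Prod.snd) :=
    Measure.isProbabilityMeasure_map measurable_snd.aemeasurable
  refine Measure.ext_of_lintegral _ fun f hf => ?_
  rw [lintegral_map hf (by fun_prop), Measure.lintegral_compProd (by fun_prop),
    Measure.lintegral_compProd hf, lintegral_map (hf.lintegral_kernel_prod_right') measurable_snd]
  simp [Kernel.comap_apply]

theorem lift_coupling {X Y : Type*} [MeasurableSpace X] [MeasurableSpace Y]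
    {μ : Measure X} {ν : Measure Y} [IsProbabilityMeasure μ]
    {ξ : ℝ → Y} (hξ : Measurable ξ) (hlaw : lam.map ξ = ν) {c : X → Y → ℝ}
    (hc : Measurable fun p : X × Y => c p.1 p.2) :
    kantorovichCost (fun x u => c x (ξ u)) μ lam ≤ kantorovichCost c μ ν := by
  refine le_iInf₂ fun σ hσ => ?_
  have hσp : IsProbabilityMeasure σ := by
    constructor
    have := measure_univ (μ := μ)
    rw [← hσ.1, Measure.map_apply measurable_fst MeasurableSet.univ] at this
    simpa using this
  set κ : Kernel Y ℝ := condDistrib id ξ lam with hκ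
  set τ := σ ⊗ₘ κ.comap Prod.snd measurable_snd with hτ
  have e1 : τ.map Prod.fst = σ := Measure.fst_compProd _ _
  have e2 : τ.map (fun q => (q.1.2, q.2)) = lam.map (fun u => (ξ u, u)) := by
    rw [hτ, compProd_comap_snd, hσ.2, ← hlaw, hκ]
    exact compProd_map_condDistrib aemeasurable_id
  have m1 : Measurable fun q : (X × Y) × ℝ => (q.1.1, q.2) := by fun_prop
  set ρ := τ.map (fun q => (q.1.1, q.2)) with hρ
  have hcoup : IsCoupling ρ μ lam := by
    constructor
    · rw [hρ, Measure.map_map measurable_fst m1, ← hσ.1]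
      conv_rhs => rw [← e1]
      rw [Measure.map_map measurable_fst measurable_fst]
      rfl
    · rw [hρ, Measure.map_map measurable_snd m1]
      have : (Prod.snd ∘ fun q : (X × Y) × ℝ => (q.1.1, q.2)) =
        Prod.snd ∘ (fun q : (X × Y) × ℝ => (q.1.2, q.2)) := rfl
      rw [this, ← Measure.map_map measurable_snd (by fun_prop), e2,
        Measure.map_map measurable_snd (by fun_prop)]
      exact Measure.map_id
  have m2 : Measurable fun p : X × ℝ => (p.1, ξ p.2) := by fun_prop
  have hpush : ρ.map (fun p => (p.1, ξ p.2)) = σ := by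
    have : IsProbabilityMeasure τ := by rw [hτ]; infer_instance
    have : IsProbabilityMeasure ρ := Measure.isProbabilityMeasure_map m1.aemeasurable
    have : IsProbabilityMeasure (ρ.map (fun p => (p.1, ξ p.2))) :=
      Measure.isProbabilityMeasure_map m2.aemeasurable
    refine Measure.ext_prod fun {A B} hA hB => ?_
    rw [hρ, Measure.map_map m2 m1]
    conv_rhs => rw [← e1]
    rw [Measure.map_apply (m2.comp m1) (hA.prod hB), Measure.map_apply measurable_fst (hA.prod hB)]
    have hae : ∀ᵐ q ∂τ, (q.1.2 ∈ B ↔ ξ q.2 ∈ B) := by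
      have hs : MeasurableSet {p : Y × ℝ | p.1 ∈ B ↔ ξ p.2 ∈ B} :=
        (measurable_fst hB).iff ((hξ.comp measurable_snd) hB)
      have : ∀ᵐ p ∂(τ.map (fun q => (q.1.2, q.2))), (p.1 ∈ B ↔ ξ p.2 ∈ B) := by
        rw [e2, ae_map_iff (by fun_prop) hs]
        simp
      exact ae_of_ae_map (by fun_prop) this
    refine measure_congr ?_
    filter_upwards [hae] with q hq
    simp only [eq_iff_iff]
    change ((q.1.1 ∈ A ∧ ξ q.2 ∈ B) ↔ (q.1.1 ∈ A ∧ q.1.2 ∈ B))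
    rw [hq]
  refine (iInf₂_le ρ hcoup).trans (le_of_eq ?_)
  conv_rhs => rw [← hpush]
  rw [lintegral_map (by fun_prop) m2]
end lift

lemma abs_integral_le_of {Ω : Type*} [MeasurableSpace Ω] {P : Measure Ω} [IsProbabilityMeasure P]
    {f : Ω → ℝ} (hf : Measurable f) {R δ β : ℝ} (hR : ∀ ω, |f ω| ≤ R) (hδ : 0 ≤ δ) (hR0 : 0 ≤ R)
    (B : Set Ω) (hfB : ∀ ω, ω ∉ B → |f ω| ≤ δ) (hB : P.real B ≤ β) :
    |∫ ω, f ω ∂P| ≤ δ + R * β := by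
  set B' := {ω | δ < |f ω|} with hB'
  have hm : MeasurableSet B' := measurableSet_lt measurable_const (measurable_norm.comp hf)
  have hsub : B' ⊆ B := fun ω hω => by
    by_contra h; exact absurd (hfB ω h) (not_le.2 hω)
  have h1 : |∫ ω, f ω ∂P| ≤ ∫ ω, |f ω| ∂P := abs_integral_le_integral_abs
  have h2 : ∫ ω, |f ω| ∂P ≤ ∫ ω, (δ + B'.indicator (fun _ => R) ω) ∂P := by
    refine integral_mono (integrable_bdd hf hR).abs ?_ fun ω => ?_
    · exact (integrable_const _).add ((integrable_const _).indicator hm)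
    · by_cases h : ω ∈ B'
      · simp only [h, Set.indicator_of_mem]; linarith [hR ω]
      · simp only [h, not_false_eq_true, Set.indicator_of_notMem, add_zero]; exact not_lt.1 h
  rw [integral_add (integrable_const _) ((integrable_const _).indicator hm),
    integral_indicator hm] at h2
  simp only [integral_const, smul_eq_mul, probReal_univ, one_mul, measureReal_restrict_apply,
    MeasurableSet.univ, Set.univ_inter] at h2
  have := measureReal_mono (μ := P) hsub
  nlinarith

lemma compl_le_of {Z : Type*} [MeasurableSpace Z] (m : Measure Z) [IsProbabilityMeasure m] (A : Set Z)
    {δ' : ℝ} (hA : MeasurableSet A) (h : ENNReal.ofReal (1 - δ') < m A) : m.real Aᶜ ≤ δ' := by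
  rw [probReal_compl_eq_one_sub hA]
  have : 1 - δ' ≤ m.real A :=
    (ENNReal.ofReal_le_iff_le_toReal (measure_ne_top _ _)).1 h.le
  linarith

/-- A multi-valued map with finitely many branches of fixed weights. -/
structure MM (X : Type*) [MeasurableSpace X] where
  M : ℕ
  p : Measure (Fin M)
  prob : IsProbabilityMeasure p
  v : X × Fin M → ℝ
  meas : Measurable v
  inj : ∀ m, Function.Injective fun x => v (x, m)

attribute [instance] MM.prob

def MM.F {X : Type*} [MeasurableSpace X] (V : MM X) (m : Measure X) (r : ℝ) : ℝ :=
  (m.prod V.p).real {q | V.v q ≤ r}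

section mm
variable {X : Type*} [MeasurableSpace X] (V : MM X) (m : Measure X) [IsProbabilityMeasure m]

lemma MM.F_meas : Measurable (V.F m) := pit_meas _

lemma MM.atomless [MeasurableSingletonClass X] [NullSingletonClass m] (r : ℝ) :
    (m.prod V.p) {q | V.v q = r} = 0 := by
  rw [Measure.prod_apply_symm (measurableSet_eq_fun V.meas measurable_const)]
  rw [← lintegral_zero (μ := V.p)]
  refine lintegral_congr fun i => ?_
  refine Set.Subsingleton.measure_zero ?_ _
  intro x hx y hy
  exact V.inj i ((hx : V.v (x, i) = r).trans (hy : V.v (y, i) = r).symm)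

lemma MM.law [MeasurableSingletonClass X] [NullSingletonClass m] :
    (m.prod V.p).map (fun q => V.F m (V.v q)) = lam :=
  pit _ V.meas (V.atomless m)

lemma MM.F_nonneg (r : ℝ) : 0 ≤ V.F m r := measureReal_nonneg
lemma MM.F_le_one (r : ℝ) : V.F m r ≤ 1 := measureReal_le_one

end mm

lemma TVNear.prod {X Z : Type*} [MeasurableSpace X] [MeasurableSpace Z] {m m' : Measure X}
    [IsProbabilityMeasure m] [IsProbabilityMeasure m'] {p : Measure Z} [IsProbabilityMeasure p]
    {δ : ℝ} (h : TVNear m m' δ) : TVNear (m.prod p) (m'.prod p) δ := by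
  intro f hf h0 h1
  have hi : ∀ (m : Measure X) [IsProbabilityMeasure m], Integrable f (m.prod p) := fun m _ =>
    integrable_bdd hf (R := 1) fun x => by rw [abs_of_nonneg (h0 x)]; exact h1 x
  rw [integral_prod _ (hi m), integral_prod _ (hi m')]
  refine h _ hf.stronglyMeasurable.integral_prod_right'.measurable
    (fun x => integral_nonneg fun z => h0 _) fun x => ?_
  have hfx : Integrable (fun z => f (x, z)) p :=
    integrable_bdd (by fun_prop) (R := 1) fun z => by rw [abs_of_nonneg (h0 _)]; exact h1 _
  simpa using integral_mono hfx (integrable_const (1:ℝ)) fun z => h1 _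

lemma TVNear.real {X : Type*} [MeasurableSpace X] {m m' : Measure X} [IsProbabilityMeasure m]
    [IsProbabilityMeasure m'] {δ : ℝ} (h : TVNear m m' δ) {s : Set X} (hs : MeasurableSet s) :
    |m.real s - m'.real s| ≤ δ := by
  have := h (s.indicator 1) (measurable_one.indicator hs)
    (fun x => Set.indicator_nonneg (fun _ _ => zero_le_one) x)
    (fun x => Set.indicator_le_self' (fun _ _ => zero_le_one) x)
  rwa [integral_indicator_one hs, integral_indicator_one hs] at this

/-- The abstract reduced problem. -/
structure Cst {X T : Type*} [MetricSpace X] [MeasurableSpace X] [MetricSpace T]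
    (c : T → X → ℝ → ℝ) (Gd : T → Set ℝ) (R : ℝ) : Prop where
  R0 : 0 < R
  nn : ∀ t x u, 0 ≤ c t x u
  le : ∀ t x u, c t x u ≤ R
  meas : ∀ t, Measurable fun q : X × ℝ => c t q.1 q.2
  gm : ∀ t, MeasurableSet (Gd t)
  gae : ∀ t, ∀ᵐ u ∂lam, u ∈ Gd t
  cont : ∀ t x, ∀ u ∈ Gd t, ContinuousAt (fun q : T × X × ℝ => c q.1 q.2.1 q.2.2) (t, x, u)

section abstract_problem
universe u
variable {X : Type u} {T : Type*} [MetricSpace X] [CompleteSpace X] [TopologicalSpace.SeparableSpace X]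
  [MeasurableSpace X] [BorelSpace X] [MetricSpace T] {μ : T → Measure X}
  [∀ t, IsProbabilityMeasure (μ t)] [∀ t, NullSingletonClass (μ t)] [∀ t, (μ t).InnerRegular]
  {c : T → X → ℝ → ℝ} {Gd : T → Set ℝ} {R : ℝ}

lemma Cst.absle (hC : Cst c Gd R) (t x u) : |c t x u| ≤ R := by
  rw [abs_of_nonneg (hC.nn t x u)]; exact hC.le t x u

lemma Cst.lemL (hC : Cst c Gd R) (t₀ : T) {δ : ℝ} (hδ : 0 < δ) :
    ∃ η > 0, ∀ s, dist s t₀ < η → ∀ (Ω : Type u) [MeasurableSpace Ω] (P : Measure Ω)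
      [IsProbabilityMeasure P] (x : Ω → X) (U U' : Ω → ℝ), Measurable x → Measurable U →
      Measurable U' → P.map x = μ t₀ → P.map U = lam → P.real {ω | η ≤ |U' ω - U ω|} ≤ η →
      |∫ ω, c s (x ω) (U' ω) ∂P - ∫ ω, c t₀ (x ω) (U ω) ∂P| ≤ δ := by
  have hR0 := hC.R0
  set δ' := δ / (1 + 3 * R) with hδ'
  have hδ'0 : 0 < δ' := by positivity
  have hlt : ENNReal.ofReal (1 - δ') < 1 := by
    rw [← ENNReal.ofReal_one]
    exact (ENNReal.ofReal_lt_ofReal_iff (by norm_num)).2 (by linarith)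
  obtain ⟨K, -, hK, hKδ⟩ : ∃ K ⊆ (Set.univ : Set X), IsCompact K ∧ ENNReal.ofReal (1 - δ') < (μ t₀) K :=
    MeasurableSet.univ.exists_lt_isCompact (by rwa [measure_univ])
  have hlr : lam.InnerRegular := by unfold lam; infer_instance
  obtain ⟨L, hLG, hL, hLδ⟩ : ∃ L ⊆ Gd t₀, IsCompact L ∧ ENNReal.ofReal (1 - δ') < lam L := by
    refine (hC.gm t₀).exists_lt_isCompact ?_
    rwa [prob_compl_eq_zero_iff (hC.gm t₀) |>.1 (hC.gae t₀)]
  have hcomp : IsCompact (({t₀} : Set T) ×ˢ (K ×ˢ L)) := isCompact_singleton.prod (hK.prod hL)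
  have hunif := hcomp.uniformContinuousAt_of_continuousAt
    (fun q : T × X × ℝ => c q.1 q.2.1 q.2.2) (r := {p : ℝ × ℝ | dist p.1 p.2 < δ'}) (by
      rintro ⟨t, x, u⟩ ⟨ht, hx, hu⟩
      rw [Set.mem_singleton_iff] at ht
      simp only at ht; subst ht
      exact hC.cont _ _ _ (hLG hu)) (Metric.dist_mem_uniformity hδ'0)
  rw [Metric.mem_uniformity_dist] at hunif
  obtain ⟨η₀, hη₀, hη⟩ := hunif
  refine ⟨min η₀ δ', lt_min hη₀ hδ'0, ?_⟩
  intro s hs Ω _ P _ x U U' hx hU hU' hPx hPU hP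
  have i1 : Measurable fun ω => c s (x ω) (U' ω) := (hC.meas s).comp (hx.prodMk hU')
  have i2 : Measurable fun ω => c t₀ (x ω) (U ω) := (hC.meas t₀).comp (hx.prodMk hU)
  rw [← integral_sub (integrable_bdd i1 fun ω => hC.absle _ _ _)
    (integrable_bdd i2 fun ω => hC.absle _ _ _)]
  have := abs_integral_le_of (P := P) (i1.sub i2) (R := R) (δ := δ') (β := 3 * δ') ?_ hδ'0.le hR0.le
    ((x ⁻¹' Kᶜ ∪ U ⁻¹' Lᶜ) ∪ {ω | min η₀ δ' ≤ |U' ω - U ω|}) ?_ ?_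
  · refine this.trans (le_of_eq ?_)
    rw [hδ']; field_simp
  · intro ω
    simp only [Pi.sub_apply]
    rw [abs_le]
    constructor <;> linarith [hC.nn s (x ω) (U' ω), hC.nn t₀ (x ω) (U ω), hC.le s (x ω) (U' ω),
      hC.le t₀ (x ω) (U ω)]
  · intro ω hω
    simp only [Set.mem_union, not_or, Set.mem_preimage, Set.mem_compl_iff, not_not,
      Set.mem_ofPred_eq, not_le] at hω
    obtain ⟨⟨h1, h2⟩, h3⟩ := hω
    have := hη (a := (t₀, x ω, U ω)) (b := (s, x ω, U' ω)) (by
      rw [Prod.dist_eq, Prod.dist_eq, dist_self]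
      refine max_lt ?_ (max_lt hη₀ ?_)
      · rw [dist_comm]; exact hs.trans_le (min_le_left _ _)
      · simp only [Real.dist_eq]; rw [abs_sub_comm]; exact h3.trans_le (min_le_left _ _)) ⟨rfl, h1, h2⟩
    simp only [Pi.sub_apply]
    rw [abs_sub_comm]
    exact (le_of_lt this)
  · refine (measureReal_union_le _ _).trans ((add_le_add (measureReal_union_le _ _) hP).trans ?_)
    have a1 := compl_le_of (μ t₀) K hK.isClosed.measurableSet hKδ
    have a2 := compl_le_of lam L hL.isClosed.measurableSet hLδ
    rw [← hPx, map_measureReal_apply hx hK.isClosed.measurableSet.compl] at a1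
    rw [← hPU, map_measureReal_apply hU hL.isClosed.measurableSet.compl] at a2
    linarith [min_le_right η₀ δ']

/-- Cost of a multi map. -/
def MM.C (V : MM X) (c : X → ℝ → ℝ) (m : Measure X) : ℝ :=
  ∫ q, c q.1 (V.F m (V.v q)) ∂(m.prod V.p)

lemma MM.c_meas (V : MM X) {c : X → ℝ → ℝ} (hc : Measurable fun q : X × ℝ => c q.1 q.2) (m : Measure X)
    [IsProbabilityMeasure m] : Measurable fun q : X × Fin V.M => c q.1 (V.F m (V.v q)) :=
  hc.comp (measurable_fst.prodMk ((V.F_meas m).comp V.meas))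

lemma Cst.lemE (hC : Cst c Gd R) (hμc : TVContinuousFamily μ) (t₀ : T) {δ : ℝ} (hδ : 0 < δ) :
    ∀ᶠ s in 𝓝 t₀, ∀ V : MM X, |V.C (c s) (μ s) - V.C (c t₀) (μ t₀)| ≤ δ := by
  obtain ⟨η, hη, hL⟩ := hC.lemL (μ := μ) t₀ (half_pos hδ)
  have hR0 := hC.R0
  have hδ' : 0 < min (δ / (4 * R)) (η / 2) := by positivity
  filter_upwards [tv_eventually hμc t₀ hδ', Metric.ball_mem_nhds t₀ hη] with s hs hsη V
  have a1 := TVNear.bdd (hs.prod (p := V.p)) hR0 (V.c_meas (hC.meas s) (μ s))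
    (fun q => hC.absle _ _ _)
  have a2 := hL s hsη (X × Fin V.M) ((μ t₀).prod V.p) Prod.fst
    (fun q => V.F (μ t₀) (V.v q)) (fun q => V.F (μ s) (V.v q)) measurable_fst
    ((V.F_meas _).comp V.meas) ((V.F_meas _).comp V.meas) (by
      rw [Measure.map_fst_prod, measure_univ, one_smul]) (V.law _) (by
      have : {q : X × Fin V.M | η ≤ |V.F (μ s) (V.v q) - V.F (μ t₀) (V.v q)|} = ∅ := by
        refine Set.eq_empty_iff_forall_notMem.2 fun q hq => ?_
        have := (hs.prod (p := V.p)).real (measurableSet_le V.meas (measurable_const (a := V.v q)))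
        have h2 : η ≤ |V.F (μ s) (V.v q) - V.F (μ t₀) (V.v q)| := hq
        unfold MM.F at h2
        linarith [min_le_right (δ / (4 * R)) (η / 2)]
      rw [this]; simp [hη.le])
  have a3 : 2 * R * min (δ / (4 * R)) (η / 2) ≤ δ / 2 := by
    calc 2 * R * min (δ / (4 * R)) (η / 2) ≤ 2 * R * (δ / (4 * R)) := by
          gcongr; exact min_le_left _ _
      _ = δ / 2 := by field_simp; norm_num
  unfold MM.C
  have := abs_sub_le (∫ q, c s q.1 (V.F (μ s) (V.v q)) ∂((μ s).prod V.p))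
    (∫ q, c s q.1 (V.F (μ s) (V.v q)) ∂((μ t₀).prod V.p))
    (∫ q, c t₀ q.1 (V.F (μ t₀) (V.v q)) ∂((μ t₀).prod V.p))
  linarith
end abstract_problem

lemma exists_emb (X : Type*) [MeasurableSpace X] [StandardBorelSpace X] :
    ∃ g : X → ℝ, MeasurableEmbedding g ∧ ∀ x, 0 < g x ∧ g x < 1 := by
  obtain ⟨f, hf⟩ := exists_measurableEmbedding_real X
  have hp := Real.pi_pos
  have hc : Continuous fun r : ℝ => Real.arctan r / Real.pi + 1/2 :=
    (Real.continuous_arctan.div_const _).add continuous_const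
  have hi : Function.Injective fun r : ℝ => Real.arctan r / Real.pi + 1/2 := by
    intro a b hab
    simp only [add_left_inj] at hab
    rw [div_left_inj' hp.ne'] at hab
    exact Real.arctan_injective hab
  refine ⟨_, (hc.measurableEmbedding hi).comp hf, fun x => ?_⟩
  have h1 := Real.neg_pi_div_two_lt_arctan (f x)
  have h2 := Real.arctan_lt_pi_div_two (f x)
  simp only [Function.comp]
  constructor
  · have : -(1/2) < Real.arctan (f x) / Real.pi := by
      rw [lt_div_iff₀ hp]; linarith
    linarith
  · have : Real.arctan (f x) / Real.pi < 1/2 := by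
      rw [div_lt_iff₀ hp]; linarith
    linarith

lemma lam_Iic_le {z : ℝ} (h : 0 ≤ z) : lam.real (Set.Iic z) ≤ z := by
  rcases le_total z 1 with h1 | h1
  · exact (lam_real_Iic h h1).le
  · exact measureReal_le_one.trans h1

lemma le_lam_Iic {z : ℝ} (h : z ≤ 1) : z ≤ lam.real (Set.Iic z) := by
  rcases le_total 0 z with h1 | h1
  · exact (lam_real_Iic h1 h).ge
  · exact h1.trans measureReal_nonneg

lemma lam_mem : ∀ᵐ u ∂lam, u ∈ Set.Icc (0:ℝ) 1 := ae_restrict_mem measurableSet_Icc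

lemma F_close {Ω : Type*} [MeasurableSpace Ω] {P : Measure Ω} [IsProbabilityMeasure P]
    {U v : Ω → ℝ} (hU : Measurable U) (hlaw : P.map U = lam) {β : ℝ} (hβ : 0 < β)
    (h : P.real {ω | β ≤ |v ω - U ω|} ≤ β) :
    P.real {ω | 4 * β ≤ |P.real {ω' | v ω' ≤ v ω} - U ω|} ≤ β := by
  have hUI : ∀ z, P.real {ω | U ω ≤ z} = lam.real (Set.Iic z) := fun z => by
    rw [← hlaw, map_measureReal_apply hU measurableSet_Iic]; rfl
  have hae : ∀ᵐ ω ∂P, U ω ∈ Set.Icc (0:ℝ) 1 := by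
    have := lam_mem
    rw [← hlaw] at this
    exact ae_of_ae_map hU.aemeasurable this
  refine le_trans ?_ h
  rw [measureReal_def, measureReal_def]
  refine ENNReal.toReal_mono (measure_ne_top _ _) (measure_mono_ae ?_)
  filter_upwards [hae] with ω hω hbig
  by_contra hc
  have hc' : |v ω - U ω| < β := not_le.1 hc
  have hbig' : 4 * β ≤ |P.real {ω' | v ω' ≤ v ω} - U ω| := hbig
  rw [abs_lt] at hc'
  have a1 : P.real {ω' | v ω' ≤ v ω} ≤ (U ω + 2 * β) + β := by
    have : {ω' | v ω' ≤ v ω} ⊆ {ω' | U ω' ≤ U ω + 2 * β} ∪ {ω | β ≤ |v ω - U ω|} := by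
      intro ω' hω'
      by_cases hb : β ≤ |v ω' - U ω'|
      · exact Or.inr hb
      · left
        rw [not_le, abs_lt] at hb
        have : v ω' ≤ v ω := hω'
        change U ω' ≤ U ω + 2 * β
        linarith
    refine (measureReal_mono this).trans ((measureReal_union_le _ _).trans (add_le_add ?_ h))
    rw [hUI]; exact lam_Iic_le (by linarith [hω.1])
  have a2 : U ω - 2 * β ≤ P.real {ω' | v ω' ≤ v ω} + β := by
    have : {ω' | U ω' ≤ U ω - 2 * β} ⊆ {ω' | v ω' ≤ v ω} ∪ {ω | β ≤ |v ω - U ω|} := by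
      intro ω' hω'
      by_cases hb : β ≤ |v ω' - U ω'|
      · exact Or.inr hb
      · left
        rw [not_le, abs_lt] at hb
        have : U ω' ≤ U ω - 2 * β := hω'
        change v ω' ≤ v ω
        linarith
    refine le_trans ?_ ((measureReal_mono this).trans ((measureReal_union_le _ _).trans
      (add_le_add le_rfl h)))
    rw [hUI]; exact le_lam_Iic (by linarith [hω.2])
  have : |P.real {ω' | v ω' ≤ v ω} - U ω| ≤ 3 * β := by
    rw [abs_le]; constructor <;> linarith
  linarith

lemma represent {X : Type*} [MeasurableSpace X] {m : Measure X} [IsProbabilityMeasure m]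
    {ρ : Measure (X × ℝ)} (hρ : IsCoupling ρ m lam) :
    ∃ q : X × unitInterval → ℝ, Measurable q ∧
      (m.prod (volume : Measure unitInterval)).map (fun z => (z.1, q z)) = ρ := by
  have hρp : IsProbabilityMeasure ρ := by
    constructor
    have := measure_univ (μ := m)
    rw [← hρ.1, Measure.map_apply measurable_fst MeasurableSet.univ] at this
    simpa using this
  obtain ⟨f, hf, hfl⟩ := ProbabilityTheory.Kernel.exists_measurable_map_eq_unitInterval ρ.condKernel
  have hm : Measurable fun z : X × unitInterval => (z.1, Function.uncurry f z) := by fun_prop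
  refine ⟨Function.uncurry f, hf, ?_⟩
  have hd := ρ.disintegrate ρ.condKernel
  have hfst : ρ.fst = m := hρ.1
  rw [hfst] at hd
  rw [← hd]
  refine Measure.ext_of_lintegral _ fun φ hφ => ?_
  rw [lintegral_map hφ hm, Measure.lintegral_compProd hφ, lintegral_prod _ (by fun_prop)]
  refine lintegral_congr fun x => ?_
  rw [← hfl x, lintegral_map (by fun_prop) (by fun_prop)]
  rfl

lemma approx_step {X : Type*} [MetricSpace X] [CompleteSpace X] [TopologicalSpace.SeparableSpace X]
    [MeasurableSpace X] [BorelSpace X] {m : Measure X} [IsProbabilityMeasure m]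
    {q : X × unitInterval → ℝ} (hq : Measurable q)
    (hint : Integrable q (m.prod (volume : Measure unitInterval))) {β : ℝ} (hβ : 0 < β) :
    ∃ (V : MM X) (e : unitInterval → Fin V.M), Measurable e ∧ V.p = volume.map e ∧
      (m.prod (volume : Measure unitInterval)).real {z | β ≤ |V.v (z.1, e z.2) - q z|} ≤ β := by
  set P := m.prod (volume : Measure unitInterval) with hP
  have : SecondCountableTopology X := UniformSpace.secondCountable_of_separable X
  obtain ⟨g, hg, hgi⟩ := hint.exists_boundedContinuous_integral_sub_le (ε := β * (β / 4) / 2)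
    (by positivity)
  -- discretization
  have hnode : ∀ (M : ℕ) (s : unitInterval), (⌊(M + 1 : ℝ) * s⌋₊ : ℝ) / (M + 1) ∈ unitInterval := by
    intro M s
    have h0 : 0 ≤ (M + 1 : ℝ) * s := mul_nonneg (by positivity) s.2.1
    refine ⟨by positivity, ?_⟩
    rw [div_le_one (by positivity)]
    exact (Nat.floor_le h0).trans (mul_le_of_le_one_right (by positivity) s.2.2)
  set nd : ℕ → unitInterval → unitInterval := fun M s => ⟨_, hnode M s⟩ with hnd
  have hndm : ∀ M, Measurable (nd M) := fun M =>
    Measurable.subtype_mk (by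
      have : Measurable fun s : unitInterval => ⌊(M + 1 : ℝ) * s⌋₊ :=
        Nat.measurable_floor.comp (by fun_prop)
      fun_prop)
  have hndt : ∀ s, Tendsto (fun M => nd M s) atTop (𝓝 s) := by
    intro s
    rw [tendsto_subtype_rng]
    have := (tendsto_nat_floor_mul_div_atTop (R := ℝ) s.2.1).comp
      ((tendsto_natCast_atTop_atTop (R := ℝ)).comp (tendsto_add_atTop_nat 1))
    refine this.congr fun M => ?_
    simp only [Function.comp, hnd]
    push_cast
    rw [mul_comm]
  have hlim : Tendsto (fun M => ∫ z, |g (z.1, nd M z.2) - g z| ∂P) atTop (𝓝 (∫ z, (0:ℝ) ∂P)) := by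
    refine tendsto_integral_of_dominated_convergence (fun _ => 2 * ‖g‖) (fun M => ?_)
      (integrable_const _) (fun M => Eventually.of_forall fun z => ?_)
      (Eventually.of_forall fun z => ?_)
    · have h1 : Measurable g := g.continuous.measurable
      have : Measurable fun z : X × unitInterval => |g (z.1, nd M z.2) - g z| :=
        measurable_norm.comp ((h1.comp (measurable_fst.prodMk ((hndm M).comp measurable_snd))).sub h1)
      exact this.aestronglyMeasurable
    · rw [Real.norm_eq_abs, abs_abs, two_mul]
      exact (abs_sub _ _).trans (add_le_add (g.norm_coe_le_norm _) (g.norm_coe_le_norm _))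
    · have h1 : Tendsto (fun M => g (z.1, nd M z.2)) atTop (𝓝 (g z)) :=
        (g.continuous.tendsto _).comp (Tendsto.prodMk_nhds tendsto_const_nhds (hndt z.2))
      have h2 := (h1.sub_const (g z)).abs
      simpa using h2
  rw [integral_zero] at hlim
  obtain ⟨M, hM⟩ := (hlim.eventually (Iio_mem_nhds (show 0 < β * (β / 4) / 2 by positivity))).exists
  have hM' : ∫ z, |g (z.1, nd M z.2) - g z| ∂P < β * (β / 4) / 2 := hM
  obtain ⟨γ, hγ, hγ01⟩ := exists_emb X
  set e : unitInterval → Fin (M + 2) := fun s => ⟨⌊(M + 1 : ℝ) * s⌋₊, by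
    have : ⌊(M + 1 : ℝ) * s⌋₊ ≤ M + 1 := by
      refine Nat.floor_le_of_le ?_
      push_cast
      exact mul_le_of_le_one_right (by positivity) s.2.2
    omega⟩ with he
  have hem : Measurable e := by
    refine measurable_to_countable' fun i => ?_
    have : e ⁻¹' {i} = (fun s : unitInterval => ⌊(M + 1 : ℝ) * s⌋₊) ⁻¹' {(i : ℕ)} := by
      ext s; simp [he, Fin.ext_iff]
    rw [this]
    have : Measurable fun s : unitInterval => ⌊(M + 1 : ℝ) * s⌋₊ :=
        Nat.measurable_floor.comp (by fun_prop)
    exact this (measurableSet_singleton _)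
  have hb2 : (0:ℝ) < β / 2 := by positivity
  set rep : Fin (M + 2) → unitInterval := fun i => Set.projIcc 0 1 zero_le_one ((i : ℝ) / (M + 1)) with hrep
  have hre : ∀ s, rep (e s) = nd M s := by
    intro s
    simp only [hrep, he, hnd]
    exact Set.projIcc_of_mem zero_le_one (hnode M s)
  set w : X × Fin (M + 2) → ℝ := fun z => g (z.1, rep z.2) with hw
  have hwm : Measurable w := g.continuous.measurable.comp
    (measurable_fst.prodMk ((measurable_of_countable rep).comp measurable_snd))
  set v : X × Fin (M + 2) → ℝ := fun z => (β / 2) * (⌊w z / (β / 2)⌋ + γ z.1) with hv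
  have hvm : Measurable v := by
    have h1 : Measurable fun z => ⌊w z / (β / 2)⌋ := Int.measurable_floor.comp (by fun_prop)
    have h2 : Measurable fun z => ((⌊w z / (β / 2)⌋ : ℤ) : ℝ) := measurable_from_top.comp h1
    exact (h2.add (hγ.measurable.comp measurable_fst)).const_mul _
  have hfr : ∀ z, Int.fract (v z / (β / 2)) = γ z.1 := by
    intro z
    simp only [hv]
    rw [mul_div_cancel_left₀ _ hb2.ne', Int.fract_intCast_add, Int.fract_eq_self]
    exact ⟨(hγ01 _).1.le, (hγ01 _).2⟩
  have hvw : ∀ z, |v z - w z| ≤ β / 2 := by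
    intro z
    have h1 := Int.floor_le (w z / (β / 2))
    have h2 := Int.lt_floor_add_one (w z / (β / 2))
    have h3 := hγ01 z.1
    rw [le_div_iff₀ hb2] at h1
    rw [div_lt_iff₀ hb2] at h2
    simp only [hv]
    rw [abs_le]
    constructor <;> nlinarith
  refine ⟨⟨M + 2, volume.map e, Measure.isProbabilityMeasure_map hem.aemeasurable, v, hvm, ?_⟩, e,
    hem, rfl, ?_⟩
  · intro i x y hxy
    have h1 := hfr (x, i)
    have h2 := hfr (y, i)
    simp only at hxy
    rw [hxy, h2] at h1
    exact (hγ.injective h1).symm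
  · simp only
    have hsub : {z : X × unitInterval | β ≤ |v (z.1, e z.2) - q z|} ⊆
        {z | β / 2 ≤ |g (z.1, nd M z.2) - g z| + |q z - g z|} := by
      intro z hz
      have hz' : β ≤ |v (z.1, e z.2) - q z| := hz
      have h1 := hvw (z.1, e z.2)
      have h2 : w (z.1, e z.2) = g (z.1, nd M z.2) := by simp only [hw, hre]
      rw [h2] at h1
      change β / 2 ≤ _
      have h3 := abs_sub_le (v (z.1, e z.2)) (g (z.1, nd M z.2)) (q z)
      have h4 := abs_sub_le (g (z.1, nd M z.2)) (g z) (q z)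
      rw [abs_sub_comm (g z) (q z)] at h4
      linarith
    have h1 : Measurable g := g.continuous.measurable
    have i1 : Integrable (fun z => |g (z.1, nd M z.2) - g z|) P := by
      refine integrable_bdd (R := 2 * ‖g‖) ?_ fun z => ?_
      · exact measurable_norm.comp
          ((h1.comp (measurable_fst.prodMk ((hndm M).comp measurable_snd))).sub h1)
      · rw [abs_abs, two_mul]
        exact (abs_sub _ _).trans (add_le_add (g.norm_coe_le_norm _) (g.norm_coe_le_norm _))
    have i2 : Integrable (fun z => |q z - g z|) P := (hint.sub hgi).abs
    have hmk := mul_meas_ge_le_integral_of_nonneg (μ := P)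
      (f := fun z => |g (z.1, nd M z.2) - g z| + |q z - g z|)
      (Eventually.of_forall fun z => by simp only [Pi.zero_apply]; positivity) (i1.add i2) (β / 2)
    rw [integral_add i1 i2] at hmk
    simp only [Real.norm_eq_abs] at hg
    have := measureReal_mono (μ := P) hsub
    have hfin : β / 2 * P.real {z | β / 2 ≤ |g (z.1, nd M z.2) - g z| + |q z - g z|} ≤ β / 2 * (β / 2) := by
      linarith
    have := le_of_mul_le_mul_left hfin hb2
    linarith

section abstract_problem
universe u
variable {X : Type u} {T : Type*} [MetricSpace X] [CompleteSpace X] [TopologicalSpace.SeparableSpace X]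
  [MeasurableSpace X] [BorelSpace X] [MetricSpace T] {μ : T → Measure X}
  [∀ t, IsProbabilityMeasure (μ t)] [∀ t, NullSingletonClass (μ t)] [∀ t, (μ t).InnerRegular]
  {c : T → X → ℝ → ℝ} {Gd : T → Set ℝ} {R : ℝ}

def kk (c : X → ℝ → ℝ) (m : Measure X) : ℝ := (kantorovichCost c m lam).toReal

lemma IsCoupling.prob {Y : Type*} [MeasurableSpace Y] {m : Measure X} [IsProbabilityMeasure m]
    {n : Measure Y} {ρ : Measure (X × Y)} (hρ : IsCoupling ρ m n) : IsProbabilityMeasure ρ := by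
  constructor
  have := measure_univ (μ := m)
  rw [← hρ.1, Measure.map_apply measurable_fst MeasurableSet.univ] at this
  simpa using this

lemma Cst.ofReal_int (hC : Cst c Gd R) (t : T) {Ω : Type*} [MeasurableSpace Ω] {P : Measure Ω}
    [IsProbabilityMeasure P] {x : Ω → X} {U : Ω → ℝ} (hx : Measurable x) (hU : Measurable U) :
    ∫⁻ ω, ENNReal.ofReal (c t (x ω) (U ω)) ∂P = ENNReal.ofReal (∫ ω, c t (x ω) (U ω) ∂P) := by
  rw [ofReal_integral_eq_lintegral_ofReal]
  · exact integrable_bdd ((hC.meas t).comp (hx.prodMk hU)) fun ω => hC.absle _ _ _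
  · exact Eventually.of_forall fun ω => hC.nn _ _ _

lemma Cst.cost_lt_top (hC : Cst c Gd R) (t : T) : kantorovichCost (c t) (μ t) lam ≠ ⊤ := by
  have hcp : IsCoupling ((μ t).prod lam) (μ t) lam :=
    ⟨by rw [Measure.map_fst_prod, measure_univ, one_smul],
      by rw [Measure.map_snd_prod, measure_univ, one_smul]⟩
  refine ne_top_of_le_ne_top ?_ (iInf₂_le (f := fun (σ : Measure (X × ℝ))
    (_ : IsCoupling σ (μ t) lam) => ∫⁻ p, ENNReal.ofReal (c t p.1 p.2) ∂σ) _ hcp)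
  rw [hC.ofReal_int t measurable_fst measurable_snd]
  exact ENNReal.ofReal_ne_top

lemma Cst.ofReal_kk (hC : Cst c Gd R) (t : T) :
    ENNReal.ofReal (kk (c t) (μ t)) = kantorovichCost (c t) (μ t) lam :=
  ENNReal.ofReal_toReal (hC.cost_lt_top t)

lemma Cst.exists_coupling (hC : Cst c Gd R) (t : T) {δ : ℝ} (hδ : 0 < δ) :
    ∃ ρ, IsCoupling ρ (μ t) lam ∧ ∫ p, c t p.1 p.2 ∂ρ ≤ kk (c t) (μ t) + δ := by
  have : kantorovichCost (c t) (μ t) lam < kantorovichCost (c t) (μ t) lam + ENNReal.ofReal δ :=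
    ENNReal.lt_add_right (hC.cost_lt_top t) (ENNReal.ofReal_pos.2 hδ).ne'
  conv_lhs at this => rw [kantorovichCost]
  simp only [iInf_lt_iff] at this
  obtain ⟨ρ, hρ, h⟩ := this
  have := hρ.prob
  refine ⟨ρ, hρ, ?_⟩
  have hk0 : 0 ≤ kk (c t) (μ t) := ENNReal.toReal_nonneg
  rw [hC.ofReal_int t measurable_fst measurable_snd, ← hC.ofReal_kk t,
    ← ENNReal.ofReal_add hk0 hδ.le] at h
  exact ((ENNReal.ofReal_lt_ofReal_iff_of_nonneg (integral_nonneg fun _ => hC.nn _ _ _)).1 h).le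

lemma Cst.kk_le (hC : Cst c Gd R) (t : T) (V : MM X) : kk (c t) (μ t) ≤ V.C (c t) (μ t) := by
  have hm : Measurable fun q : X × Fin V.M => (q.1, V.F (μ t) (V.v q)) :=
    measurable_fst.prodMk ((V.F_meas _).comp V.meas)
  have hcp : IsCoupling (((μ t).prod V.p).map fun q => (q.1, V.F (μ t) (V.v q))) (μ t) lam := by
    constructor
    · rw [Measure.map_map measurable_fst hm]
      change ((μ t).prod V.p).map Prod.fst = _
      rw [Measure.map_fst_prod, measure_univ, one_smul]
    · rw [Measure.map_map measurable_snd hm]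
      exact V.law _
  have h := iInf₂_le (f := fun (σ : Measure (X × ℝ)) (_ : IsCoupling σ (μ t) lam) =>
    ∫⁻ p, ENNReal.ofReal (c t p.1 p.2) ∂σ) _ hcp
  have e : kantorovichCost (c t) (μ t) lam ≤ ENNReal.ofReal (V.C (c t) (μ t)) := by
    refine le_trans h (le_of_eq ?_)
    rw [lintegral_map ((hC.meas t).ennreal_ofReal) hm]
    exact hC.ofReal_int t measurable_fst ((V.F_meas _).comp V.meas)
  rw [← hC.ofReal_kk t] at e
  exact (ENNReal.ofReal_le_ofReal_iff (integral_nonneg fun _ => hC.nn _ _ _)).1 e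

lemma Cst.lemS (hC : Cst c Gd R) (t : T) {δ : ℝ} (hδ : 0 < δ) :
    ∃ V : MM X, V.C (c t) (μ t) ≤ kk (c t) (μ t) + δ := by
  obtain ⟨η, hη, hL⟩ := hC.lemL (μ := μ) t (half_pos hδ)
  obtain ⟨ρ, hρ, hρc⟩ := hC.exists_coupling (μ := μ) t (half_pos hδ)
  obtain ⟨q, hq, hql⟩ := represent hρ
  have hzq : Measurable fun z : X × unitInterval => (z.1, q z) := measurable_fst.prodMk hq
  set P := (μ t).prod (volume : Measure unitInterval) with hP
  have hU : P.map q = lam := by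
    rw [← hρ.2, ← hql, Measure.map_map measurable_snd hzq]
    rfl
  have hint : Integrable q P := by
    have hm := lam_mem
    rw [← hU] at hm
    refine Integrable.of_bound hq.aestronglyMeasurable 1 ?_
    filter_upwards [ae_of_ae_map hq.aemeasurable hm] with z hz
    rw [Real.norm_eq_abs, abs_of_nonneg hz.1]; exact hz.2
  obtain ⟨V, e, he, hpe, hV⟩ := approx_step hq hint (β := η / 4) (by positivity)
  have hmapE : (μ t).prod V.p = P.map (fun z => (z.1, e z.2)) := by
    have := Measure.map_prod_map (μ t) (volume : Measure unitInterval) measurable_id he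
    rw [Measure.map_id, ← hpe] at this
    exact this
  have hEm : Measurable fun z : X × unitInterval => (z.1, e z.2) := by fun_prop
  have hF : ∀ r, V.F (μ t) r = P.real {z | V.v (z.1, e z.2) ≤ r} := by
    intro r
    rw [MM.F, hmapE, map_measureReal_apply hEm (measurableSet_le V.meas measurable_const)]
    rfl
  have hcl := F_close hq hU (by positivity) hV
  simp only [← hF] at hcl
  have h1 := hL t (by simpa using hη) (X × unitInterval) P Prod.fst q
    (fun z => V.F (μ t) (V.v (z.1, e z.2))) measurable_fst hq
    ((V.F_meas _).comp (V.meas.comp hEm)) (by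
      rw [Measure.map_fst_prod, measure_univ, one_smul]) hU (by
      have : 4 * (η / 4) = η := by ring
      rw [this] at hcl
      linarith)
  refine ⟨V, ?_⟩
  have e1 : V.C (c t) (μ t) = ∫ z, c t z.1 (V.F (μ t) (V.v (z.1, e z.2))) ∂P := by
    rw [MM.C, hmapE, integral_map hEm.aemeasurable
      (V.c_meas (hC.meas t) (μ t)).aestronglyMeasurable]
  have e2 : ∫ p, c t p.1 p.2 ∂ρ = ∫ z, c t z.1 (q z) ∂P := by
    rw [← hql, integral_map hzq.aemeasurable (hC.meas t).aestronglyMeasurable]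
  rw [abs_le] at h1
  linarith

/-- Locally near-optimal multimap. -/
lemma Cst.local_opt (hC : Cst c Gd R) (hμc : TVContinuousFamily μ) (t₀ : T) {δ : ℝ} (hδ : 0 < δ) :
    ∃ V : MM X, ∀ᶠ s in 𝓝 t₀, V.C (c s) (μ s) ≤ kk (c s) (μ s) + δ := by
  obtain ⟨V, hV⟩ := hC.lemS (μ := μ) t₀ (show 0 < δ / 4 by positivity)
  refine ⟨V, ?_⟩
  filter_upwards [hC.lemE hμc t₀ (show 0 < δ / 4 by positivity)] with s hs
  obtain ⟨V', hV'⟩ := hC.lemS (μ := μ) s (show 0 < δ / 4 by positivity)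
  have h1 := abs_le.1 (hs V)
  have h2 := abs_le.1 (hs V')
  have h3 := hC.kk_le (μ := μ) t₀ V'
  linarith [h1.1, h1.2, h2.1, h2.2]

/-- lower semicontinuity -/
lemma Cst.kk_lsc (hC : Cst c Gd R) (hμc : TVContinuousFamily μ) (t₀ : T) {δ : ℝ} (hδ : 0 < δ) :
    ∀ᶠ s in 𝓝 t₀, kk (c t₀) (μ t₀) ≤ kk (c s) (μ s) + δ := by
  filter_upwards [hC.lemE hμc t₀ (show 0 < δ / 2 by positivity)] with s hs
  obtain ⟨V', hV'⟩ := hC.lemS (μ := μ) s (show 0 < δ / 2 by positivity)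
  have h2 := abs_le.1 (hs V')
  have h3 := hC.kk_le (μ := μ) t₀ V'
  linarith [h2.1, h2.2]
end abstract_problem

lemma vol_fract {N b s : ℝ} (hN : 0 < N) (hb0 : 0 ≤ b) (hb1 : b ≤ 1) (hs0 : 0 ≤ s) (hs1 : s ≤ 1) :
    |lam.real {u | u ≤ b ∧ Int.fract (N * u) < s} - s * b| ≤ 1 / N := by
  set A : ℕ → Set ℝ := fun n => ⋃ i ∈ Finset.range n, Set.Ico ((i:ℝ) / N) ((i + s) / N) with hA
  have hvol : ∀ n, volume.real (A n) = n * (s / N) := by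
    intro n
    refine (measureReal_biUnion_finset ?_ ?_ ?_).trans ?_
    rotate_left 3
    · have : ∀ i ∈ Finset.range n, volume.real (Set.Ico ((i:ℝ) / N) ((i + s) / N)) = s / N := by
        intro i _
        rw [Real.volume_real_Ico_of_le (by gcongr; linarith)]
        ring
      rw [Finset.sum_congr rfl this]; simp
    · intro i _ j _ hij
      refine Set.disjoint_left.2 fun u hu hu' => hij ?_
      rw [Set.mem_Ico, div_le_iff₀ hN, lt_div_iff₀ hN] at hu hu'
      have h1 : (i:ℝ) < j + 1 := by linarith [hu.1, hu'.2]
      have h2 : (j:ℝ) < i + 1 := by linarith [hu.2, hu'.1]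
      have h1' : i < j + 1 := by exact_mod_cast h1
      have h2' : j < i + 1 := by exact_mod_cast h2
      omega
    · intro i _; exact measurableSet_Ico
    · intro i _; simp [Real.volume_Ico]
  have hmS : MeasurableSet {u : ℝ | u ≤ b ∧ Int.fract (N * u) < s} :=
    (measurableSet_le measurable_id measurable_const).inter
      (measurableSet_lt (measurable_fract.comp (measurable_const_mul N)) measurable_const)
  have hlam : lam.real {u : ℝ | u ≤ b ∧ Int.fract (N * u) < s} =
      volume.real ({u : ℝ | u ≤ b ∧ Int.fract (N * u) < s} ∩ Set.Icc 0 1) := by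
    rw [lam, measureReal_restrict_apply hmS]
  set n := ⌊N * b⌋₊ with hn
  have hNb : 0 ≤ N * b := by positivity
  have hn1 : (n:ℝ) ≤ N * b := Nat.floor_le hNb
  have hn2 : N * b < n + 1 := Nat.lt_floor_add_one _
  have lo : A n ⊆ {u : ℝ | u ≤ b ∧ Int.fract (N * u) < s} ∩ Set.Icc 0 1 := by
    intro u hu
    simp only [hA, Set.mem_iUnion, Finset.mem_range] at hu
    obtain ⟨i, hi, hu⟩ := hu
    rw [Set.mem_Ico, div_le_iff₀ hN, lt_div_iff₀ hN] at hu
    have hi' : (i:ℝ) + 1 ≤ n := by exact_mod_cast hi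
    have hub : u ≤ b := by
      by_contra h
      push Not at h
      nlinarith [hu.2]
    have hu0 : 0 ≤ u := by
      by_contra h
      push Not at h
      have : (0:ℝ) ≤ i := by positivity
      nlinarith [hu.1]
    have hfl : ⌊N * u⌋ = (i:ℤ) := by
      rw [Int.floor_eq_iff]
      push_cast
      constructor <;> nlinarith [hu.1, hu.2]
    refine ⟨⟨hub, ?_⟩, hu0, hub.trans hb1⟩
    rw [Int.fract, hfl]
    push_cast
    nlinarith [hu.2]
  have hi : {u : ℝ | u ≤ b ∧ Int.fract (N * u) < s} ∩ Set.Icc 0 1 ⊆ A (n + 1) := by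
    rintro u ⟨⟨hub, hf⟩, hu0, hu1⟩
    simp only [hA, Set.mem_iUnion, Finset.mem_range]
    have h0 : 0 ≤ N * u := by positivity
    refine ⟨⌊N * u⌋₊, ?_, ?_⟩
    · have : ⌊N * u⌋₊ ≤ n := Nat.floor_le_floor (by gcongr)
      omega
    · rw [Set.mem_Ico, div_le_iff₀ hN, lt_div_iff₀ hN, mul_comm u N]
      refine ⟨Nat.floor_le h0, ?_⟩
      have h2 : ((⌊N * u⌋₊ : ℕ) : ℝ) = (⌊N * u⌋ : ℝ) := by
        rw [← natCast_floor_eq_intCast_floor h0]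
      rw [h2]
      have := Int.floor_add_fract (N * u)
      linarith
  have hfin : volume (A (n + 1)) ≠ ⊤ := by
    refine ne_top_of_le_ne_top ?_ (measure_biUnion_finset_le _ _)
    simp [Real.volume_Ico, ENNReal.sum_eq_top]
  have h1 := measureReal_mono (μ := volume) lo (measure_ne_top_of_subset hi hfin)
  have h2 := measureReal_mono (μ := volume) hi hfin
  rw [hvol] at h1 h2
  rw [hlam]
  push_cast at h2
  have h3 : s * b = (N * b) * (s / N) := by field_simp
  have h4 : 0 ≤ s / N := by positivity
  have h5 : s / N ≤ 1 / N := by gcongr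
  rw [abs_le]
  constructor <;> nlinarith

section mix
variable {X T : Type*} [MeasurableSpace X] (g : X → ℝ)

def GG (m : Measure X) (x : X) : ℝ := m.real {y | g y ≤ g x}
def th (m : Measure X) (N : ℝ) (x : X) : ℝ := Int.fract (N * GG g m x)

variable {g}

lemma GG_meas (hg : MeasurableEmbedding g) (m : Measure X) [IsProbabilityMeasure m] :
    Measurable (GG g m) := (pit_meas (Z := g) m).comp hg.measurable

lemma th_meas (hg : MeasurableEmbedding g) (m : Measure X) [IsProbabilityMeasure m] (N : ℝ) :
    Measurable (th g m N) := measurable_fract.comp ((GG_meas hg m).const_mul N)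

lemma GG_law (hg : MeasurableEmbedding g) (m : Measure X) [IsProbabilityMeasure m]
    [NullSingletonClass m] : m.map (GG g m) = lam :=
  pit m hg.measurable fun _ => Set.Subsingleton.measure_zero
    (fun _ hx _ hy => hg.injective (Eq.trans hx (Eq.symm hy))) _

lemma mix_base (hg : MeasurableEmbedding g) (m : Measure X) [IsProbabilityMeasure m]
    [NullSingletonClass m] {N s : ℝ} (hN : 0 < N) (hs0 : 0 ≤ s) (hs1 : s ≤ 1) (a : ℝ) :
    |m.real (g ⁻¹' Set.Iic a ∩ {x | th g m N x < s}) - s * m.real (g ⁻¹' Set.Iic a)| ≤ 1 / N := by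
  set b := m.real (g ⁻¹' Set.Iic a) with hb
  have hb0 : 0 ≤ b := measureReal_nonneg
  have hb1 : b ≤ 1 := measureReal_le_one
  have hsub : g ⁻¹' Set.Iic a ⊆ {x | GG g m x ≤ b} := by
    intro x hx
    exact measureReal_mono fun y (hy : g y ≤ g x) => le_trans hy hx
  have hmG : MeasurableSet {x | GG g m x ≤ b} := measurableSet_le (GG_meas hg m) measurable_const
  have hGb : m.real {x | GG g m x ≤ b} = b := by
    have : lam.real (Set.Iic b) = b := lam_real_Iic hb0 hb1
    rw [← GG_law hg m, map_measureReal_apply (GG_meas hg m) measurableSet_Iic] at this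
    exact this
  have hae : (g ⁻¹' Set.Iic a : Set X) =ᵐ[m] {x | GG g m x ≤ b} := by
    refine ae_eq_of_subset_of_measure_ge hsub ?_ (hg.measurable measurableSet_Iic).nullMeasurableSet
      (measure_ne_top _ _)
    rw [← ENNReal.toReal_le_toReal (measure_ne_top _ _) (measure_ne_top _ _)]
    exact hGb.le
  have e : m.real (g ⁻¹' Set.Iic a ∩ {x | th g m N x < s}) =
      lam.real {u | u ≤ b ∧ Int.fract (N * u) < s} := by
    have hmS : MeasurableSet {u : ℝ | u ≤ b ∧ Int.fract (N * u) < s} :=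
      (measurableSet_le measurable_id measurable_const).inter
        (measurableSet_lt (measurable_fract.comp (measurable_const_mul N)) measurable_const)
    rw [← GG_law hg m, map_measureReal_apply (GG_meas hg m) hmS]
    exact measureReal_congr (hae.inter (ae_eq_refl _))
  rw [e]
  exact vol_fract hN hb0 hb1 hs0 hs1

variable [TopologicalSpace T] {μ : T → Measure X} [∀ t, IsProbabilityMeasure (μ t)]
  [∀ t, NullSingletonClass (μ t)] {ι : Type*} {l : Filter ι} [l.IsCountablyGenerated]
  {τ : ι → T} {N s : ι → ℝ} {t₀ : T} {s₀ : ℝ}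

lemma tv_real_tendsto (hμc : TVContinuousFamily μ) (hτ : Tendsto τ l (𝓝 t₀)) {A : ι → Set X}
    (hA : ∀ i, MeasurableSet (A i)) :
    Tendsto (fun i => (μ (τ i)).real (A i) - (μ t₀).real (A i)) l (𝓝 0) := by
  rw [Metric.tendsto_nhds]
  intro e he
  filter_upwards [hτ.eventually (tv_eventually hμc t₀ (half_pos he))] with i hi
  rw [Real.dist_eq, sub_zero]
  linarith [hi.real (hA i)]

lemma mix_set (hg : MeasurableEmbedding g) (hg1 : ∀ x, g x ≤ 1) (hμc : TVContinuousFamily μ)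
    (hτ : Tendsto τ l (𝓝 t₀)) (hN : Tendsto N l atTop) (hs : Tendsto s l (𝓝 s₀))
    (hs01 : ∀ i, s i ∈ Set.Icc (0:ℝ) 1) {B : Set ℝ} (hB : MeasurableSet B) :
    Tendsto (fun i => (μ t₀).real (g ⁻¹' B ∩ {x | th g (μ (τ i)) (N i) x < s i})) l
      (𝓝 (s₀ * (μ t₀).real (g ⁻¹' B))) := by
  have hmE : ∀ i, MeasurableSet {x | th g (μ (τ i)) (N i) x < s i} := fun i =>
    measurableSet_lt (th_meas hg _ _) measurable_const
  have basic : ∀ a : ℝ, Tendsto (fun i => (μ t₀).real (g ⁻¹' Set.Iic a ∩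
      {x | th g (μ (τ i)) (N i) x < s i})) l (𝓝 (s₀ * (μ t₀).real (g ⁻¹' Set.Iic a))) := by
    intro a
    have hma : MeasurableSet (g ⁻¹' Set.Iic a) := hg.measurable measurableSet_Iic
    have d1 := tv_real_tendsto hμc hτ (fun i => hma.inter (hmE i))
    have d2 := tv_real_tendsto hμc hτ (fun _ => hma)
    have d3 : Tendsto (fun i => (μ (τ i)).real (g ⁻¹' Set.Iic a ∩
        {x | th g (μ (τ i)) (N i) x < s i}) - s i * (μ (τ i)).real (g ⁻¹' Set.Iic a)) l (𝓝 0) := by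
      refine squeeze_zero_norm' (a := fun i => 1 / N i) ?_ ?_
      · filter_upwards [hN.eventually_gt_atTop 0] with i hi
        exact mix_base hg (μ (τ i)) hi (hs01 i).1 (hs01 i).2 a
      · simp only [one_div]; exact tendsto_inv_atTop_zero.comp hN
    have d4 : Tendsto (fun i => s i * ((μ (τ i)).real (g ⁻¹' Set.Iic a) -
      (μ t₀).real (g ⁻¹' Set.Iic a))) l (𝓝 (s₀ * 0)) := hs.mul d2
    have d5 : Tendsto (fun i => s i * (μ t₀).real (g ⁻¹' Set.Iic a)) l
      (𝓝 (s₀ * (μ t₀).real (g ⁻¹' Set.Iic a))) := hs.mul_const _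
    have := ((d3.sub d1).add d4).add d5
    simp only [sub_zero, mul_zero, zero_add, add_zero] at this
    refine this.congr fun i => ?_
    ring
  have huniv := basic 1
  have e1 : g ⁻¹' Set.Iic 1 = Set.univ := by ext x; simp [hg1 x]
  rw [e1] at huniv
  induction B, hB using MeasurableSpace.induction_on_inter (borel_eq_generateFrom_Iic ℝ)
    isPiSystem_Iic with
  | empty => simp; exact tendsto_const_nhds
  | basic B hB =>
    obtain ⟨a, rfl⟩ := hB
    exact basic a
  | compl B hB ih =>
    have := huniv.sub ih
    have hm : MeasurableSet (g ⁻¹' B) := hg.measurable hB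
    have e2 : s₀ * (μ t₀).real (g ⁻¹' Bᶜ) =
        s₀ * (μ t₀).real Set.univ - s₀ * (μ t₀).real (g ⁻¹' B) := by
      rw [Set.preimage_compl, probReal_compl_eq_one_sub hm, probReal_univ]; ring
    rw [e2]
    refine this.congr fun i => ?_
    rw [Set.univ_inter, Set.preimage_compl, Set.inter_comm, Set.inter_comm (g ⁻¹' B)ᶜ,
      ← Set.sdiff_eq]
    have := measureReal_inter_add_sdiff (μ := μ t₀) (s := {x | th g (μ (τ i)) (N i) x < s i}) hm
    linarith
  | iUnion f hd hf ih =>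
    have hm : ∀ k, MeasurableSet (g ⁻¹' f k) := fun k => hg.measurable (hf k)
    have hsum : ∀ {E : Set X}, MeasurableSet E → HasSum (fun k => (μ t₀).real (g ⁻¹' f k ∩ E))
        ((μ t₀).real (g ⁻¹' (⋃ k, f k) ∩ E)) := by
      intro E hE
      have : g ⁻¹' (⋃ k, f k) ∩ E = ⋃ k, (g ⁻¹' f k ∩ E) := by
        rw [Set.preimage_iUnion, Set.iUnion_inter]
      rw [this]
      have hu := measure_iUnion (μ := μ t₀) (f := fun k => g ⁻¹' f k ∩ E) ?_ fun k => (hm k).inter hE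
      · have h1 : ∑' k, μ t₀ (g ⁻¹' f k ∩ E) ≠ ⊤ := hu ▸ measure_ne_top _ _
        have h2 := ENNReal.hasSum_toReal h1
        rw [← ENNReal.tsum_toReal_eq (fun _ => measure_ne_top _ _), ← hu] at h2
        exact h2
      intro i j hij
      exact ((hd hij).preimage g).mono Set.inter_subset_left Set.inter_subset_left
    have h0 := hsum MeasurableSet.univ
    simp only [Set.inter_univ] at h0
    have := tendsto_tsum_of_dominated_convergence (f := fun i k => (μ t₀).real (g ⁻¹' f k ∩
      {x | th g (μ (τ i)) (N i) x < s i})) (g := fun k => s₀ * (μ t₀).real (g ⁻¹' f k)) h0.summable ih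
      (Eventually.of_forall fun i k => by
        rw [Real.norm_eq_abs, abs_of_nonneg measureReal_nonneg]
        exact measureReal_mono Set.inter_subset_left)
    rw [tsum_mul_left, h0.tsum_eq] at this
    refine this.congr fun i => ?_
    exact (hsum (hmE i)).tsum_eq

lemma mix_fun (hg : MeasurableEmbedding g) (hg1 : ∀ x, g x ≤ 1) (hμc : TVContinuousFamily μ)
    (hτ : Tendsto τ l (𝓝 t₀)) (hN : Tendsto N l atTop) (hs : Tendsto s l (𝓝 s₀))
    (hs01 : ∀ i, s i ∈ Set.Icc (0:ℝ) 1) {f : X → ℝ} (hf : Measurable f) {R : ℝ}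
    (h0 : ∀ x, 0 ≤ f x) (hR : ∀ x, f x ≤ R) :
    Tendsto (fun i => ∫ x in {x | th g (μ (τ i)) (N i) x < s i}, f x ∂(μ t₀)) l
      (𝓝 (s₀ * ∫ x, f x ∂(μ t₀))) := by
  have hab : ∀ x, |f x| ≤ R := fun x => by rw [abs_of_nonneg (h0 x)]; exact hR x
  have hmE : ∀ i, MeasurableSet {x | th g (μ (τ i)) (N i) x < s i} := fun i =>
    measurableSet_lt (th_meas hg _ _) measurable_const
  have hlc : ∀ (m : Measure X) [IsFiniteMeasure m], ∫ x, f x ∂m =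
      ∫ r in Set.Ioc 0 R, m.real {x | r ≤ f x} := fun m _ =>
    Integrable.integral_eq_integral_Ioc_meas_le (integrable_bdd hf hab)
      (Eventually.of_forall h0) (Eventually.of_forall hR)
  simp only [hlc]
  rw [← integral_const_mul]
  refine tendsto_integral_filter_of_dominated_convergence (fun _ => 1)
    (Eventually.of_forall fun i => ?_)
    (Eventually.of_forall fun i => Eventually.of_forall fun r => ?_) ?_
    (Eventually.of_forall fun r => ?_)
  · have : Antitone fun r => ((μ t₀).restrict {x | th g (μ (τ i)) (N i) x < s i}).real
        {x | r ≤ f x} := fun a b hab => measureReal_mono fun x (hx : b ≤ f x) => hab.trans hx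
    exact this.measurable.aestronglyMeasurable
  · rw [Real.norm_eq_abs, abs_of_nonneg measureReal_nonneg]
    rw [measureReal_restrict_apply (measurableSet_le measurable_const hf)]
    exact measureReal_le_one
  · exact integrable_const _
  · have hm : MeasurableSet {x | r ≤ f x} := measurableSet_le measurable_const hf
    have := mix_set (B := g '' {x | r ≤ f x}) hg hg1 hμc hτ hN hs hs01 (hg.measurableSet_image' hm)
    rw [hg.injective.preimage_image] at this
    refine this.congr fun i => ?_
    rw [measureReal_restrict_apply hm]

/-- joint mixing -/
lemma mix_lt (hg : MeasurableEmbedding g) (hg1 : ∀ x, g x ≤ 1) (hμc : TVContinuousFamily μ)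
    (hτ : Tendsto τ l (𝓝 t₀)) (hN : Tendsto N l atTop) (hs : Tendsto s l (𝓝 s₀))
    (hs01 : ∀ i, s i ∈ Set.Icc (0:ℝ) 1) {f : ι → X → ℝ} {f₀ : X → ℝ} (hf : ∀ i, Measurable (f i))
    (hf₀ : Measurable f₀) {R : ℝ} (hRp : 0 < R)
    (h0 : ∀ i x, 0 ≤ f i x) (hR : ∀ i x, f i x ≤ R) (h0' : ∀ x, 0 ≤ f₀ x) (hR' : ∀ x, f₀ x ≤ R)
    (hlim : ∀ᵐ x ∂(μ t₀), Tendsto (fun i => f i x) l (𝓝 (f₀ x))) :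
    Tendsto (fun i => ∫ x, {x | th g (μ (τ i)) (N i) x < s i}.indicator (f i) x ∂(μ (τ i))) l
      (𝓝 (s₀ * ∫ x, f₀ x ∂(μ t₀))) := by
  have hmE : ∀ i, MeasurableSet {x | th g (μ (τ i)) (N i) x < s i} := fun i =>
    measurableSet_lt (th_meas hg _ _) measurable_const
  have a1 := mix_fun hg hg1 hμc hτ hN hs hs01 hf₀ h0' hR'
  have hb : ∀ i x, |{x | th g (μ (τ i)) (N i) x < s i}.indicator (f i) x| ≤ R := by
    intro i x
    by_cases hx : x ∈ {x | th g (μ (τ i)) (N i) x < s i}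
    · rw [Set.indicator_of_mem hx, abs_of_nonneg (h0 i x)]; exact hR i x
    · rw [Set.indicator_of_notMem hx, abs_zero]; exact hRp.le
  have hb' : ∀ i x, |{x | th g (μ (τ i)) (N i) x < s i}.indicator f₀ x| ≤ R := by
    intro i x
    by_cases hx : x ∈ {x | th g (μ (τ i)) (N i) x < s i}
    · rw [Set.indicator_of_mem hx, abs_of_nonneg (h0' x)]; exact hR' x
    · rw [Set.indicator_of_notMem hx, abs_zero]; exact hRp.le
  have a2 : Tendsto (fun i => ∫ x, ({x | th g (μ (τ i)) (N i) x < s i}.indicator (f i) x -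
      {x | th g (μ (τ i)) (N i) x < s i}.indicator f₀ x) ∂(μ t₀)) l (𝓝 (∫ x, (0:ℝ) ∂(μ t₀))) := by
    refine tendsto_integral_filter_of_dominated_convergence (fun _ => R + R)
      (Eventually.of_forall fun i => ?_)
      (Eventually.of_forall fun i => Eventually.of_forall fun x => ?_) (integrable_const _) ?_
    · exact (((hf i).indicator (hmE i)).sub (hf₀.indicator (hmE i))).aestronglyMeasurable
    · exact (abs_sub _ _).trans (add_le_add (hb i x) (hb' i x))
    · filter_upwards [hlim] with x hx
      refine squeeze_zero_norm (a := fun i => |f i x - f₀ x|) (fun i => ?_) ?_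
      · rw [Real.norm_eq_abs]
        by_cases hx : x ∈ {x | th g (μ (τ i)) (N i) x < s i}
        · rw [Set.indicator_of_mem hx, Set.indicator_of_mem hx]
        · rw [Set.indicator_of_notMem hx, Set.indicator_of_notMem hx]; simp
      · simpa using (hx.sub_const (f₀ x)).abs
  rw [integral_zero] at a2
  have a3 : Tendsto (fun i => ∫ x, {x | th g (μ (τ i)) (N i) x < s i}.indicator (f i) x ∂(μ (τ i)) -
      ∫ x, {x | th g (μ (τ i)) (N i) x < s i}.indicator (f i) x ∂(μ t₀)) l (𝓝 0) := by
    rw [Metric.tendsto_nhds]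
    intro e he
    filter_upwards [hτ.eventually (tv_eventually hμc t₀ (show 0 < e / (4 * R) by positivity))] with i hi
    rw [Real.dist_eq, sub_zero]
    refine (hi.bdd hRp ((hf i).indicator (hmE i)) (hb i)).trans_lt ?_
    have : 2 * R * (e / (4 * R)) = e / 2 := by field_simp; norm_num
    linarith
  have := (a3.add a2).add a1
  rw [zero_add, zero_add] at this
  refine this.congr fun i => ?_
  rw [integral_sub (integrable_bdd ((hf i).indicator (hmE i)) (hb i))
    (integrable_bdd (hf₀.indicator (hmE i)) (hb' i)), integral_indicator (f := f₀) (hmE i)]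
  ring

lemma mix_Ico (hg : MeasurableEmbedding g) (hg1 : ∀ x, g x ≤ 1) (hμc : TVContinuousFamily μ)
    (hτ : Tendsto τ l (𝓝 t₀)) (hN : Tendsto N l atTop) {r : ι → ℝ} {r₀ : ℝ}
    (hs : Tendsto s l (𝓝 s₀)) (hr : Tendsto r l (𝓝 r₀)) (hsr : ∀ i, r i ≤ s i)
    (hs01 : ∀ i, s i ≤ 1) (hr01 : ∀ i, 0 ≤ r i)
    {f : ι → X → ℝ} {f₀ : X → ℝ} (hf : ∀ i, Measurable (f i))
    (hf₀ : Measurable f₀) {R : ℝ} (hRp : 0 < R)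
    (h0 : ∀ i x, 0 ≤ f i x) (hR : ∀ i x, f i x ≤ R) (h0' : ∀ x, 0 ≤ f₀ x) (hR' : ∀ x, f₀ x ≤ R)
    (hlim : ∀ᵐ x ∂(μ t₀), Tendsto (fun i => f i x) l (𝓝 (f₀ x))) :
    Tendsto (fun i => ∫ x, {x | th g (μ (τ i)) (N i) x ∈ Set.Ico (r i) (s i)}.indicator (f i) x
      ∂(μ (τ i))) l (𝓝 ((s₀ - r₀) * ∫ x, f₀ x ∂(μ t₀))) := by
  have a1 := mix_lt hg hg1 hμc hτ hN hs (fun i => ⟨(hr01 i).trans (hsr i), hs01 i⟩) hf hf₀ hRp h0 hR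
    h0' hR' hlim
  have a2 := mix_lt hg hg1 hμc hτ hN hr (fun i => ⟨hr01 i, (hsr i).trans (hs01 i)⟩) hf hf₀ hRp h0 hR
    h0' hR' hlim
  have := a1.sub a2
  rw [← sub_mul] at this
  refine this.congr fun i => ?_
  have hint : ∀ z : ℝ, Integrable ({x | th g (μ (τ i)) (N i) x < z}.indicator (f i)) (μ (τ i)) :=
    fun z => (integrable_bdd (hf i) (R := R) fun x => by
      rw [abs_of_nonneg (h0 i x)]; exact hR i x).indicator
        (measurableSet_lt (th_meas hg _ _) measurable_const)
  rw [← integral_sub (hint _) (hint _)]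
  refine integral_congr_ae (Eventually.of_forall fun x => ?_)
  simp only [Set.indicator, Set.mem_ofPred_eq, Set.mem_Ico]
  have := hsr i
  split_ifs with h1 h2 h3 h4 h5 <;> first | (exfalso; grind) | simp
end mix

section glue
universe u
variable {X : Type u} {T : Type*} [MetricSpace X] [CompleteSpace X] [TopologicalSpace.SeparableSpace X]
  [MeasurableSpace X] [BorelSpace X] [MetricSpace T] {κ : Type*} [LinearOrder κ]

/-- Data for gluing countably many branches. -/
structure Glue (μ : T → Measure X) (w : κ → T → ℝ) (u : κ → T → X → ℝ) : Prop where
  wc : ∀ k, Continuous (w k)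
  w0 : ∀ k t, 0 ≤ w k t
  wlf : LocallyFinite fun k => Function.support (w k)
  wsum : ∀ t, ∑ᶠ k, w k t = 1
  um : ∀ k t, Measurable (u k t)
  u0 : ∀ k t x, 0 ≤ u k t x
  u1 : ∀ k t x, u k t x ≤ 1
  uc : ∀ k x, Continuous fun t => u k t x
  ulaw : ∀ k t, w k t ≠ 0 → (μ t).map (u k t) ≪ lam
  umix : ∀ t r, 0 < r → r < 1 →
    ∑ᶠ k, w k t * ∫ x, (Set.Iic r).indicator (fun _ => (1:ℝ)) (u k t x) ∂(μ t) = r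

/-- the slice belonging to branch `k` -/
def sl (g : X → ℝ) (μ : T → Measure X) (w : κ → T → ℝ) (k : κ) (t : T) (N : ℝ) : Set X :=
  {x | th g (μ t) N x ∈ Set.Ico (cum w k t) (cum w k t + w k t)}

def Wg (g : X → ℝ) (μ : T → Measure X) (w : κ → T → ℝ) (u : κ → T → X → ℝ) (t : T) (N : ℝ) (x : X) : ℝ :=
  ∑ᶠ k, (sl g μ w k t N).indicator (u k t) x

def Qg (g : X → ℝ) (μ : T → Measure X) (w : κ → T → ℝ) (u : κ → T → X → ℝ) (t : T) (N : ℝ) (r : ℝ) : ℝ :=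
  (μ t).real {x | Wg g μ w u t N x ≤ r}

variable {μ : T → Measure X}
  [∀ t, IsProbabilityMeasure (μ t)] [∀ t, NullSingletonClass (μ t)]
  {w : κ → T → ℝ} {u : κ → T → X → ℝ} {g : X → ℝ}

lemma Glue.fin (G : Glue μ w u) (t : T) : (Function.support fun k => w k t).Finite :=
  G.wlf.point_finite t

lemma Glue.locfin (G : Glue μ w u) (t₀ : T) : ∃ S : Finset κ, ∀ᶠ t in 𝓝 t₀, ∀ k, w k t ≠ 0 → k ∈ S := by
  obtain ⟨U, hU, hf⟩ := G.wlf t₀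
  refine ⟨hf.toFinset, ?_⟩
  filter_upwards [hU] with t ht k hk
  simp only [Set.Finite.mem_toFinset]
  exact ⟨t, hk, ht⟩

lemma sl_meas (hg : MeasurableEmbedding g) (k : κ) (t : T) (N : ℝ) : MeasurableSet (sl g μ w k t N) :=
  th_meas hg (μ t) N measurableSet_Ico

lemma sl_ne {k : κ} {t : T} {N : ℝ} {x : X} (h : x ∈ sl g μ w k t N) : w k t ≠ 0 := by
  intro h0
  have := h.1.trans_lt h.2
  simp [h0] at this

lemma Glue.sl_unique (G : Glue μ w u) {k j : κ} {t : T} {N : ℝ} {x : X} (h : x ∈ sl g μ w k t N)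
    (h' : x ∈ sl g μ w j t N) : k = j := by
  rcases lt_trichotomy k j with hkj | hkj | hkj
  · have := cum_add_le G.w0 (G.fin t) hkj
    linarith [h.2, h'.1]
  · exact hkj
  · have := cum_add_le G.w0 (G.fin t) hkj
    linarith [h'.2, h.1]

lemma Glue.sl_ex (G : Glue μ w u) (t : T) (N : ℝ) (x : X) (S : Finset κ) (hS : ∀ k, w k t ≠ 0 → k ∈ S) :
    ∃ k ∈ S, x ∈ sl g μ w k t N :=
  cum_cover S hS (G.wsum t) (Int.fract_nonneg _) (Int.fract_lt_one _)

lemma Glue.W_of_mem (G : Glue μ w u) {k : κ} {t : T} {N : ℝ} {x : X} (h : x ∈ sl g μ w k t N) :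
    Wg g μ w u t N x = u k t x := by
  rw [Wg, finsum_eq_single _ k, Set.indicator_of_mem h]
  intro j hj
  exact Set.indicator_of_notMem (fun h' => hj (G.sl_unique h' h)) _

lemma Glue.dec (G : Glue μ w u) {t : T} (N : ℝ) (S : Finset κ) (hS : ∀ k, w k t ≠ 0 → k ∈ S)
    (f : κ → X → ℝ) (F : X → ℝ) (hF : ∀ k, ∀ x ∈ sl g μ w k t N, F x = f k x) (x : X) :
    F x = ∑ k ∈ S, (sl g μ w k t N).indicator (f k) x := by
  obtain ⟨k, hk, hx⟩ := G.sl_ex (g := g) t N x S hS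
  rw [Finset.sum_eq_single k, Set.indicator_of_mem hx, hF k x hx]
  · intro j _ hj
    exact Set.indicator_of_notMem (fun h' => hj (G.sl_unique h' hx)) _
  · intro h; exact absurd hk h

lemma Glue.W_meas (G : Glue μ w u) (hg : MeasurableEmbedding g) (t : T) (N : ℝ) :
    Measurable (Wg g μ w u t N) := by
  have : Wg g μ w u t N = fun x => ∑ k ∈ (G.fin t).toFinset, (sl g μ w k t N).indicator (u k t) x :=
    funext fun x => G.dec N _ (fun k hk => by simpa using hk) _ _ (fun k x hx => G.W_of_mem hx) x
  rw [this]
  exact Finset.measurable_sum _ fun k _ => (G.um k t).indicator (sl_meas hg k t N)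

lemma lam_singleton (r : ℝ) : lam {r} = 0 :=
  le_antisymm ((Measure.restrict_apply_le _ _).trans (by simp)) zero_le

lemma Glue.u_null (G : Glue μ w u) {k : κ} {t : T} (hk : w k t ≠ 0) {B : Set ℝ} (hB : MeasurableSet B)
    (h0 : lam B = 0) : μ t {x | u k t x ∈ B} = 0 := by
  have := G.ulaw k t hk h0
  rwa [Measure.map_apply (G.um k t) hB] at this

lemma Glue.W_atom (G : Glue μ w u) (t : T) (N : ℝ) (r : ℝ) :
    μ t {x | Wg g μ w u t N x = r} = 0 := by
  refine measure_mono_null (t := ⋃ k ∈ Function.support fun k => w k t, {x | u k t x ∈ ({r} : Set ℝ)}) ?_ ?_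
  · intro x hx
    obtain ⟨k, hk, hxk⟩ := G.sl_ex (g := g) t N x (G.fin t).toFinset (fun k hk => by simpa using hk)
    simp only [Set.mem_iUnion]
    refine ⟨k, by simpa using hk, ?_⟩
    exact (G.W_of_mem hxk).symm.trans hx
  · rw [measure_biUnion_null_iff (G.fin t).countable]
    intro k hk
    exact G.u_null hk (measurableSet_singleton r) (lam_singleton r)

lemma Glue.V_meas (G : Glue μ w u) (hg : MeasurableEmbedding g) (t : T) (N : ℝ) :
    Measurable fun x => Qg g μ w u t N (Wg g μ w u t N x) :=
  (pit_meas (μ t)).comp (G.W_meas hg t N)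

lemma Glue.V_law (G : Glue μ w u) (hg : MeasurableEmbedding g) (t : T) (N : ℝ) :
    (μ t).map (fun x => Qg g μ w u t N (Wg g μ w u t N x)) = lam :=
  pit (μ t) (G.W_meas hg t N) (G.W_atom t N)

lemma GG_cont (hμc : TVContinuousFamily μ) (hg : MeasurableEmbedding g) (x : X) : Continuous fun t => GG g (μ t) x := by
  rw [continuous_iff_continuousAt]
  intro t
  have := tv_real_tendsto (l := 𝓝 t) (τ := id) hμc tendsto_id (A := fun _ => {y | g y ≤ g x})
    (fun _ => measurableSet_le hg.measurable measurable_const)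
  have := this.add_const ((μ t).real {y | g y ≤ g x})
  simpa [GG, ContinuousAt] using this

lemma Glue.W_seq (G : Glue μ w u) (hμc : TVContinuousFamily μ) (hg : MeasurableEmbedding g) 
    {N : T → ℝ} (hN : Continuous N) (hN1 : ∀ t, 1 ≤ N t) (t : T) {tn : ℕ → T}
    (htn : Tendsto tn atTop (𝓝 t)) : ∀ᵐ x ∂(μ t),
      Tendsto (fun n => Wg g μ w u (tn n) (N (tn n)) x) atTop (𝓝 (Wg g μ w u t (N t) x)) := by
  have hNt : N t ≠ 0 := by linarith [hN1 t]
  have key : ∀ a : ℝ, ∀ᵐ x ∂(μ t), ∀ z : ℤ, N t * GG g (μ t) x ≠ a + z := by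
    intro a
    rw [ae_all_iff]
    intro z
    have h1 : lam {(a + z) / N t} = 0 := lam_singleton _
    rw [← GG_law hg (μ t), Measure.map_apply (GG_meas hg _) (measurableSet_singleton _)] at h1
    refine measure_mono_null ?_ h1
    intro x hx
    simp only [ne_eq, Set.mem_compl_iff, Set.mem_ofPred_eq, not_not] at hx
    simp only [Set.mem_preimage, Set.mem_singleton_iff]
    rw [← hx]; field_simp
  have key2 : ∀ᵐ x ∂(μ t), ∀ k ∈ Function.support fun k => w k t, ∀ z : ℤ,
      N t * GG g (μ t) x ≠ cum w k t + z := by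
    rw [ae_ball_iff (G.fin t).countable]
    intro k _
    exact key _
  filter_upwards [key 0, key2] with x h0 h2
  obtain ⟨k, -, hxk⟩ := G.sl_ex (g := g) t (N t) x (G.fin t).toFinset (fun k hk => by simpa using hk)
  have hk := sl_ne hxk
  have hlt : cum w k t < th g (μ t) (N t) x := by
    refine lt_of_le_of_ne hxk.1 fun h => ?_
    refine h2 k hk ⌊N t * GG g (μ t) x⌋ ?_
    rw [h, th]; exact (Int.fract_add_floor _).symm
  have hth : ContinuousAt (fun s => th g (μ s) (N s) x) t := by
    have : ContinuousAt (Int.fract : ℝ → ℝ) (N t * GG g (μ t) x) :=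
      continuousAt_fract fun h => by
        exact h0 _ (by rw [zero_add]; exact h)
    exact ContinuousAt.comp (f := fun s => N s * GG g (μ s) x) this
      (hN.mul (GG_cont hμc hg x)).continuousAt
  have hcc := cum_continuous G.wc G.wlf k
  have ev : ∀ᶠ s in 𝓝 t, x ∈ sl g μ w k s (N s) := by
    filter_upwards [hcc.continuousAt.eventually_lt hth hlt,
      hth.eventually_lt (hcc.add (G.wc k)).continuousAt hxk.2] with s a b
    exact ⟨a.le, b⟩
  rw [G.W_of_mem hxk]
  refine ((((G.uc k x).tendsto t).comp htn)).congr' ?_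
  filter_upwards [htn.eventually ev] with n hn
  rw [G.W_of_mem hn]; rfl

lemma ind_Iic_tendsto {ι : Type*} {l : Filter ι} {a r : ι → ℝ} {a₀ r₀ : ℝ} (ha : Tendsto a l (𝓝 a₀))
    (hr : Tendsto r l (𝓝 r₀)) (hne : a₀ ≠ r₀) :
    Tendsto (fun i => (Set.Iic (r i)).indicator (fun _ => (1:ℝ)) (a i)) l
      (𝓝 ((Set.Iic r₀).indicator (fun _ => (1:ℝ)) a₀)) := by
  rcases lt_or_gt_of_ne hne with h | h
  · refine tendsto_const_nhds.congr' ?_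
    filter_upwards [ha.eventually_lt hr h] with i hi
    rw [Set.indicator_of_mem (show a₀ ∈ Set.Iic r₀ from h.le), Set.indicator_of_mem (show a i ∈ Set.Iic (r i) from hi.le)]
  · refine tendsto_const_nhds.congr' ?_
    filter_upwards [hr.eventually_lt ha h] with i hi
    rw [Set.indicator_of_notMem (show a₀ ∉ Set.Iic r₀ from not_le.2 h),
      Set.indicator_of_notMem (show a i ∉ Set.Iic (r i) from not_le.2 hi)]

lemma Qg_eq (hg : MeasurableEmbedding g) (G : Glue μ w u) (t : T) (N r : ℝ) : Qg g μ w u t N r =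
    ∫ y, (Set.Iic r).indicator (fun _ => (1:ℝ)) (Wg g μ w u t N y) ∂(μ t) := by
  have hm : MeasurableSet {x | Wg g μ w u t N x ≤ r} :=
    measurableSet_le (G.W_meas hg t N) measurable_const
  rw [Qg, ← integral_indicator_one hm]
  rfl

lemma indm {f : X → ℝ} (hf : Measurable f) (r : ℝ) :
    Measurable fun y => (Set.Iic r).indicator (fun _ => (1:ℝ)) (f y) :=
  (measurable_const.indicator measurableSet_Iic).comp hf

lemma Glue.V_seq (G : Glue μ w u) (hμc : TVContinuousFamily μ) (hg : MeasurableEmbedding g) 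
    {N : T → ℝ} (hN : Continuous N) (hN1 : ∀ t, 1 ≤ N t) (t : T) {tn : ℕ → T}
    (htn : Tendsto tn atTop (𝓝 t)) : ∀ᵐ x ∂(μ t),
      Tendsto (fun n => Qg g μ w u (tn n) (N (tn n)) (Wg g μ w u (tn n) (N (tn n)) x)) atTop
        (𝓝 (Qg g μ w u t (N t) (Wg g μ w u t (N t) x))) := by
  have hW := G.W_seq hμc hg hN hN1 t htn
  filter_upwards [hW] with x hx
  simp only [Qg_eq hg G]
  refine tv_dct hμc htn (R := 1) (Eventually.of_forall fun n => ?_) one_pos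
    (Eventually.of_forall fun n y => ?_) ?_
  · exact indm (G.W_meas hg _ _) _
  · simp only [Set.indicator]; split_ifs <;> simp
  · have hne : ∀ᵐ y ∂(μ t), Wg g μ w u t (N t) y ≠ Wg g μ w u t (N t) x := by
      refine measure_mono_null ?_ (G.W_atom (g := g) t (N t) (Wg g μ w u t (N t) x))
      intro y hy; simpa using hy
    filter_upwards [hW, hne] with y hy hyx
    exact ind_Iic_tendsto hy hx hyx
end glue

section glue2
universe u
variable {X : Type u} {T : Type*} [MetricSpace X] [CompleteSpace X] [TopologicalSpace.SeparableSpace X]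
  [MeasurableSpace X] [BorelSpace X] [MetricSpace T] {κ : Type*} [LinearOrder κ] {μ : T → Measure X}
  [∀ t, IsProbabilityMeasure (μ t)] [∀ t, NullSingletonClass (μ t)]
  {w : κ → T → ℝ} {u : κ → T → X → ℝ} {g : X → ℝ}

lemma Glue.mixk (G : Glue μ w u) (hμc : TVContinuousFamily μ) (hg : MeasurableEmbedding g)
    (hg1 : ∀ x, g x ≤ 1) (t₀ : T) (k : κ) {f : T × ℝ → X → ℝ} {f₀ : X → ℝ} (hf : ∀ i, Measurable (f i))
    (hf₀ : Measurable f₀) {R : ℝ} (hRp : 0 < R)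
    (h0 : ∀ i x, 0 ≤ f i x) (hR : ∀ i x, f i x ≤ R) (h0' : ∀ x, 0 ≤ f₀ x) (hR' : ∀ x, f₀ x ≤ R)
    (hlim : w k t₀ ≠ 0 → ∀ᵐ x ∂(μ t₀), Tendsto (fun i => f i x) (𝓝 t₀ ×ˢ atTop) (𝓝 (f₀ x))) :
    Tendsto (fun i : T × ℝ => ∫ x, (sl g μ w k i.1 i.2).indicator (f i) x ∂(μ i.1)) (𝓝 t₀ ×ˢ atTop)
      (𝓝 (w k t₀ * ∫ x, f₀ x ∂(μ t₀))) := by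
  have hcc := cum_continuous G.wc G.wlf k
  have hr : Tendsto (fun i : T × ℝ => cum w k i.1) (𝓝 t₀ ×ˢ (atTop : Filter ℝ)) (𝓝 (cum w k t₀)) :=
    (hcc.tendsto t₀).comp tendsto_fst
  have hs : Tendsto (fun i : T × ℝ => cum w k i.1 + w k i.1) (𝓝 t₀ ×ˢ (atTop : Filter ℝ))
      (𝓝 (cum w k t₀ + w k t₀)) := ((hcc.add (G.wc k)).tendsto t₀).comp tendsto_fst
  have hsr : ∀ i : T × ℝ, cum w k i.1 ≤ cum w k i.1 + w k i.1 := fun i => by linarith [G.w0 k i.1]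
  have hs1 : ∀ i : T × ℝ, cum w k i.1 + w k i.1 ≤ 1 := fun i =>
    cum_add_le_one G.w0 (G.fin _) (G.wsum _).le k
  have hr0 : ∀ i : T × ℝ, 0 ≤ cum w k i.1 := fun i => cum_nonneg G.w0 _ _
  by_cases hk : w k t₀ = 0
  · have a := mix_Ico (τ := Prod.fst) (N := Prod.snd) hg hg1 hμc tendsto_fst tendsto_snd hs hr hsr hs1 hr0
      (f := fun _ _ => R) (f₀ := fun _ => R) (fun _ => measurable_const) measurable_const hRp
      (fun _ _ => hRp.le) (fun _ _ => le_rfl) (fun _ => hRp.le) (fun _ => le_rfl)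
      (Eventually.of_forall fun _ => tendsto_const_nhds)
    rw [add_sub_cancel_left, hk, zero_mul] at a
    rw [hk, zero_mul]
    refine squeeze_zero (fun i => ?_) (fun i => ?_) a
    · exact integral_nonneg fun x => Set.indicator_nonneg (fun x _ => h0 i x) x
    · have hm := sl_meas (μ := μ) (w := w) hg k i.1 i.2
      refine integral_mono ?_ ?_ ?_
      · exact (integrable_bdd (hf i) (R := R) fun x => by
          rw [abs_of_nonneg (h0 i x)]; exact hR i x).indicator hm
      · exact (integrable_const R).indicator hm
      · intro x
        exact Set.indicator_le_indicator (hR i x)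
  · have a := mix_Ico (τ := Prod.fst) (N := Prod.snd) hg hg1 hμc tendsto_fst tendsto_snd hs hr hsr hs1 hr0
      hf hf₀ hRp h0 hR h0' hR' (hlim hk)
    rw [add_sub_cancel_left] at a
    exact a

lemma Glue.mixsum (G : Glue μ w u) (hμc : TVContinuousFamily μ) (hg : MeasurableEmbedding g)
    (hg1 : ∀ x, g x ≤ 1) (t₀ : T) {f : κ → T × ℝ → X → ℝ} {f₀ : κ → X → ℝ} {F : T × ℝ → X → ℝ}
    (hf : ∀ k i, Measurable (f k i))
    (hf₀ : ∀ k, Measurable (f₀ k)) {R : ℝ} (hRp : 0 < R)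
    (h0 : ∀ k i x, 0 ≤ f k i x) (hR : ∀ k i x, f k i x ≤ R) (h0' : ∀ k x, 0 ≤ f₀ k x)
    (hR' : ∀ k x, f₀ k x ≤ R)
    (hF : ∀ k (i : T × ℝ), ∀ x ∈ sl g μ w k i.1 i.2, F i x = f k i x)
    (hlim : ∀ k, w k t₀ ≠ 0 → ∀ᵐ x ∂(μ t₀), Tendsto (fun i => f k i x) (𝓝 t₀ ×ˢ atTop) (𝓝 (f₀ k x))) :
    Tendsto (fun i : T × ℝ => ∫ x, F i x ∂(μ i.1)) (𝓝 t₀ ×ˢ atTop)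
      (𝓝 (∑ᶠ k, w k t₀ * ∫ x, f₀ k x ∂(μ t₀))) := by
  obtain ⟨S, hS⟩ := G.locfin t₀
  rw [finsum_eq_sum_of_support_subset (s := S) _ (fun k hk => hS.self_of_nhds k fun h => hk (by
    simp [h]))]
  have := tendsto_finsetSum S fun k _ => G.mixk hμc hg hg1 t₀ k (hf k) (hf₀ k) hRp (h0 k) (hR k) (h0' k)
    (hR' k) (hlim k)
  refine this.congr' ?_
  filter_upwards [(tendsto_fst (f := 𝓝 t₀) (g := (atTop : Filter ℝ))).eventually hS] with i hi
  rw [← integral_finsetSum]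
  · refine integral_congr_ae (Eventually.of_forall fun x => ?_)
    exact (G.dec i.2 S hi (fun k => f k i) (F i) (fun k x hx => hF k i x hx) x).symm
  · intro k _
    exact (integrable_bdd (hf k i) (R := R) fun x => by
          rw [abs_of_nonneg (h0 k i x)]; exact hR k i x).indicator (sl_meas hg k i.1 i.2)

lemma Glue.Q_tendsto (G : Glue μ w u) (hμc : TVContinuousFamily μ) (hg : MeasurableEmbedding g)
    (hg1 : ∀ x, g x ≤ 1) (t₀ : T) {r : ℝ} (hr0 : 0 < r) (hr1 : r < 1) :
    Tendsto (fun i : T × ℝ => Qg g μ w u i.1 i.2 r) (𝓝 t₀ ×ˢ atTop) (𝓝 r) := by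
  simp only [Qg_eq hg G]
  have h01 : ∀ z : ℝ, 0 ≤ (Set.Iic r).indicator (fun _ => (1:ℝ)) z ∧
      (Set.Iic r).indicator (fun _ => (1:ℝ)) z ≤ 1 := by
    intro z; simp only [Set.indicator]; split_ifs <;> simp
  have := G.mixsum hμc hg hg1 t₀
    (f := fun k i x => (Set.Iic r).indicator (fun _ => (1:ℝ)) (u k i.1 x))
    (f₀ := fun k x => (Set.Iic r).indicator (fun _ => (1:ℝ)) (u k t₀ x))
    (F := fun i x => (Set.Iic r).indicator (fun _ => (1:ℝ)) (Wg g μ w u i.1 i.2 x))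
    (fun k i => indm (G.um k i.1) r) (fun k => indm (G.um k t₀) r) one_pos
    (fun k i x => (h01 _).1) (fun k i x => (h01 _).2) (fun k x => (h01 _).1) (fun k x => (h01 _).2)
    (fun k i x hx => by rw [G.W_of_mem hx]) ?_
  · rwa [G.umix t₀ r hr0 hr1] at this
  · intro k hk
    have := G.u_null hk (measurableSet_singleton r) (lam_singleton r)
    have hne : ∀ᵐ x ∂(μ t₀), u k t₀ x ≠ r := by
      refine measure_mono_null ?_ this
      intro y hy; simpa using hy
    filter_upwards [hne] with x hx
    exact ind_Iic_tendsto (((G.uc k x).tendsto t₀).comp tendsto_fst) tendsto_const_nhds hx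

lemma mono_id {ι : Type*} {l : Filter ι} {Q : ι → ℝ → ℝ} (hm : ∀ i, Monotone (Q i))
    (h0 : ∀ i r, 0 ≤ Q i r) (h1 : ∀ i r, Q i r ≤ 1)
    (hQ : ∀ r, 0 < r → r < 1 → Tendsto (fun i => Q i r) l (𝓝 r)) {v : ι → ℝ} {v₀ : ℝ}
    (hv : Tendsto v l (𝓝 v₀)) (hv0 : 0 ≤ v₀) (hv1 : v₀ ≤ 1) : Tendsto (fun i => Q i (v i)) l (𝓝 v₀) := by
  rw [tendsto_order]
  constructor
  · intro a ha
    by_cases ha0 : a < 0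
    · exact Eventually.of_forall fun i => ha0.trans_le (h0 _ _)
    push Not at ha0
    set b := (a + v₀) / 2 with hb
    filter_upwards [(hQ b (by linarith) (by linarith)).eventually_const_lt (show a < b by linarith),
      hv.eventually_const_lt (show b < v₀ by linarith)] with i hi hi'
    exact hi.trans_le (hm i hi'.le)
  · intro a ha
    by_cases ha0 : 1 < a
    · exact Eventually.of_forall fun i => (h1 _ _).trans_lt ha0
    push Not at ha0
    set b := (a + v₀) / 2 with hb
    filter_upwards [(hQ b (by linarith) (by linarith)).eventually_lt_const (show b < a by linarith),
      hv.eventually_lt_const (show v₀ < b by linarith)] with i hi hi'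
    exact (hm i hi'.le).trans_lt hi

lemma Glue.cost_tendsto (G : Glue μ w u) (hμc : TVContinuousFamily μ) (hg : MeasurableEmbedding g)
    (hg1 : ∀ x, g x ≤ 1) {c : T → X → ℝ → ℝ} {Gd : T → Set ℝ} {R : ℝ} (hC : Cst c Gd R) (t₀ : T) :
    Tendsto (fun i : T × ℝ => ∫ x, c i.1 x (Qg g μ w u i.1 i.2 (Wg g μ w u i.1 i.2 x)) ∂(μ i.1))
      (𝓝 t₀ ×ˢ atTop) (𝓝 (∑ᶠ k, w k t₀ * ∫ x, c t₀ x (u k t₀ x) ∂(μ t₀))) := by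
  refine G.mixsum hμc hg hg1 t₀
    (f := fun k i x => c i.1 x (Qg g μ w u i.1 i.2 (u k i.1 x)))
    (f₀ := fun k x => c t₀ x (u k t₀ x)) ?_ ?_ hC.R0 (fun _ _ _ => hC.nn _ _ _) (fun _ _ _ => hC.le _ _ _)
    (fun _ _ => hC.nn _ _ _) (fun _ _ => hC.le _ _ _) (fun k i x hx => by rw [G.W_of_mem hx]) ?_
  · intro k i
    exact (hC.meas i.1).comp (measurable_id.prodMk ((pit_meas (μ i.1)).comp (G.um k i.1)))
  · intro k
    exact (hC.meas t₀).comp (measurable_id.prodMk (G.um k t₀))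
  · intro k hk
    have hgd : lam (Gd t₀)ᶜ = 0 := hC.gae t₀
    have := G.u_null hk (hC.gm t₀).compl hgd
    have hae : ∀ᵐ x ∂(μ t₀), u k t₀ x ∈ Gd t₀ := this
    filter_upwards [hae] with x hx
    have hQ : Tendsto (fun i : T × ℝ => Qg g μ w u i.1 i.2 (u k i.1 x)) (𝓝 t₀ ×ˢ atTop)
        (𝓝 (u k t₀ x)) := by
      refine mono_id (Q := fun i : T × ℝ => Qg g μ w u i.1 i.2) ?_ (fun i r => measureReal_nonneg)
        (fun i r => measureReal_le_one) (fun r a b => G.Q_tendsto hμc hg hg1 t₀ a b)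
        (((G.uc k x).tendsto t₀).comp tendsto_fst) (G.u0 _ _ _) (G.u1 _ _ _)
      intro i a b hab
      exact measureReal_mono fun y (hy : _ ≤ a) => hy.trans hab
    exact (hC.cont t₀ x _ hx).tendsto.comp
      (tendsto_fst.prodMk_nhds (tendsto_const_nhds.prodMk_nhds hQ))
end glue2

section glue3
universe u
variable {X : Type u} {T : Type*} [MetricSpace X] [CompleteSpace X] [TopologicalSpace.SeparableSpace X]
  [MeasurableSpace X] [BorelSpace X] [MetricSpace T] {μ : T → Measure X}
  [∀ t, IsProbabilityMeasure (μ t)] [∀ t, NullSingletonClass (μ t)] [∀ t, (μ t).InnerRegular]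
  {c : T → X → ℝ → ℝ} {Gd : T → Set ℝ} {R : ℝ}

lemma sig_sum {ι : Type*} {M : ι → ℕ} {φ : ι → ℝ} (hφ : (Function.support φ).Finite)
    (B : ∀ i, Fin (M i) → ℝ) :
    ∑ᶠ k : (Σ i, Fin (M i)), φ k.1 * B k.1 k.2 = ∑ᶠ i, φ i * ∑ m, B i m := by
  classical
  rw [finsum_eq_sum_of_support_subset (s := hφ.toFinset.sigma fun _ => Finset.univ),
    finsum_eq_sum_of_support_subset (s := hφ.toFinset), Finset.sum_sigma]
  · simp only [Finset.mul_sum]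
  · intro i hi
    simp only [Set.Finite.coe_toFinset]
    exact fun h => hi (by simp [h])
  · intro k hk
    simp only [Finset.coe_sigma, Set.mem_sigma_iff, Set.Finite.coe_toFinset]
    exact ⟨fun h => hk (by simp [h]), by simp⟩

lemma MM.int_sum (V : MM X) (m : Measure X) [IsProbabilityMeasure m] {f : X × Fin V.M → ℝ}
    (hf : Measurable f) {R : ℝ} (hR : ∀ q, |f q| ≤ R) :
    ∑ i, V.p.real {i} * ∫ x, f (x, i) ∂m = ∫ q, f q ∂(m.prod V.p) := by
  have hi := integrable_bdd (μ := m.prod V.p) hf hR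
  rw [integral_prod_symm _ hi, integral_fintype hi.integral_prod_right]
  rfl

lemma MM.F_cont (hμc : TVContinuousFamily μ) (V : MM X) (r : ℝ) : Continuous fun t => V.F (μ t) r := by
  rw [continuous_iff_continuousAt]
  intro t
  rw [ContinuousAt, Metric.tendsto_nhds]
  intro e he
  filter_upwards [tv_eventually hμc t (half_pos he)] with s hs
  have := (hs.prod (p := V.p)).real (measurableSet_le V.meas (measurable_const (a := r)))
  rw [Real.dist_eq]
  have h2 : |V.F (μ s) r - V.F (μ t) r| ≤ e / 2 := this
  linarith

lemma MM.slice (V : MM X) (m : Measure X) [IsProbabilityMeasure m] [NullSingletonClass m] (i : Fin V.M)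
    (hi : V.p.real {i} ≠ 0) : m.map (fun x => V.F m (V.v (x, i))) ≪ lam := by
  have hm : Measurable fun q => V.F m (V.v q) := (V.F_meas m).comp V.meas
  have hm' : Measurable fun x => V.F m (V.v (x, i)) := hm.comp (measurable_id.prodMk measurable_const)
  refine Measure.AbsolutelyContinuous.mk fun B hB h0 => ?_
  rw [Measure.map_apply hm' hB]
  rw [← V.law m, Measure.map_apply hm hB] at h0
  have hsub : ((fun x => V.F m (V.v (x, i))) ⁻¹' B) ×ˢ ({i} : Set (Fin V.M)) ⊆
      (fun q => V.F m (V.v q)) ⁻¹' B := by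
    rintro ⟨x, j⟩ ⟨hx, hj⟩
    have hj : j = i := hj
    subst hj
    exact hx
  have h1 := measure_mono_null hsub h0
  rw [Measure.prod_prod, mul_eq_zero] at h1
  refine h1.resolve_right fun h => hi ?_
  simp [Measure.real, h]

lemma Cst.glue (hC : Cst c Gd R) (hμc : TVContinuousFamily μ) {δ : ℝ} (hδ : 0 < δ) :
    ∃ (M : T → ℕ) (_ : LinearOrder (Σ i : T, Fin (M i))) (w : (Σ i : T, Fin (M i)) → T → ℝ)
      (u : (Σ i : T, Fin (M i)) → T → X → ℝ), Glue μ w u ∧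
      ∀ t, ∑ᶠ k, w k t * ∫ x, c t x (u k t x) ∂(μ t) ≤ kk (c t) (μ t) + δ := by
  choose V hV using fun t₀ : T => hC.local_opt hμc t₀ hδ
  have hopen : ∀ t₀ : T, ∃ U, IsOpen U ∧ t₀ ∈ U ∧ ∀ s ∈ U, (V t₀).C (c s) (μ s) ≤ kk (c s) (μ s) + δ := by
    intro t₀
    obtain ⟨U, h1, h2, h3⟩ := eventually_nhds_iff.1 (hV t₀)
    exact ⟨U, h2, h3, h1⟩
  choose U hUo hUm hUc using hopen
  obtain ⟨φ, hφ⟩ := PartitionOfUnity.exists_isSubordinate isClosed_univ U hUo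
    (fun t _ => Set.mem_iUnion.2 ⟨t, hUm t⟩)
  have hsum : ∀ t, ∑ᶠ i, φ i t = 1 := fun t => φ.sum_eq_one (Set.mem_univ t)
  have hfin : ∀ t, (Function.support fun i => φ i t).Finite := fun t => φ.locallyFinite.point_finite t
  refine ⟨fun i => (V i).M, IsWellOrder.linearOrder WellOrderingRel,
    fun k t => φ k.1 t * (V k.1).p.real {k.2}, fun k t x => (V k.1).F (μ t) ((V k.1).v (x, k.2)), ?_, ?_⟩
  · refine ⟨?_, ?_, ?_, ?_, ?_, ?_, ?_, ?_, ?_, ?_⟩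
    · intro k; exact (φ k.1).continuous.mul continuous_const
    · intro k t; exact mul_nonneg (φ.nonneg _ _) measureReal_nonneg
    · intro t
      obtain ⟨A, hA, hf⟩ := φ.locallyFinite t
      refine ⟨A, hA, ?_⟩
      refine (hf.toFinset.sigma fun i => (Finset.univ : Finset (Fin (V i).M))).finite_toSet.subset ?_
      rintro k ⟨s, hs, hsA⟩
      simp only [Finset.coe_sigma, Set.mem_sigma_iff, Set.Finite.coe_toFinset]
      exact ⟨⟨s, fun h => hs (by simp [h]), hsA⟩, by simp⟩
    · intro t
      have := sig_sum (hfin t) (fun i m => (V i).p.real {m})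
      rw [this]
      have h1 : ∀ i, ∑ m, (V i).p.real {m} = 1 := fun i => by
        simp
      simp only [h1, mul_one]
      exact hsum t
    · intro k t
      exact ((V k.1).F_meas (μ t)).comp ((V k.1).meas.comp (measurable_id.prodMk measurable_const))
    · intro k t x; exact MM.F_nonneg _ _ _
    · intro k t x; exact MM.F_le_one _ _ _
    · intro k x; exact MM.F_cont hμc _ _
    · intro k t hk
      exact MM.slice _ _ _ fun h => hk (by rw [h, mul_zero])
    · intro t r hr0 hr1
      have := sig_sum (hfin t) (fun i m => (V i).p.real {m} *
        ∫ x, (Set.Iic r).indicator (fun _ => (1:ℝ)) ((V i).F (μ t) ((V i).v (x, m))) ∂(μ t))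
      simp only [mul_assoc]
      rw [this]
      have h1 : ∀ i, ∑ m, (V i).p.real {m} * ∫ x, (Set.Iic r).indicator (fun _ => (1:ℝ))
          ((V i).F (μ t) ((V i).v (x, m))) ∂(μ t) = r := fun i => by
        have hm : Measurable fun q => (V i).F (μ t) ((V i).v q) := ((V i).F_meas (μ t)).comp (V i).meas
        rw [(V i).int_sum (μ t) (f := fun q => (Set.Iic r).indicator (fun _ => (1:ℝ))
          ((V i).F (μ t) ((V i).v q))) ((measurable_const.indicator measurableSet_Iic).comp hm) (R := 1)
          (fun q => by simp only [Set.indicator]; split_ifs <;> simp)]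
        have e := integral_map (μ := (μ t).prod (V i).p) hm.aemeasurable
          (f := (Set.Iic r).indicator fun _ => (1:ℝ))
          (measurable_const.indicator measurableSet_Iic).aestronglyMeasurable
        rw [← e, (V i).law (μ t)]
        have e2 := integral_indicator_one (μ := lam) (measurableSet_Iic (a := r))
        rw [lam_real_Iic hr0.le hr1.le] at e2
        exact e2
      simp only [h1]
      rw [← finsum_mul, hsum t, one_mul]
  · intro t
    have := sig_sum (hfin t) (fun i m => (V i).p.real {m} *
        ∫ x, c t x ((V i).F (μ t) ((V i).v (x, m))) ∂(μ t))
    simp only [mul_assoc]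
    rw [this]
    have h1 : ∀ i, ∑ m, (V i).p.real {m} * ∫ x, c t x ((V i).F (μ t) ((V i).v (x, m))) ∂(μ t) =
        (V i).C (c t) (μ t) := fun i => by
      exact (V i).int_sum (μ t) (f := fun q => c t q.1 ((V i).F (μ t) ((V i).v q)))
        ((V i).c_meas (hC.meas t) (μ t)) (fun q => hC.absle _ _ _)
    simp only [h1]
    calc ∑ᶠ i, φ i t * (V i).C (c t) (μ t) ≤ ∑ᶠ i, φ i t * (kk (c t) (μ t) + δ) := by
          refine finsum_le_finsum' ?_ ?_ fun i => ?_
          · exact (hfin t).subset fun i hi h => hi (by simp [h])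
          · exact (hfin t).subset fun i hi h => hi (by simp [h])
          · by_cases h : φ i t = 0
            · simp [h]
            · exact mul_le_mul_of_nonneg_left (hUc i t (hφ i (subset_tsupport _ h))) (φ.nonneg _ _)
      _ = kk (c t) (μ t) + δ := by
          rw [← finsum_mul, hsum t, one_mul]

theorem Cst.main (hC : Cst c Gd R) (hμc : TVContinuousFamily μ) {ε : ℝ} (hε : 0 < ε) :
    ∃ V : T → X → ℝ, (∀ t, Measurable (V t)) ∧ (∀ t, (μ t).map (V t) = lam) ∧
      (∀ t, ∫ x, c t x (V t x) ∂(μ t) ≤ kk (c t) (μ t) + ε) ∧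
      ∀ (t : T) (tn : ℕ → T), Tendsto tn atTop (𝓝 t) →
        ∀ᵐ x ∂(μ t), Tendsto (fun n => V (tn n) x) atTop (𝓝 (V t x)) := by
  obtain ⟨M, _, w, u, G, hcost⟩ := hC.glue hμc (show 0 < ε / 4 by positivity)
  obtain ⟨g, hg, hg01⟩ := exists_emb X
  have hg1 : ∀ x, g x ≤ 1 := fun x => (hg01 x).2.le
  set K : T → ℝ → ℝ := fun t N => ∫ x, c t x (Qg g μ w u t N (Wg g μ w u t N x)) ∂(μ t) with hK
  have hN : ∃ N : C(T, ℝ), ∀ t, N t ∈ {y : ℝ | 1 ≤ y ∧ ∀ z ≥ y, K t z ≤ kk (c t) (μ t) + ε} := by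
    refine exists_continuous_forall_mem_convex_of_local_const (fun t => ?_) fun t => ?_
    · refine Set.OrdConnected.convex ⟨?_⟩
      intro a ha b hb y hy
      exact ⟨ha.1.trans hy.1, fun z hz => ha.2 z (hy.1.trans hz)⟩
    · have h1 := (G.cost_tendsto hμc hg hg1 hC t).eventually_lt_const
        (show _ < kk (c t) (μ t) + ε / 2 by linarith [hcost t])
      obtain ⟨A, hA, B, hB, hAB⟩ := (eventually_prod_iff.1 h1)
      obtain ⟨N₀, hN₀⟩ := eventually_atTop.1 hB
      refine ⟨max 1 N₀, ?_⟩
      filter_upwards [hA, hC.kk_lsc hμc t (show 0 < ε / 4 by positivity)] with s hs hs'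
      refine ⟨le_max_left _ _, fun z hz => ?_⟩
      have := hAB hs (hN₀ z ((le_max_right _ _).trans hz))
      have h2 : K s z < kk (c t) (μ t) + ε / 2 := this
      linarith
  obtain ⟨N, hN⟩ := hN
  refine ⟨fun t x => Qg g μ w u t (N t) (Wg g μ w u t (N t) x), fun t => G.V_meas hg t _,
    fun t => G.V_law hg t _, fun t => (hN t).2 _ le_rfl, fun t tn htn => ?_⟩
  exact G.V_seq hμc hg N.continuous (fun t => (hN t).1) t htn
end glue3

/-- **Theorem 4 of the paper.** `X` a complete separable metric space, `Y` a
complete metric space, `t ↦ μ t` a family of non-atomic Radon probability measures on `X`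
continuous in the total variation norm, `t ↦ ν t` a weakly continuous family of Radon
probability measures on `Y`, `h` continuous nonnegative with the uniform integrability
bound. Then for every `ε > 0` one can select `ε`-optimal Monge mappings `T_t` with
`μ_t ∘ T_t⁻¹ = ν t`, continuous in `t` in the sense of convergence `μ_t`-a.e. -/
theorem approx_monge_varying_marginals
    {X Y T : Type*} [MetricSpace X] [CompleteSpace X] [TopologicalSpace.SeparableSpace X]
    [MetricSpace Y] [CompleteSpace Y] [MetricSpace T]
    [MeasurableSpace X] [BorelSpace X] [MeasurableSpace Y] [BorelSpace Y]
    (μ : T → Measure X) (ν : T → Measure Y)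
    (hμp : ∀ t, IsProbabilityMeasure (μ t)) (hνp : ∀ t, IsProbabilityMeasure (ν t))
    (hμna : ∀ t, NoAtoms (μ t))
    (hμr : ∀ t, (μ t).InnerRegular) (hνr : ∀ t, (ν t).InnerRegular)
    (hμc : TVContinuousFamily μ) (hνc : WeaklyContinuousFamily ν)
    (h : X → Y → T → ℝ)
    (hcont : Continuous fun p : X × Y × T => h p.1 p.2.1 p.2.2)
    (hnonneg : ∀ x y t, 0 ≤ h x y t)
    (a : T → X → ℝ) (b : T → Y → ℝ)
    (hameas : ∀ t, Measurable (a t)) (hbmeas : ∀ t, Measurable (b t))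
    (ha0 : ∀ t x, 0 ≤ a t x) (hb0 : ∀ t y, 0 ≤ b t y)
    (haint : ∀ t, Integrable (a t) (μ t)) (hbint : ∀ t, Integrable (b t) (ν t))
    (hdom : ∀ t x y, h x y t ≤ a t x + b t y)
    (hunif : ∀ ε > (0 : ℝ), ∃ R₀ : ℝ, ∀ R ≥ R₀, ∀ t : T,
      (∫ x in {x | R ≤ a t x}, a t x ∂(μ t)) + ∫ y in {y | R ≤ b t y}, b t y ∂(ν t) ≤ ε)
    (ε : ℝ) (hε : 0 < ε) :
    ∃ Tm : T → X → Y,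
      (∀ t, Measurable (Tm t)) ∧
      (∀ t, (μ t).map (Tm t) = ν t) ∧
      (∀ t, (∫⁻ x, ENNReal.ofReal (h x (Tm t x) t) ∂(μ t)) ≤
        kantorovichCost (fun x y => h x y t) (μ t) (ν t) + ENNReal.ofReal ε) ∧
      (∀ (t : T) (tn : ℕ → T), Tendsto tn atTop (𝓝 t) →
        ∀ᵐ x ∂(μ t), Tendsto (fun n => Tm (tn n) x) atTop (𝓝 (Tm t x))) := by
  rcases isEmpty_or_nonempty T with hT | ⟨⟨t₁⟩⟩
  · exact ⟨fun t => (hT.false t).elim, fun t => (hT.false t).elim, fun t => (hT.false t).elim,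
      fun t => (hT.false t).elim, fun t => (hT.false t).elim⟩
  have hY : Nonempty Y := nonempty_of_isProbabilityMeasure (ν t₁)
  have hna : ∀ t, NullSingletonClass (μ t) := hμna
  have hsc : SecondCountableTopology X := UniformSpace.secondCountable_of_separable X
  obtain ⟨ξ, Gd, hξm, hξl, hGm, hGae, hξc⟩ := xi_exists hνc
  obtain ⟨R₀, hR₀⟩ := hunif (ε / 2) (half_pos hε)
  obtain ⟨R, hR1, hR⟩ : ∃ R : ℝ, 1 ≤ R ∧ ∀ t : T,
      (∫ x in {x | R ≤ a t x}, a t x ∂(μ t)) + ∫ y in {y | R ≤ b t y}, b t y ∂(ν t) ≤ ε / 2 :=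
    ⟨max 1 R₀, le_max_left _ _, fun t => hR₀ _ (le_max_right _ _) t⟩
  set c : T → X → ℝ → ℝ := fun t x z => min (h x (ξ (t, z)) t) (2 * R) with hc
  have hhm : ∀ t, Measurable fun p : X × Y => h p.1 p.2 t := fun t =>
    (hcont.comp (continuous_fst.prodMk (continuous_snd.prodMk continuous_const))).measurable
  have hC : Cst c Gd (2 * R) := by
    refine ⟨by linarith, fun t x z => le_min (hnonneg _ _ _) (by linarith), fun t x z => min_le_right _ _,
      fun t => ?_, hGm, hGae, fun t x z hz => ?_⟩
    · exact ((hhm t).comp (measurable_fst.prodMk ((hξm t).comp measurable_snd))).min measurable_const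
    · have h1 : ContinuousAt (fun q : T × X × ℝ => ξ (q.1, q.2.2)) (t, x, z) :=
        ContinuousAt.comp (f := fun q : T × X × ℝ => (q.1, q.2.2)) (hξc t z hz)
          (by fun_prop)
      have h2 : ContinuousAt (fun q : T × X × ℝ => h q.2.1 (ξ (q.1, q.2.2)) q.1) (t, x, z) :=
        ContinuousAt.comp (f := fun q : T × X × ℝ => (q.2.1, ξ (q.1, q.2.2), q.1)) hcont.continuousAt
          ((continuous_fst.comp continuous_snd).continuousAt.prodMk
            (h1.prodMk continuous_fst.continuousAt))
      exact h2.min continuousAt_const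
  obtain ⟨V, hVm, hVl, hVc, hVs⟩ := hC.main hμc (half_pos hε)
  have hTm : ∀ t, Measurable fun x => ξ (t, V t x) := fun t => (hξm t).comp (hVm t)
  have hTl : ∀ t, (μ t).map (fun x => ξ (t, V t x)) = ν t := fun t => by
    rw [← hξl t, ← hVl t, Measure.map_map (hξm t) (hVm t)]; rfl
  refine ⟨fun t x => ξ (t, V t x), hTm, hTl, fun t => ?_, fun t tn htn => ?_⟩
  · have hA : MeasurableSet {x | R ≤ a t x} := measurableSet_le measurable_const (hameas t)
    have hB : MeasurableSet {y | R ≤ b t y} := measurableSet_le measurable_const (hbmeas t)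
    have hAm : Measurable fun x => ENNReal.ofReal ({x | R ≤ a t x}.indicator (a t) x) :=
      ((hameas t).indicator hA).ennreal_ofReal
    have hBm : Measurable fun y => ENNReal.ofReal ({y | R ≤ b t y}.indicator (b t) y) :=
      ((hbmeas t).indicator hB).ennreal_ofReal
    have hpt : ∀ x y, h x y t ≤ min (h x y t) (2 * R) + ({x | R ≤ a t x}.indicator (a t) x +
        {y | R ≤ b t y}.indicator (b t) y) := by
      intro x y
      have h1 := hdom t x y
      have h2 := ha0 t x
      have h3 := hb0 t y
      simp only [Set.indicator, Set.mem_ofPred_eq]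
      rcases le_total (h x y t) (2 * R) with h4 | h4
      · rw [min_eq_left h4]
        split_ifs <;> linarith
      · rw [min_eq_right h4]
        split_ifs <;> linarith
    have i0 : ∀ x, 0 ≤ {x | R ≤ a t x}.indicator (a t) x := fun x =>
      Set.indicator_nonneg (fun x _ => ha0 t x) x
    have j0 : ∀ y, 0 ≤ {y | R ≤ b t y}.indicator (b t) y := fun y =>
      Set.indicator_nonneg (fun y _ => hb0 t y) y
    have eA : ∫⁻ x, ENNReal.ofReal ({x | R ≤ a t x}.indicator (a t) x) ∂(μ t) =
        ENNReal.ofReal (∫ x in {x | R ≤ a t x}, a t x ∂(μ t)) := by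
      rw [← integral_indicator hA, ofReal_integral_eq_lintegral_ofReal ((haint t).indicator hA)
        (Eventually.of_forall i0)]
    have eB : ∫⁻ x, ENNReal.ofReal ({y | R ≤ b t y}.indicator (b t) (ξ (t, V t x))) ∂(μ t) =
        ENNReal.ofReal (∫ y in {y | R ≤ b t y}, b t y ∂(ν t)) := by
      rw [← integral_indicator hB, ofReal_integral_eq_lintegral_ofReal ((hbint t).indicator hB)
        (Eventually.of_forall j0), ← hTl t, lintegral_map hBm (hTm t)]
    have e1 : ∫⁻ x, ENNReal.ofReal (c t x (V t x)) ∂(μ t) ≤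
        kantorovichCost (fun x y => h x y t) (μ t) (ν t) + ENNReal.ofReal (ε / 2) := by
      have k0 : 0 ≤ kk (c t) (μ t) := ENNReal.toReal_nonneg
      calc ∫⁻ x, ENNReal.ofReal (c t x (V t x)) ∂(μ t) = ENNReal.ofReal (∫ x, c t x (V t x) ∂(μ t)) :=
            hC.ofReal_int t measurable_id (hVm t)
        _ ≤ ENNReal.ofReal (kk (c t) (μ t) + ε / 2) := ENNReal.ofReal_le_ofReal (hVc t)
        _ = kantorovichCost (c t) (μ t) lam + ENNReal.ofReal (ε / 2) := by
            rw [ENNReal.ofReal_add k0 (half_pos hε).le, hC.ofReal_kk t]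
        _ ≤ _ := by
            gcongr
            refine (lift_coupling (hξm t) (hξl t) (c := fun x y => min (h x y t) (2 * R))
              ((hhm t).min measurable_const)).trans ?_
            refine iInf₂_mono fun σ _ => lintegral_mono fun p => ENNReal.ofReal_le_ofReal (min_le_left _ _)
    have hABm : Measurable fun x => ENNReal.ofReal ({x | R ≤ a t x}.indicator (a t) x) +
        ENNReal.ofReal ({y | R ≤ b t y}.indicator (b t) (ξ (t, V t x))) :=
      hAm.add (hBm.comp (hTm t))
    calc ∫⁻ x, ENNReal.ofReal (h x (ξ (t, V t x)) t) ∂(μ t)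
        ≤ ∫⁻ x, (ENNReal.ofReal (c t x (V t x)) + (ENNReal.ofReal ({x | R ≤ a t x}.indicator (a t) x) +
            ENNReal.ofReal ({y | R ≤ b t y}.indicator (b t) (ξ (t, V t x))))) ∂(μ t) := by
          refine lintegral_mono fun x => ?_
          rw [← ENNReal.ofReal_add (i0 _) (j0 _), ← ENNReal.ofReal_add (hC.nn _ _ _) (add_nonneg (i0 _) (j0 _))]
          exact ENNReal.ofReal_le_ofReal (hpt _ _)
      _ = ∫⁻ x, ENNReal.ofReal (c t x (V t x)) ∂(μ t) +
          (ENNReal.ofReal (∫ x in {x | R ≤ a t x}, a t x ∂(μ t)) +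
            ENNReal.ofReal (∫ y in {y | R ≤ b t y}, b t y ∂(ν t))) := by
          rw [lintegral_add_right _ hABm, lintegral_add_left hAm, eA, eB]
      _ ≤ (kantorovichCost (fun x y => h x y t) (μ t) (ν t) + ENNReal.ofReal (ε / 2)) +
          ENNReal.ofReal (ε / 2) := by
          refine add_le_add e1 ?_
          rw [← ENNReal.ofReal_add (setIntegral_nonneg hA fun x _ => ha0 t x)
            (setIntegral_nonneg hB fun y _ => hb0 t y)]
          exact ENNReal.ofReal_le_ofReal (hR t)
      _ = _ := by
          rw [add_assoc, ← ENNReal.ofReal_add (half_pos hε).le (half_pos hε).le, add_halves]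
  · have hgd : ∀ᵐ x ∂(μ t), V t x ∈ Gd t := by
      have := hGae t
      rw [← hVl t] at this
      exact ae_of_ae_map (hVm t).aemeasurable this
    filter_upwards [hVs t tn htn, hgd] with x hx hxg
    exact (hξc t _ hxg).tendsto.comp (htn.prodMk_nhds hx)
end
end

section
/- Let K₁ be a compact metric space with metric d, let K₂ be a compact topological space, let T be a metric space, and let h : K₁ × K₂ × T → ℝ be continuous. Then for every ε > 0 there exists a continuous strictly positive function δ : T → (0,+∞) such that for all x₁, x₂ ∈ K₁, y ∈ K₂ and t ∈ T, if d(x₁, x₂) < δ(t) then |h(x₁, y, t) − h(x₂, y, t)| < ε. -/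
open Filter Topology

/-- For a continuous function `h` on `K₁ × K₂ × T` with `K₁` a compact
metric space, `K₂` a compact topological space and `T` a metric space, for every `ε > 0`
there exists a continuous strictly positive function `δ : T → (0, ∞)` such that
`|h(x₁,y,t) − h(x₂,y,t)| < ε` whenever `dist x₁ x₂ < δ t`. -/
theorem continuous_parametric_modulus
    {K₁ K₂ T : Type*} [MetricSpace K₁] [CompactSpace K₁]
    [TopologicalSpace K₂] [CompactSpace K₂] [MetricSpace T]
    (h : K₁ × K₂ × T → ℝ) (hcont : Continuous h) (ε : ℝ) (hε : 0 < ε) :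
    ∃ δ : T → ℝ, Continuous δ ∧ (∀ t, 0 < δ t) ∧
      ∀ (x₁ x₂ : K₁) (y : K₂) (t : T), dist x₁ x₂ < δ t →
        |h (x₁, y, t) - h (x₂, y, t)| < ε := by
  have hloc : ∀ t₀ : T, ∃ r : ℝ, ∀ᶠ t in 𝓝 t₀, r ∈ {r : ℝ | 0 < r ∧
      ∀ (x₁ x₂ : K₁) (y : K₂), dist x₁ x₂ < r → |h (x₁, y, t) - h (x₂, y, t)| < ε} := by
    intro t₀
    have key : ∀ᶠ s : ℝ × T in 𝓝 ((0 : ℝ), t₀), ∀ q ∈ (Set.univ : Set (K₁ × K₁ × K₂)),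
        dist q.1 q.2.1 < s.1 → |h (q.1, q.2.2, s.2) - h (q.2.1, q.2.2, s.2)| < ε := by
      apply isCompact_univ.eventually_forall_of_forall_eventually
      rintro ⟨a, b, y⟩ -
      by_cases hab : a = b
      · subst hab
        have hc : Continuous fun z : (ℝ × T) × (K₁ × K₁ × K₂) =>
            |h (z.2.1, z.2.2.2, z.1.2) - h (z.2.2.1, z.2.2.2, z.1.2)| := by fun_prop
        have := hc.continuousAt.eventually_lt (x₀ := (((0 : ℝ), t₀), (a, a, y)))
          (continuousAt_const (y := ε)) (by simpa using hε)
        filter_upwards [this] with z hz _ using hz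
      · have h1 : Continuous fun z : (ℝ × T) × (K₁ × K₁ × K₂) => z.1.1 := by fun_prop
        have h2 : Continuous fun z : (ℝ × T) × (K₁ × K₁ × K₂) => dist z.2.1 z.2.2.1 := by
          fun_prop
        have := h1.continuousAt.eventually_lt (x₀ := (((0 : ℝ), t₀), (a, b, y)))
          h2.continuousAt (by simpa using hab)
        filter_upwards [this] with z hz hz' using absurd hz' (not_lt.mpr hz.le)
    rw [nhds_prod_eq] at key
    have h3 : ∀ᶠ r in 𝓝[>] (0 : ℝ), _ := key.curry.filter_mono nhdsWithin_le_nhds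
    obtain ⟨r, hr, hr0⟩ := (h3.and self_mem_nhdsWithin).exists
    refine ⟨r, ?_⟩
    filter_upwards [hr] with t ht
    exact ⟨hr0, fun x₁ x₂ y hd => ht (x₁, x₂, y) trivial hd⟩
  obtain ⟨δ, hδ⟩ := exists_continuous_forall_mem_convex_of_local_const (fun t => by
    apply Set.OrdConnected.convex
    refine ⟨fun a ha b hb c hc => ⟨ha.1.trans_le hc.1, fun x₁ x₂ y hd =>
      hb.2 x₁ x₂ y (hd.trans_le hc.2)⟩⟩) hloc
  exact ⟨δ, δ.continuous, fun t => (hδ t).1, fun x₁ x₂ y t => (hδ t).2 x₁ x₂ y⟩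
end

section
/- Let X and Y be complete metric spaces with metrics d_X and d_Y, let K₁ ⊂ X be compact, let T be a metric space, let h : X × Y × T → [0,∞) be continuous, and suppose the mapping t ↦ ν_t from T to P_r(Y) is continuous in the weak topology. Then for every ε > 0 there exist a continuous strictly positive function δ : T → (0,+∞) and a collection of closed sets Y(t) ⊂ Y, t ∈ T, such that for every t ∈ T one has ν_t(Y ∖ Y(t)) < ε, and |h(x₁, y, t) − h(x₂, y, t)| < ε for all x₁, x₂ ∈ K₁ with d_X(x₁, x₂) < δ(t) and all y ∈ Y(t). -/
open MeasureTheory Filter Topology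

noncomputable section

/-- For complete metric spaces `X`, `Y`, a compact set `K₁ ⊆ X`, a
continuous nonnegative cost `h` and a weakly continuous family of Radon probability
measures `t ↦ ν t` on `Y`, for every `ε > 0` there exist a continuous strictly positive
function `δ : T → (0, ∞)` and closed sets `Y(t) ⊆ Y` with `ν_t(Y ∖ Y(t)) < ε` such that
`|h(x₁,y,t) − h(x₂,y,t)| < ε` whenever `x₁, x₂ ∈ K₁`, `dist x₁ x₂ < δ t`, `y ∈ Y(t)`. -/
theorem continuous_modulus_with_good_sets
    {X Y T : Type*} [MetricSpace X] [CompleteSpace X] [MetricSpace Y] [CompleteSpace Y]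
    [MetricSpace T] [MeasurableSpace Y] [BorelSpace Y]
    (K₁ : Set X) (hK₁ : IsCompact K₁)
    (h : X → Y → T → ℝ)
    (hcont : Continuous fun p : X × Y × T => h p.1 p.2.1 p.2.2)
    (hnonneg : ∀ x y t, 0 ≤ h x y t)
    (ν : T → Measure Y)
    (hνp : ∀ t, IsProbabilityMeasure (ν t)) (hνr : ∀ t, (ν t).InnerRegular)
    (hνc : WeaklyContinuousFamily ν)
    (ε : ℝ) (hε : 0 < ε) :
    ∃ (δ : T → ℝ) (Yt : T → Set Y), Continuous δ ∧ (∀ t, 0 < δ t) ∧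
      (∀ t, IsClosed (Yt t)) ∧ (∀ t, ν t (Yt t)ᶜ < ENNReal.ofReal ε) ∧
      ∀ t : T, ∀ x₁ ∈ K₁, ∀ x₂ ∈ K₁, ∀ y ∈ Yt t, dist x₁ x₂ < δ t →
        |h x₁ y t - h x₂ y t| < ε := by
  have key : ∃ g : C(T, ℝ), ∀ t, g t ∈ {r : ℝ | 0 < r ∧ ∃ F : Set Y, IsClosed F ∧
      ν t Fᶜ < ENNReal.ofReal ε ∧ ∀ x₁ ∈ K₁, ∀ x₂ ∈ K₁, ∀ y ∈ F, dist x₁ x₂ < r →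
        |h x₁ y t - h x₂ y t| < ε} := by
    apply exists_continuous_forall_mem_convex_of_local_const
    · intro t
      apply Set.OrdConnected.convex
      constructor
      rintro a ⟨ha, -⟩ b ⟨hb, F, hF, hF1, hF2⟩ c ⟨hac, hcb⟩
      exact ⟨ha.trans_le hac, F, hF, hF1, fun x₁ h₁ x₂ h₂ y hy hd =>
        hF2 x₁ h₁ x₂ h₂ y hy (hd.trans_le hcb)⟩
    · intro t₀
      have := hνp t₀
      have := hνr t₀
      have hε' : ENNReal.ofReal ε ≠ 0 := by simpa using hε
      obtain ⟨C, -, hC, hCc, hCε⟩ := MeasurableSet.univ.exists_isCompact_isClosed_sdiff_lt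
        (μ := ν t₀) (measure_ne_top _ _) hε'
      rw [← Set.compl_eq_univ_sdiff] at hCε
      let N : Set ((X × X) × (Y × T)) :=
        {p | |h p.1.1 p.2.1 p.2.2 - h p.1.2 p.2.1 p.2.2| < ε}
      have hN : IsOpen N := by
        have h1 : Continuous fun p : (X × X) × (Y × T) => h p.1.1 p.2.1 p.2.2 :=
          hcont.comp (f := fun p : (X × X) × (Y × T) => (p.1.1, p.2.1, p.2.2)) (by fun_prop)
        have h2 : Continuous fun p : (X × X) × (Y × T) => h p.1.2 p.2.1 p.2.2 :=
          hcont.comp (f := fun p : (X × X) × (Y × T) => (p.1.2, p.2.1, p.2.2)) (by fun_prop)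
        exact isOpen_lt (h1.sub h2).abs continuous_const
      have hD : IsCompact ((fun x : X => (x, x)) '' K₁) := hK₁.image (by fun_prop)
      obtain ⟨V, W, hV, hW, hDV, hCW, hVW⟩ := generalized_tube_lemma hD
        (hC.prod (isCompact_singleton (x := t₀))) hN (by
          rintro ⟨⟨a, b⟩, y, t⟩ ⟨⟨x, hx, hxe⟩, -⟩
          simp only [Prod.mk.injEq] at hxe
          obtain ⟨rfl, rfl⟩ := hxe
          simpa [N] using hε)
      obtain ⟨U, S, hU, hS, hCU, hS0, hUS⟩ := generalized_tube_lemma hC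
        (isCompact_singleton (x := t₀)) hW hCW
      obtain ⟨r, hr, hrV⟩ := hD.exists_thickening_subset_open hV hDV
      obtain ⟨O, hO, hCO, hOU⟩ := normal_exists_closure_subset hCc hU hCU
      obtain ⟨f, hf0, hf1, hf⟩ := exists_bounded_zero_one_of_closed hCc hO.isClosed_compl
        (Set.disjoint_compl_right_iff_subset.2 hCO)
      have hint : ∀ t, ν t Oᶜ ≤ ENNReal.ofReal (∫ y, f y ∂(ν t)) := by
        intro t
        have := hνp t
        rw [ofReal_integral_eq_lintegral_ofReal (f.integrable _)
          (ae_of_all _ fun y => (hf y).1), ← lintegral_indicator_one hO.measurableSet.compl]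
        apply lintegral_mono
        intro y
        by_cases hy : y ∈ Oᶜ
        · simp [hy, hf1 hy]
        · simp only [Set.indicator_of_notMem hy]; exact zero_le
      have h0 : ∫ y, f y ∂(ν t₀) < ε := by
        rw [← ENNReal.ofReal_lt_ofReal_iff hε]
        refine lt_of_le_of_lt ?_ hCε
        rw [ofReal_integral_eq_lintegral_ofReal (f.integrable _)
          (ae_of_all _ fun y => (hf y).1), ← lintegral_indicator_one hCc.measurableSet.compl]
        apply lintegral_mono
        intro y
        by_cases hy : y ∈ C
        · simp [hy, hf0 hy]
        · simpa [hy] using (hf y).2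
      refine ⟨r, ?_⟩
      filter_upwards [(hνc f).continuousAt.eventually_lt continuousAt_const h0,
        hS.mem_nhds (hS0 rfl)] with t ht htS
      refine ⟨hr, closure O, isClosed_closure, ?_, ?_⟩
      · refine (measure_mono (Set.compl_subset_compl.2 subset_closure)).trans_lt
          ((hint t).trans_lt ?_)
        exact (ENNReal.ofReal_lt_ofReal_iff hε).2 ht
      · intro x₁ h₁ x₂ h₂ y hy hd
        have hv : (x₁, x₂) ∈ V := by
          apply hrV
          rw [Metric.mem_thickening_iff]
          refine ⟨(x₁, x₁), ⟨x₁, h₁, rfl⟩, ?_⟩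
          simpa [Prod.dist_eq, dist_comm x₂ x₁, hr] using hd
        exact hVW (Set.mk_mem_prod hv (hUS (Set.mk_mem_prod (hOU hy) htS)))
  obtain ⟨g, hg⟩ := key
  choose hpos F hF h1 h2 using hg
  exact ⟨g, F, g.continuous, hpos, hF, h1, h2⟩
end
end

section
/- Let X be a complete separable metric space and Y a complete metric space with metrics d_X and d_Y, let T be a metric space, and let h : X × Y × T → [0,∞) be continuous. Suppose the mapping t ↦ ν_t from T to P_r(Y) is continuous in the weak topology and the mapping t ↦ μ_t from T to P_r(X) is continuous in the total variation norm. Then for every ε > 0 there exist a continuous strictly positive function δ : T → (0,+∞), a collection of compact sets X(t) ⊂ X and a collection of closed sets Y(t) ⊂ Y, t ∈ T, such that for every t ∈ T one has μ_t(X ∖ X(t)) < ε, ν_t(Y ∖ Y(t)) < ε, and |h(x₁, y, t) − h(x₂, y, t)| < ε for all x₁, x₂ ∈ X(t) with d_X(x₁, x₂) < δ(t) and all y ∈ Y(t). -/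
open MeasureTheory Filter Topology

noncomputable section

/-- For `X` complete separable metric, `Y` complete metric, a continuous
nonnegative cost `h`, a weakly continuous family `t ↦ ν t` of Radon probability measures
on `Y`, and a family `t ↦ μ t` of Radon probability measures on `X` continuous in the
total variation norm, for every `ε > 0` there exist a continuous strictly positive
`δ : T → (0, ∞)`, compact sets `X(t) ⊆ X` and closed sets `Y(t) ⊆ Y` with
`μ_t(X ∖ X(t)) < ε`, `ν_t(Y ∖ Y(t)) < ε`, such that `|h(x₁,y,t) − h(x₂,y,t)| < ε`
whenever `x₁, x₂ ∈ X(t)`, `dist x₁ x₂ < δ t`, `y ∈ Y(t)`. -/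
theorem continuous_modulus_with_good_sets_varying
    {X Y T : Type*} [MetricSpace X] [CompleteSpace X] [TopologicalSpace.SeparableSpace X]
    [MetricSpace Y] [CompleteSpace Y] [MetricSpace T]
    [MeasurableSpace X] [BorelSpace X] [MeasurableSpace Y] [BorelSpace Y]
    (h : X → Y → T → ℝ)
    (hcont : Continuous fun p : X × Y × T => h p.1 p.2.1 p.2.2)
    (hnonneg : ∀ x y t, 0 ≤ h x y t)
    (μ : T → Measure X) (ν : T → Measure Y)
    (hμp : ∀ t, IsProbabilityMeasure (μ t)) (hνp : ∀ t, IsProbabilityMeasure (ν t))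
    (hμr : ∀ t, (μ t).InnerRegular) (hνr : ∀ t, (ν t).InnerRegular)
    (hμc : TVContinuousFamily μ) (hνc : WeaklyContinuousFamily ν)
    (ε : ℝ) (hε : 0 < ε) :
    ∃ (δ : T → ℝ) (Xt : T → Set X) (Yt : T → Set Y), Continuous δ ∧ (∀ t, 0 < δ t) ∧
      (∀ t, IsCompact (Xt t)) ∧ (∀ t, IsClosed (Yt t)) ∧
      (∀ t, μ t (Xt t)ᶜ < ENNReal.ofReal ε) ∧ (∀ t, ν t (Yt t)ᶜ < ENNReal.ofReal ε) ∧
      ∀ t : T, ∀ x₁ ∈ Xt t, ∀ x₂ ∈ Xt t, ∀ y ∈ Yt t, dist x₁ x₂ < δ t →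
        |h x₁ y t - h x₂ y t| < ε := by
  rcases isEmpty_or_nonempty T with hT | hT
  · exact ⟨fun _ => 1, fun _ => ∅, fun _ => ∅, continuous_const, fun _ => one_pos, isEmptyElim,
      isEmptyElim, isEmptyElim, isEmptyElim, isEmptyElim⟩
  have hε' : (0 : ENNReal) < ENNReal.ofReal ε := ENNReal.ofReal_pos.2 hε
  let S : T → Set ℝ := fun t => {d | 0 < d ∧ ∃ (A : Set X) (B : Set Y), IsCompact A ∧ IsClosed B ∧
    μ t Aᶜ < ENNReal.ofReal ε ∧ ν t Bᶜ < ENNReal.ofReal ε ∧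
    ∀ x₁ ∈ A, ∀ x₂ ∈ A, ∀ y ∈ B, dist x₁ x₂ < d → |h x₁ y t - h x₂ y t| < ε}
  have hconv : ∀ t, Convex ℝ (S t) := by
    intro t
    apply Set.OrdConnected.convex
    constructor
    rintro a ⟨ha, -⟩ b ⟨-, A, B, hA, hB, h1, h2, h3⟩ c hc
    exact ⟨ha.trans_le hc.1, A, B, hA, hB, h1, h2, fun x₁ hx₁ x₂ hx₂ y hy hd =>
      h3 x₁ hx₁ x₂ hx₂ y hy (hd.trans_le hc.2)⟩
  have hloc : ∀ t₀ : T, ∃ c : ℝ, ∀ᶠ t in 𝓝 t₀, c ∈ S t := by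
    intro t₀
    have := hμp t₀
    have := hνp t₀
    have := hμr t₀
    have := hνr t₀
    obtain ⟨K, -, hK, hKm⟩ := (MeasurableSet.univ (α := X)).exists_isCompact_diff_lt
      (measure_ne_top (μ t₀) _) hε'.ne'
    obtain ⟨C, -, hC, hCm⟩ := (MeasurableSet.univ (α := Y)).exists_isCompact_diff_lt
      (measure_ne_top (ν t₀) _) hε'.ne'
    rw [← Set.compl_eq_univ_diff] at hKm hCm
    have hcomp : IsCompact (K ×ˢ C ×ˢ ({t₀} : Set T)) := hK.prod (hC.prod isCompact_singleton)
    have hu := hcomp.uniformContinuousAt_of_continuousAt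
      (fun p : X × Y × T => h p.1 p.2.1 p.2.2) (fun p _ => hcont.continuousAt)
      (Metric.dist_mem_uniformity (half_pos hε))
    obtain ⟨η, hη, hu⟩ := Metric.mem_uniformity_dist.1 hu
    have hμe : ∀ᶠ t in 𝓝 t₀, μ t Kᶜ < ENNReal.ofReal ε := by
      have h0 : Tendsto (fun t => μ t₀ Kᶜ + tvDist (μ t) (μ t₀)) (𝓝 t₀) (𝓝 (μ t₀ Kᶜ + 0)) :=
        tendsto_const_nhds.add (hμc t₀)
      rw [add_zero] at h0
      filter_upwards [h0.eventually_lt_const hKm] with t ht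
      refine lt_of_le_of_lt ?_ ht
      refine le_add_tsub.trans (add_le_add le_rfl ?_)
      exact le_self_add.trans
        (le_iSup₂ (f := fun (s : Set X) (_ : MeasurableSet s) =>
          ((μ t s - μ t₀ s) + (μ t₀ s - μ t s))) Kᶜ hK.measurableSet.compl)
    have hνe : ∀ᶠ t in 𝓝 t₀, ν t (Metric.thickening (η / 2) C)ᶜ < ENNReal.ofReal ε := by
      let N : T → ProbabilityMeasure Y := fun t => ⟨ν t, hνp t⟩
      have hN : Tendsto N (𝓝 t₀) (𝓝 (N t₀)) :=
        ProbabilityMeasure.tendsto_iff_forall_integral_tendsto.2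
          fun f => (hνc f).tendsto t₀
      have hl := ProbabilityMeasure.limsup_measure_closed_le_of_tendsto hN
        (F := (Metric.thickening (η / 2) C)ᶜ) Metric.isOpen_thickening.isClosed_compl
      have hl2 := (hl.trans (measure_mono (Set.compl_subset_compl.2
        (Metric.self_subset_thickening (half_pos hη) C)))).trans_lt hCm
      exact eventually_lt_of_limsup_lt hl2
    refine ⟨η, ?_⟩
    filter_upwards [hμe, hνe, Metric.ball_mem_nhds t₀ hη] with t h1 h2 h3
    refine ⟨hη, K, Metric.cthickening (η / 2) C, hK, Metric.isClosed_cthickening, h1,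
      (measure_mono (Set.compl_subset_compl.2
        (Metric.thickening_subset_cthickening _ _))).trans_lt h2, ?_⟩
    intro x₁ hx₁ x₂ hx₂ y hy hd
    obtain ⟨c, hc, hyc⟩ := Metric.mem_thickening_iff.1
      (Metric.cthickening_subset_thickening' hη (half_lt_self hη) C hy)
    have key : ∀ x, dist x₁ x < η → |h x₁ c t₀ - h x y t| < ε / 2 := by
      intro x hx
      have := @hu (x₁, c, t₀) (x, y, t) (by
        simp only [Prod.dist_eq, max_lt_iff]
        exact ⟨hx, by rwa [dist_comm], by rw [dist_comm]; exact h3⟩) ⟨hx₁, hc, rfl⟩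
      simpa [Real.dist_eq] using this
    have k1 := abs_lt.1 (key x₁ (by simpa using hη))
    have k2 := abs_lt.1 (key x₂ hd)
    rw [abs_lt]
    constructor <;> linarith [k1.1, k1.2, k2.1, k2.2]
  obtain ⟨g, hg⟩ := exists_continuous_forall_mem_convex_of_local_const hconv hloc
  choose hpos A B hA hB h1 h2 h3 using hg
  exact ⟨g, A, B, g.continuous, hpos, hA, hB, h1, h2, h3⟩
end
end

section
/- Let X and Y be completely regular topological spaces, let μ be a Radon probability measure on X, and let π_n (n ∈ ℕ) and π be Radon probability measures on X × Y, each of whose projections onto X equals μ, such that π_n converges weakly to π. Then for every Borel set B ⊂ X the measures 1_{B×Y}·π_n converge weakly to 1_{B×Y}·π; in particular, the projections onto Y of 1_{B×Y}·π_n converge weakly to the projection onto Y of 1_{B×Y}·π. -/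
open MeasureTheory Filter Topology

lemma aux_sep {X : Type*} [TopologicalSpace X] [CompletelyRegularSpace X]
    {K F : Set X} (hK : IsCompact K) (hF : IsClosed F) (hKF : Disjoint K F) :
    ∃ φ : X → ℝ, Continuous φ ∧ (∀ x, 0 ≤ φ x ∧ φ x ≤ 1) ∧ (∀ x ∈ K, φ x = 0) ∧
      ∀ x ∈ F, φ x = 1 := by
  refine hK.induction_on (p := fun s => ∃ φ : X → ℝ, Continuous φ ∧ (∀ x, 0 ≤ φ x ∧ φ x ≤ 1) ∧
    (∀ x ∈ s, φ x = 0) ∧ ∀ x ∈ F, φ x = 1) ?_ ?_ ?_ ?_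
  · exact ⟨fun _ => 1, continuous_const, by simp, by simp, by simp⟩
  · rintro s t hst ⟨φ, h1, h2, h3, h4⟩
    exact ⟨φ, h1, h2, fun x hx => h3 x (hst hx), h4⟩
  · rintro s t ⟨φ, h1, h2, h3, h4⟩ ⟨ψ, k1, k2, k3, k4⟩
    refine ⟨fun x => min (φ x) (ψ x), h1.min k1, fun x => ⟨le_min (h2 x).1 (k2 x).1,
      (min_le_left _ _).trans (h2 x).2⟩, ?_, fun x hx => by simp [h4 x hx, k4 x hx]⟩
    rintro x (hx | hx)
    · simp [h3 x hx, (k2 x).1]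
    · simp [k3 x hx, (h2 x).1]
  · intro x hx
    obtain ⟨g, hg, hg0, hg1⟩ := CompletelyRegularSpace.completely_regular x F hF
      (Set.disjoint_left.1 hKF hx)
    have hgc : Continuous (fun y => (g y : ℝ)) := continuous_subtype_val.comp hg
    refine ⟨{y | (g y : ℝ) < 1 / 2}, mem_nhdsWithin_of_mem_nhds
      ((isOpen_lt hgc continuous_const).mem_nhds (by simp [hg0])),
      fun y => max 0 (2 * (g y : ℝ) - 1), by fun_prop, ?_, ?_, ?_⟩
    · intro y
      refine ⟨le_max_left _ _, max_le (by norm_num) ?_⟩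
      have := (g y).2.2
      linarith
    · intro y hy
      have hy' : (g y : ℝ) < 1 / 2 := hy
      exact max_eq_left (by linarith)
    · intro y hy
      have : g y = 1 := hg1 hy
      simp only [this]
      norm_num

lemma aux_between {X Y : Type*} [TopologicalSpace X] [TopologicalSpace Y]
    [MeasurableSpace X] [BorelSpace X] [MeasurableSpace Y] [BorelSpace Y]
    {C U : Set (X × Y)} (hC : IsCompact C) (hU : IsOpen U) (hCU : C ⊆ U) :
    ∃ R, MeasurableSet R ∧ C ⊆ R ∧ R ⊆ U := by
  refine hC.induction_on (p := fun s => ∃ R, MeasurableSet R ∧ s ⊆ R ∧ R ⊆ U) ?_ ?_ ?_ ?_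
  · exact ⟨∅, by simp, by simp, by simp⟩
  · rintro s t hst ⟨R, h1, h2, h3⟩
    exact ⟨R, h1, hst.trans h2, h3⟩
  · rintro s t ⟨R, h1, h2, h3⟩ ⟨S, k1, k2, k3⟩
    exact ⟨R ∪ S, h1.union k1, Set.union_subset_union h2 k2, Set.union_subset h3 k3⟩
  · rintro ⟨x, y⟩ hx
    obtain ⟨u, v, hu, hv, hxu, hyv, huv⟩ := isOpen_prod_iff.1 hU x y (hCU hx)
    exact ⟨u ×ˢ v, mem_nhdsWithin_of_mem_nhds ((hu.prod hv).mem_nhds ⟨hxu, hyv⟩),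
      u ×ˢ v, hu.measurableSet.prod hv.measurableSet, subset_rfl, huv⟩

lemma aux_aem {X Y : Type*} [TopologicalSpace X] [CompletelyRegularSpace X]
    [TopologicalSpace Y] [CompletelyRegularSpace Y]
    [MeasurableSpace X] [BorelSpace X] [MeasurableSpace Y] [BorelSpace Y]
    (ρ : Measure (X × Y)) [IsProbabilityMeasure ρ] (hr : ρ.InnerRegular)
    (f : X × Y → ℝ) (hf : Continuous f) : AEMeasurable f ρ := by
  have key : ∀ n : ℕ, ∃ L : Set (X × Y), IsCompact L ∧ MeasurableSet L ∧
      ρ Lᶜ ≤ ((n : ENNReal) + 1)⁻¹ := by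
    intro n
    obtain ⟨K, -, hK, hlt⟩ := (MeasurableSet.univ : MeasurableSet (Set.univ : Set (X × Y))).exists_isCompact_lt_add
      (μ := ρ) (measure_ne_top _ _) (ε := ((n : ENNReal) + 1)⁻¹) (by simp)
    have h1 := (hK.image continuous_fst).closure
    have h2 := (hK.image continuous_snd).closure
    have hm : MeasurableSet (closure (Prod.fst '' K) ×ˢ closure (Prod.snd '' K)) :=
      isClosed_closure.measurableSet.prod isClosed_closure.measurableSet
    refine ⟨_, h1.prod h2, hm, ?_⟩
    have hsub : K ⊆ closure (Prod.fst '' K) ×ˢ closure (Prod.snd '' K) := fun p hp =>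
      ⟨subset_closure ⟨p, hp, rfl⟩, subset_closure ⟨p, hp, rfl⟩⟩
    rw [measure_compl hm (measure_ne_top _ _)]
    exact tsub_le_iff_left.2 (hlt.le.trans (by gcongr))
  choose L hLc hLm hL using key
  have h0 : ρ (⋃ n, L n)ᶜ = 0 := by
    have hle : ∀ n : ℕ, ρ (⋃ n, L n)ᶜ ≤ ((n : ENNReal) + 1)⁻¹ := fun n =>
      (measure_mono (Set.compl_subset_compl.2 (Set.subset_iUnion L n))).trans (hL n)
    have ht : Tendsto (fun n : ℕ => ((n : ENNReal) + 1)⁻¹) atTop (𝓝 0) := by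
      have := (tendsto_add_atTop_iff_nat 1).2 ENNReal.tendsto_inv_nat_nhds_zero
      simpa using this
    exact le_antisymm (ge_of_tendsto' ht hle) zero_le
  have hres : ρ.restrict (⋃ n, L n) = ρ :=
    Measure.restrict_eq_self_of_ae_mem (mem_ae_iff.2 h0)
  rw [← hres, aemeasurable_iUnion_iff]
  intro n
  refine aemeasurable_restrict_of_measurable_subtype (hLm n) (measurable_of_Ici fun a => ?_)
  have hC : IsCompact (L n ∩ f ⁻¹' Set.Ici a) := (hLc n).inter_right (isClosed_Ici.preimage hf)
  have hex : ∀ k : ℕ, ∃ R, MeasurableSet R ∧ L n ∩ f ⁻¹' Set.Ici a ⊆ R ∧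
      R ⊆ f ⁻¹' Set.Ioi (a - 1 / ((k : ℝ) + 1)) := fun k =>
    aux_between hC (isOpen_Ioi.preimage hf) (by
      rintro p ⟨-, hp⟩
      have hp' : a ≤ f p := hp
      have : 0 < 1 / ((k : ℝ) + 1) := by positivity
      change a - 1 / ((k : ℝ) + 1) < f p
      linarith)
  choose R hRm hR1 hR2 using hex
  have heq : (fun x : L n => f x) ⁻¹' Set.Ici a = Subtype.val ⁻¹' (⋂ k, R k) := by
    ext ⟨p, hp⟩
    constructor
    · intro h
      exact Set.mem_iInter.2 fun k => hR1 k ⟨hp, h⟩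
    · intro h
      have ht : Tendsto (fun k : ℕ => a - 1 / ((k : ℝ) + 1)) atTop (𝓝 (a - 0)) :=
        tendsto_const_nhds.sub tendsto_one_div_add_atTop_nhds_zero_nat
      rw [sub_zero] at ht
      exact le_of_tendsto' ht fun k => le_of_lt (hR2 k (Set.mem_iInter.1 h k))
  rw [heq]
  exact measurable_subtype_coe (MeasurableSet.iInter hRm)

lemma aux_est {X Y : Type*} [TopologicalSpace X] [CompletelyRegularSpace X]
    [TopologicalSpace Y] [CompletelyRegularSpace Y]
    [MeasurableSpace X] [BorelSpace X] [MeasurableSpace Y] [BorelSpace Y]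
    (μ : Measure X) (ρ : Measure (X × Y)) [IsProbabilityMeasure ρ] (hr : ρ.InnerRegular)
    (hproj : ρ.map Prod.fst = μ) (B S : Set X) (hB : MeasurableSet B) (hS : MeasurableSet S)
    (φ : X → ℝ) (hφ : Continuous φ) (h01 : ∀ x, 0 ≤ φ x ∧ φ x ≤ 1)
    (h1 : ∀ x, x ∉ S → x ∈ B → φ x = 1) (h0 : ∀ x, x ∉ S → x ∉ B → φ x = 0)
    (f : X × Y → ℝ) (hf : Continuous f) (C : ℝ) (hC : ∀ p, |f p| ≤ C) :
    |(∫ p, f p ∂(ρ.restrict (B ×ˢ Set.univ))) - ∫ p, f p * φ p.1 ∂ρ| ≤ C * μ.real S := by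
  have hBm : MeasurableSet (B ×ˢ (Set.univ : Set Y)) := hB.prod MeasurableSet.univ
  have hSm : MeasurableSet (Prod.fst ⁻¹' S : Set (X × Y)) := measurable_fst hS
  have hfi : Integrable f ρ := Integrable.of_bound
    (aux_aem ρ hr f hf).aestronglyMeasurable C (ae_of_all _ hC)
  have hgi : Integrable (fun p : X × Y => f p * φ p.1) ρ := by
    refine Integrable.of_bound
      (aux_aem ρ hr _ (hf.mul (hφ.comp continuous_fst))).aestronglyMeasurable C
      (ae_of_all _ fun p => ?_)
    rw [Real.norm_eq_abs, abs_mul, abs_of_nonneg (h01 p.1).1]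
    exact (mul_le_of_le_one_right (abs_nonneg _) (h01 p.1).2).trans (hC p)
  rw [← integral_indicator hBm, ← integral_sub (hfi.indicator hBm) hgi]
  have hμ : μ.real S = ρ.real (Prod.fst ⁻¹' S) := by
    rw [← hproj, map_measureReal_apply measurable_fst hS]
  have hint : ∫ p, (Prod.fst ⁻¹' S : Set (X × Y)).indicator (fun _ => C) p ∂ρ = C * μ.real S := by
    rw [integral_indicator_const C hSm, hμ, smul_eq_mul, mul_comm]
  rw [← hint, ← Real.norm_eq_abs]
  refine norm_integral_le_of_norm_le ((integrable_const C).indicator hSm) (ae_of_all _ fun p => ?_)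
  rw [Real.norm_eq_abs]
  have ha := hC p
  have hb := h01 p.1
  by_cases hpS : p.1 ∈ S <;> by_cases hpB : p.1 ∈ B
  · have e : f p - f p * φ p.1 = f p * (1 - φ p.1) := by ring
    simp only [Set.indicator, Set.mem_prod, Set.mem_univ, and_true, Set.mem_preimage, hpS, hpB,
      if_true]
    rw [e, abs_mul, abs_of_nonneg (by linarith : 0 ≤ 1 - φ p.1)]
    exact (mul_le_of_le_one_right (abs_nonneg _) (by linarith)).trans ha
  · simp only [Set.indicator, Set.mem_prod, Set.mem_univ, and_true, Set.mem_preimage, hpS, hpB,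
      if_true, if_false, zero_sub, abs_neg]
    rw [abs_mul, abs_of_nonneg hb.1]
    exact (mul_le_of_le_one_right (abs_nonneg _) hb.2).trans ha
  · simp [Set.indicator, hpS, hpB, h1 _ hpS hpB]
  · simp [Set.indicator, hpS, hpB, h0 _ hpS hpB]

/-- Let `X`, `Y` be completely regular spaces, `μ` a Radon probability
measure on `X`, and `π n`, `π` Radon probability measures on `X × Y` with `X`-projection
equal to `μ`, such that `π n → π` weakly. Then for every Borel set `B ⊆ X` the measures
`1_{B×Y}·π n` converge weakly to `1_{B×Y}·π`; in particular their `Y`-projections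
converge weakly as well. -/
theorem restricted_plans_weakly_converge
    {X Y : Type*} [TopologicalSpace X] [CompletelyRegularSpace X]
    [TopologicalSpace Y] [CompletelyRegularSpace Y]
    [MeasurableSpace X] [BorelSpace X] [MeasurableSpace Y] [BorelSpace Y]
    (μ : Measure X) (hμp : IsProbabilityMeasure μ) (hμr : μ.InnerRegular)
    (π : ℕ → Measure (X × Y)) (πl : Measure (X × Y))
    (hπp : ∀ n, IsProbabilityMeasure (π n)) (hπlp : IsProbabilityMeasure πl)
    (hπr : ∀ n, (π n).InnerRegular) (hπlr : πl.InnerRegular)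
    (hproj : ∀ n, (π n).map Prod.fst = μ) (hprojl : πl.map Prod.fst = μ)
    (hconv : ∀ f : BoundedContinuousFunction (X × Y) ℝ,
      Tendsto (fun n => ∫ p, f p ∂(π n)) atTop (𝓝 (∫ p, f p ∂πl)))
    (B : Set X) (hB : MeasurableSet B) :
    (∀ f : BoundedContinuousFunction (X × Y) ℝ,
      Tendsto (fun n => ∫ p, f p ∂((π n).restrict (B ×ˢ Set.univ))) atTop
        (𝓝 (∫ p, f p ∂(πl.restrict (B ×ˢ Set.univ))))) ∧
    (∀ g : BoundedContinuousFunction Y ℝ,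
      Tendsto (fun n => ∫ y, g y ∂(((π n).restrict (B ×ˢ Set.univ)).map Prod.snd)) atTop
        (𝓝 (∫ y, g y ∂((πl.restrict (B ×ˢ Set.univ)).map Prod.snd)))) := by
  have main : ∀ f : BoundedContinuousFunction (X × Y) ℝ,
      Tendsto (fun n => ∫ p, f p ∂((π n).restrict (B ×ˢ Set.univ))) atTop
        (𝓝 (∫ p, f p ∂(πl.restrict (B ×ˢ Set.univ)))) := by
    intro f
    have hC : ∀ p, |f p| ≤ ‖f‖ := fun p => f.norm_coe_le_norm p
    rw [Metric.tendsto_atTop]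
    intro ε hε
    have hN : 0 < ‖f‖ + 1 := by positivity
    set δ : ℝ := ε / (8 * (‖f‖ + 1)) with hδ
    have hδ0 : 0 < δ := by positivity
    have hδ' : ENNReal.ofReal δ ≠ 0 := by simpa using hδ0
    obtain ⟨K, hKB, hKc, hKcl, hK⟩ :=
      hB.exists_isCompact_isClosed_sdiff_lt (μ := μ) (measure_ne_top _ _) hδ'
    obtain ⟨F, hFB, hFc, hFcl, hF⟩ :=
      hB.compl.exists_isCompact_isClosed_sdiff_lt (μ := μ) (measure_ne_top _ _) hδ'
    obtain ⟨φ, hφ, h01, hφF, hφK⟩ := aux_sep hFc hKcl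
      (Set.disjoint_left.2 fun x hx hxK => hFB hx (hKB hxK))
    set S : Set X := (B \ K) ∪ (Bᶜ \ F) with hSdef
    have hSm : MeasurableSet S :=
      (hB.diff hKcl.measurableSet).union (hB.compl.diff hFcl.measurableSet)
    have hμS : μ.real S ≤ 2 * δ := by
      have a1 : μ.real (B \ K) ≤ δ := ENNReal.toReal_le_of_le_ofReal hδ0.le hK.le
      have a2 : μ.real (Bᶜ \ F) ≤ δ := ENNReal.toReal_le_of_le_ofReal hδ0.le hF.le
      have a3 := measureReal_union_le (μ := μ) (B \ K) (Bᶜ \ F)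
      linarith
    have h1 : ∀ x, x ∉ S → x ∈ B → φ x = 1 := fun x hx hxB => hφK x (by
      by_contra h
      exact hx (Or.inl ⟨hxB, h⟩))
    have h0 : ∀ x, x ∉ S → x ∉ B → φ x = 0 := fun x hx hxB => hφF x (by
      by_contra h
      exact hx (Or.inr ⟨hxB, h⟩))
    have hsmall : ‖f‖ * μ.real S ≤ ε / 4 := by
      have b1 : ‖f‖ * μ.real S ≤ (‖f‖ + 1) * (2 * δ) := by
        gcongr
        linarith
      have b2 : (‖f‖ + 1) * (2 * δ) = ε / 4 := by
        rw [hδ]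
        field_simp
        norm_num
      linarith
    have hn := fun n => (aux_est μ (π n) (hπr n) (hproj n) B S hB hSm φ hφ h01 h1 h0 f
      f.continuous ‖f‖ hC).trans hsmall
    have hl := (aux_est μ πl hπlr hprojl B S hB hSm φ hφ h01 h1 h0 f
      f.continuous ‖f‖ hC).trans hsmall
    have hgb : ∀ p : X × Y, ‖f p * φ p.1‖ ≤ ‖f‖ := fun p => by
      rw [Real.norm_eq_abs, abs_mul, abs_of_nonneg (h01 p.1).1]
      exact (mul_le_of_le_one_right (abs_nonneg _) (h01 p.1).2).trans (hC p)
    have hg := hconv (BoundedContinuousFunction.ofNormedAddCommGroup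
      (fun p : X × Y => f p * φ p.1) (f.continuous.mul (hφ.comp continuous_fst)) ‖f‖ hgb)
    simp only [BoundedContinuousFunction.coe_ofNormedAddCommGroup] at hg
    obtain ⟨N, hN⟩ := Metric.tendsto_atTop.1 hg (ε / 4) (by positivity)
    refine ⟨N, fun n hnN => ?_⟩
    have c1 := abs_le.1 (hn n)
    have c2 := abs_le.1 hl
    have c3 := hN n hnN
    rw [Real.dist_eq, abs_lt] at c3 ⊢
    constructor <;> linarith [c1.1, c1.2, c2.1, c2.2, c3.1, c3.2]
  refine ⟨main, fun g => ?_⟩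
  have := main (g.compContinuous ⟨Prod.snd, continuous_snd⟩)
  have e : ∀ ρ : Measure (X × Y), ∫ y, g y ∂(ρ.map Prod.snd) = ∫ p, g p.2 ∂ρ := fun ρ =>
    integral_map measurable_snd.aemeasurable g.continuous.measurable.aestronglyMeasurable
  simp only [e]
  exact this
end
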